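/- There is an absolute constant c such that for every K > 0 there exists N with the following property for all n ≥ N: if P is a set of n points in ℝ² determining at most Kn² ordinary generalised circles, then there exist t, u, v ∈ ℝ and a nonzero real polynomial q(x,y) of degree at most 2 such that all but at most cK points (x,y) of P satisfy t(x² + y²)² + (ux + vy)(x² + y²) + q(x,y) = 0 (that is, all but at most cK points of P lie on a bicircular quartic curve). -/

import Mathlib

noncomputable section

/-- A circle in the plane `ℝ² ≅ ℂ`: the set of points at a fixed positive
distance from a fixed centre. -/
def IsCircle (s : Set ℂ) : Prop :=
  ∃ (c : ℂ) (ρ : ℝ), 0 < ρ ∧ s = Metric.sphere c ρ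

/-- A line in the plane `ℝ² ≅ ℂ`. -/
def IsLine (s : Set ℂ) : Prop :=
  ∃ a d : ℂ, d ≠ 0 ∧ s = {z : ℂ | ∃ t : ℝ, z = a + t • d}

/-- A generalised circle is a circle or a line. -/
def IsGenCircle (s : Set ℂ) : Prop :=
  IsCircle s ∨ IsLine s

/-- The number of ordinary circles of a planar point set `P`:
circles containing exactly three points of `P`. -/
def ordinaryCircles (P : Set ℂ) : ℕ :=
  {C : Set ℂ | IsCircle C ∧ (C ∩ P).ncard = 3}.ncard

/-- The number of ordinary generalised circles of a planar point set `P`: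
generalised circles containing exactly three points of `P`. -/
def ordinaryGenCircles (P : Set ℂ) : ℕ :=
  {C : Set ℂ | IsGenCircle C ∧ (C ∩ P).ncard = 3}.ncard

/-- The number of 4-point generalised circles of a planar point set `P`:
generalised circles containing exactly four points of `P`. -/
def fourPointGenCircles (P : Set ℂ) : ℕ :=
  {C : Set ℂ | IsGenCircle C ∧ (C ∩ P).ncard = 4}.ncard

/-- The sign of a real number as a unit, with the convention `sg 0 = -1`. -/
def sg (t : ℝ) : ℤˣ := if 0 < t then 1 else -1

lemma sg_of_pos {t : ℝ} (h : 0 < t) : sg t = 1 := if_pos h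

lemma sg_of_neg {t : ℝ} (h : t < 0) : sg t = -1 := if_neg h.not_gt

lemma sg_eq_one {t : ℝ} : sg t = 1 ↔ 0 < t := by
  unfold sg; split_ifs with h <;> simp [h]

lemma sg_eq_neg_one {t : ℝ} (ht : t ≠ 0) : sg t = -1 ↔ t < 0 := by
  unfold sg
  rcases lt_or_gt_of_ne ht with h | h
  · simp [h, h.not_gt]
  · simp [h, h.not_gt]

lemma sg_mul {a b : ℝ} (ha : a ≠ 0) (hb : b ≠ 0) : sg (a * b) = sg a * sg b := by
  rcases lt_or_gt_of_ne ha with h | h <;> rcases lt_or_gt_of_ne hb with h' | h'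
  · rw [sg_of_pos (mul_pos_of_neg_of_neg h h'), sg_of_neg h, sg_of_neg h']; rfl
  · rw [sg_of_neg (mul_neg_of_neg_of_pos h h'), sg_of_neg h, sg_of_pos h']; rfl
  · rw [sg_of_neg (mul_neg_of_pos_of_neg h h'), sg_of_pos h, sg_of_neg h']; rfl
  · rw [sg_of_pos (mul_pos h h'), sg_of_pos h, sg_of_pos h']; rfl

lemma sg_sub_comm {a b : ℝ} (h : a ≠ b) : sg (a - b) = -sg (b - a) := by
  rcases lt_or_gt_of_ne h with h | h
  · rw [sg_of_neg (sub_neg.2 h), sg_of_pos (sub_pos.2 h)]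
  · rw [sg_of_neg (sub_neg.2 h), sg_of_pos (sub_pos.2 h)]; rfl

lemma units_mul_self (a : ℤˣ) : a * a = 1 := Int.units_mul_self a

section CycNext

variable {α : Type*}

/-- `t'` follows `t` in the cyclic order of the set `S` sorted by `key`, in the direction `ε`;
`κ = -1` when the step passes through infinity. -/
structure CycNext (S : Finset α) (key : α → ℝ) (ε : ℤˣ) (t t' : α) (κ : ℤˣ) : Prop where
  mem : t' ∈ S
  ne : t' ≠ t
  sgn : sg (key t' - key t) = κ * ε
  btw : ∀ s ∈ S, s ≠ t → s ≠ t' → sg (key s - key t) * sg (key s - key t') = κ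

variable {S : Finset α} {key : α → ℝ} {ε κ κ' : ℤˣ} {t t' t'' : α}

lemma CycNext.neg_key (hk : Set.InjOn key S) (ht : t ∈ S)
    (h : CycNext S (fun s => -key s) ε t t' κ) :
    CycNext S key (-ε) t t' κ := by
  have hne : ∀ a ∈ S, ∀ b ∈ S, a ≠ b → sg (key a - key b) = -sg (-key a - -key b) := by
    intro a ha b hb hab
    have : key a ≠ key b := fun e => hab (hk ha hb e)
    rw [sg_sub_comm this]
    congr 2; ring
  refine ⟨h.mem, h.ne, ?_, fun s hs h1 h2 => ?_⟩
  · rw [hne _ h.mem _ ht h.ne, h.sgn, mul_neg]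
  · rw [hne _ hs _ ht h1, hne _ hs _ h.mem h2, neg_mul_neg]
    exact h.btw s hs h1 h2

lemma CycNext.exists (hk : Set.InjOn key S) (ht : t ∈ S) (h2 : ∃ s ∈ S, s ≠ t) (ε : ℤˣ) :
    ∃ t' κ, CycNext S key ε t t' κ := by
  classical
  suffices H : ∀ key : α → ℝ, Set.InjOn key S → ∃ t' κ, CycNext S key 1 t t' κ by
    rcases Int.units_eq_one_or ε with rfl | rfl
    · exact H key hk
    · obtain ⟨t', κ, h⟩ := H (fun s => -key s) (fun a ha b hb e => hk ha hb (neg_injective e))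
      exact ⟨t', κ, h.neg_key hk ht⟩
  intro key hk
  have hlt : ∀ a ∈ S, ∀ b ∈ S, a ≠ b → key a < key b ∨ key b < key a := fun a ha b hb hab =>
    lt_or_gt_of_ne fun e => hab (hk ha hb e)
  by_cases h : (S.filter (fun s => key t < key s)).Nonempty
  · obtain ⟨t', h', hmin⟩ := Finset.exists_min_image _ key h
    rw [Finset.mem_filter] at h'
    refine ⟨t', 1, h'.1, ?_, ?_, fun s hs h1 h2 => ?_⟩
    · rintro rfl; exact lt_irrefl _ h'.2
    · rw [sg_of_pos (sub_pos.2 h'.2)]; rfl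
    · rcases hlt s hs t ht h1 with h3 | h3
      · rw [sg_of_neg (sub_neg.2 h3), sg_of_neg (sub_neg.2 (h3.trans h'.2))]; rfl
      · have h4 : key t' < key s := by
          rcases hlt s hs t' h'.1 h2 with h4 | h4
          · exact absurd (hmin s (Finset.mem_filter.2 ⟨hs, h3⟩)) h4.not_ge
          · exact h4
        rw [sg_of_pos (sub_pos.2 h3), sg_of_pos (sub_pos.2 h4)]; rfl
  · obtain ⟨s0, hs0, hs0t⟩ := h2
    have hbelow : ∀ s ∈ S, s ≠ t → key s < key t := fun s hs hst =>
      (hlt s hs t ht hst).resolve_right fun h3 => h ⟨s, Finset.mem_filter.2 ⟨hs, h3⟩⟩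
    obtain ⟨t', h', hmin⟩ := Finset.exists_min_image (S.erase t) key
      ⟨s0, Finset.mem_erase.2 ⟨hs0t, hs0⟩⟩
    rw [Finset.mem_erase] at h'
    refine ⟨t', -1, h'.2, h'.1, ?_, fun s hs h1 h2 => ?_⟩
    · rw [sg_of_neg (sub_neg.2 (hbelow t' h'.2 h'.1))]; rfl
    · have h4 : key t' < key s := by
        rcases hlt s hs t' h'.2 h2 with h4 | h4
        · exact absurd (hmin s (Finset.mem_erase.2 ⟨h1, hs⟩)) h4.not_ge
        · exact h4
      rw [sg_of_neg (sub_neg.2 (hbelow s hs h1)), sg_of_pos (sub_pos.2 h4)]; rfl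

lemma CycNext.unique (hk : Set.InjOn key S) (h : CycNext S key ε t t' κ)
    (h' : CycNext S key ε t t'' κ') : t' = t'' ∧ κ = κ' := by
  have ht : t' = t'' := by
    by_contra hne
    have hk' : key t' ≠ key t'' := fun e => hne (hk h.mem h'.mem e)
    have e1 := h.btw t'' h'.mem h'.ne (Ne.symm hne)
    have e2 := h'.btw t' h.mem h.ne hne
    rw [h'.sgn] at e1
    rw [h.sgn, sg_sub_comm hk'] at e2
    generalize sg (key t'' - key t') = a at e1 e2
    revert e1 e2
    clear h h' hk
    revert a κ κ' ε
    decide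
  subst ht
  exact ⟨rfl, mul_right_cancel (h.sgn.symm.trans h'.sgn)⟩

lemma CycNext.symm (hk : Set.InjOn key S) (ht : t ∈ S) (h : CycNext S key ε t t' κ) :
    CycNext S key (-ε) t' t κ := by
  refine ⟨ht, h.ne.symm, ?_, fun s hs h1 h2 => ?_⟩
  · rw [sg_sub_comm fun e => h.ne.symm (hk ht h.mem e), h.sgn, mul_neg]
  · rw [mul_comm]; exact h.btw s hs h2 h1

/-- In a three-element set the cyclic successor of `t'` is the remaining element. -/
lemma CycNext.third (hk : Set.InjOn key S) (ht : t ∈ S) (hu : t'' ∈ S)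
    (hut : t'' ≠ t) (hut' : t'' ≠ t')
    (hS : ∀ s ∈ S, s = t ∨ s = t' ∨ s = t'') (h : CycNext S key ε t t' κ) :
    CycNext S key ε t' t'' (sg (key t'' - key t') * ε) := by
  refine ⟨hu, hut', ?_, fun s hs h1 h2 => ?_⟩
  · rw [mul_assoc, units_mul_self, mul_one]
  · have hst : s = t := by
      rcases hS s hs with h3 | h3 | h3
      · exact h3
      · exact absurd h3 h1
      · exact absurd h3 h2
    subst hst
    have e1 := h.btw _ hu hut hut'
    rw [sg_sub_comm fun e => h.ne.symm (hk ht h.mem e), h.sgn,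
      sg_sub_comm fun e => hut.symm (hk ht hu e)]
    generalize sg (key t'' - key t') = a at e1 ⊢
    generalize sg (key t'' - key s) = b at e1 ⊢
    clear h
    revert e1
    revert a b κ ε
    decide

/-- A nonempty set closed under the cyclic successor is everything. -/
lemma CycNext.closed_eq (hk : Set.InjOn key S) {U : Finset α} (hUS : U ⊆ S) (hU : U.Nonempty)
    (hcl : ∀ t ∈ U, ∀ t' κ, CycNext S key ε t t' κ → t' ∈ U)
    (hex : ∀ t ∈ S, ∃ t' κ, CycNext S key ε t t' κ) : U = S := by
  classical
  have aux : ∀ key : α → ℝ, Set.InjOn key S →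
      (∀ t ∈ U, ∃ t' ∈ U, ∃ κ, CycNext S key 1 t t' κ) → U = S := by
    intro key hk hcl
    refine hUS.antisymm fun s hs => ?_
    by_contra hsU
    have hne : ∀ t ∈ U, t ≠ s := fun t ht e => hsU (e ▸ ht)
    have hlt : ∀ t ∈ U, key t < key s ∨ key s < key t := fun t ht =>
      lt_or_gt_of_ne fun e => hne t ht (hk (hUS ht) hs e)
    by_cases h : (U.filter (fun t => key t < key s)).Nonempty
    · obtain ⟨t, ht, hmax⟩ := Finset.exists_max_image _ key h
      rw [Finset.mem_filter] at ht
      obtain ⟨t', ht', κ, hn⟩ := hcl t ht.1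
      have e := hn.btw s hs (hne t ht.1).symm (hne t' ht').symm
      have e2 := hn.sgn
      rw [sg_of_pos (sub_pos.2 ht.2), one_mul] at e
      rw [mul_one] at e2
      rcases hlt t' ht' with h3 | h3
      · have h4 := hmax t' (Finset.mem_filter.2 ⟨ht', h3⟩)
        rw [sg_of_pos (sub_pos.2 h3)] at e
        rw [← e, sg_eq_one] at e2
        linarith
      · rw [sg_of_neg (sub_neg.2 h3)] at e
        rw [← e, sg_eq_neg_one (by linarith)] at e2
        linarith
    · obtain ⟨t, ht, hmax⟩ := Finset.exists_max_image _ key hU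
      obtain ⟨t', ht', κ, hn⟩ := hcl t ht
      have hab : ∀ t ∈ U, key s < key t := fun t ht => (hlt t ht).resolve_left
        fun h3 => h ⟨t, Finset.mem_filter.2 ⟨ht, h3⟩⟩
      have e := hn.btw s hs (hne t ht).symm (hne t' ht').symm
      have e2 := hn.sgn
      rw [sg_of_neg (sub_neg.2 (hab t ht)), sg_of_neg (sub_neg.2 (hab t' ht'))] at e
      rw [← e, mul_one] at e2
      have := sg_eq_one.1 (e2.trans (by decide))
      linarith [hmax t' ht']
  rcases Int.units_eq_one_or ε with rfl | rfl
  · exact aux key hk fun t ht => by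
      obtain ⟨t', κ, h⟩ := hex t (hUS ht)
      exact ⟨t', hcl t ht t' κ h, κ, h⟩
  · refine aux (fun s => -key s) (fun a ha b hb e => hk ha hb (neg_injective e)) fun t ht => ?_
    obtain ⟨t', κ, h⟩ := hex t (hUS ht)
    refine ⟨t', hcl t ht t' κ h, κ, ?_⟩
    have h' : CycNext S (fun s => - -key s) (-1) t t' κ := by simpa using h
    simpa using h'.neg_key (key := fun s => -key s)
      (fun a ha b hb e => hk ha hb (neg_injective e)) (hUS ht)

end CycNext

/-- The point `v` lies on the non-vertical line dual to `p`. -/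
def On (v : ℝ × ℝ) (p : ℂ) : Prop := v.2 = p.re * v.1 + p.im

/-- The intersection of two dual lines. -/
def meet (p q : ℂ) : ℝ × ℝ :=
  ((q.im - p.im) / (p.re - q.re), p.re * ((q.im - p.im) / (p.re - q.re)) + p.im)

lemma on_meet_left (p q : ℂ) : On (meet p q) p := rfl

lemma on_meet_right {p q : ℂ} (h : p.re ≠ q.re) : On (meet p q) q := by
  have : p.re - q.re ≠ 0 := sub_ne_zero.2 h
  unfold On meet
  field_simp
  ring

lemma On.fst_eq {v : ℝ × ℝ} {p q : ℂ} (h : p.re ≠ q.re) (hp : On v p) (hq : On v q) :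
    v = meet p q := by
  have h' : p.re - q.re ≠ 0 := sub_ne_zero.2 h
  unfold On at hp hq
  have : v.1 = (q.im - p.im) / (p.re - q.re) := by
    rw [eq_div_iff h']; linarith
  exact Prod.ext this (by rw [hp, this]; rfl)

lemma On.eq_of_fst {u v : ℝ × ℝ} {p : ℂ} (hu : On u p) (hv : On v p) (h : u.1 = v.1) : u = v :=
  Prod.ext h (by unfold On at hu hv; rw [hu, hv, h])

lemma eq_of_re_eq {v : ℝ × ℝ} {p q : ℂ} (h : p.re = q.re) (hp : On v p) (hq : On v q) : p = q := by
  unfold On at hp hq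
  rw [h] at hp
  exact Complex.ext h (by linarith)

/-- Two distinct dual lines have at most one common point. -/
lemma On.unique {u v : ℝ × ℝ} {p q : ℂ} (hpq : p ≠ q) (hup : On u p) (huq : On u q)
    (hvp : On v p) (hvq : On v q) : u = v := by
  have h : p.re ≠ q.re := fun e => hpq (eq_of_re_eq e hup huq)
  rw [On.fst_eq h hup huq, On.fst_eq h hvp hvq]

/-- A finite planar point set with distinct real parts, not on a line; the points are viewed as
the lines of the dual arrangement. -/
structure Arrangement where
  /-- the points -/
  pts : Finset ℂ
  inj : Set.InjOn Complex.re pts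
  noncol : ∀ v : ℝ × ℝ, ∃ p ∈ pts, ¬ On v p

namespace Arrangement

open Classical in
/-- The vertices of the dual arrangement. -/
def verts (A : Arrangement) : Finset (ℝ × ℝ) := A.pts.offDiag.image fun pq => meet pq.1 pq.2

open Classical in
/-- The lines through a vertex. -/
def thru (A : Arrangement) (v : ℝ × ℝ) : Finset ℂ := A.pts.filter (On v)

open Classical in
/-- The vertices on a line. -/
def onV (A : Arrangement) (p : ℂ) : Finset (ℝ × ℝ) := A.verts.filter fun v => On v p

variable (A : Arrangement)

lemma mem_thru {v : ℝ × ℝ} {p : ℂ} : p ∈ A.thru v ↔ p ∈ A.pts ∧ On v p := by simp [thru]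

lemma mem_onV {v : ℝ × ℝ} {p : ℂ} : v ∈ A.onV p ↔ v ∈ A.verts ∧ On v p := by simp [onV]

variable {A}

lemma re_ne {p q : ℂ} (hp : p ∈ A.pts) (hq : q ∈ A.pts) (h : p ≠ q) : p.re ≠ q.re :=
  fun e => h (A.inj hp hq e)

lemma meet_mem {p q : ℂ} (hp : p ∈ A.pts) (hq : q ∈ A.pts) (h : p ≠ q) : meet p q ∈ A.verts := by
  classical
  exact Finset.mem_image.2 ⟨(p, q), Finset.mem_offDiag.2 ⟨hp, hq, h⟩, rfl⟩

lemma mem_verts {v : ℝ × ℝ} :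
    v ∈ A.verts ↔ ∃ p ∈ A.pts, ∃ q ∈ A.pts, p ≠ q ∧ On v p ∧ On v q := by
  classical
  constructor
  · intro h
    obtain ⟨⟨p, q⟩, h', rfl⟩ := Finset.mem_image.1 h
    obtain ⟨hp, hq, hne⟩ := Finset.mem_offDiag.1 h'
    exact ⟨p, hp, q, hq, hne, rfl, on_meet_right (re_ne hp hq hne)⟩
  · rintro ⟨p, hp, q, hq, hne, h1, h2⟩
    rw [On.fst_eq (re_ne hp hq hne) h1 h2]
    exact meet_mem hp hq hne

lemma exists_other_thru {v : ℝ × ℝ} (hv : v ∈ A.verts) (p : ℂ) : ∃ q ∈ A.thru v, q ≠ p := by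
  obtain ⟨a, ha, b, hb, hab, h1, h2⟩ := mem_verts.1 hv
  by_cases h : a = p
  · exact ⟨b, A.mem_thru.2 ⟨hb, h2⟩, fun e => hab (h.trans e.symm)⟩
  · exact ⟨a, A.mem_thru.2 ⟨ha, h1⟩, h⟩

lemma exists_other_onV {p : ℂ} (hp : p ∈ A.pts) (v : ℝ × ℝ) : ∃ u ∈ A.onV p, u ≠ v := by
  by_cases hv : On v p
  · obtain ⟨r, hr, hvr⟩ := A.noncol v
    have hne : p ≠ r := by rintro rfl; exact hvr hv
    refine ⟨meet p r, A.mem_onV.2 ⟨meet_mem hp hr hne, rfl⟩, ?_⟩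
    rintro rfl
    exact hvr (on_meet_right (re_ne hp hr hne))
  · obtain ⟨r, hr, hvr⟩ := A.noncol (0, p.im)
    have h0 : On (0, p.im) p := by simp [On]
    have hne : p ≠ r := by rintro rfl; exact hvr h0
    refine ⟨meet p r, A.mem_onV.2 ⟨meet_mem hp hr hne, rfl⟩, ?_⟩
    rintro rfl
    exact hv rfl

lemma injOn_thru (v : ℝ × ℝ) : Set.InjOn Complex.re (A.thru v) := fun _ ha _ hb e =>
  A.inj (A.mem_thru.1 ha).1 (A.mem_thru.1 hb).1 e

lemma injOn_onV (p : ℂ) : Set.InjOn (Prod.fst : ℝ × ℝ → ℝ) (A.onV p) := fun _ ha _ hb e =>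
  (A.mem_onV.1 ha).2.eq_of_fst (A.mem_onV.1 hb).2 e

variable (A)

/-- A flag: a vertex on a line, with a direction along the line and a side of it. -/
@[ext] structure Flag where
  /-- the vertex -/
  v : ℝ × ℝ
  /-- the line -/
  p : ℂ
  /-- the direction -/
  d : ℤˣ
  /-- the side -/
  s : ℤˣ
  hv : v ∈ A.verts
  hp : p ∈ A.pts
  on : On v p

variable {A}

instance : Finite A.Flag := by
  refine Finite.of_injective (β := A.verts × A.pts × ℤˣ × ℤˣ)
    (fun f => (⟨f.v, f.hv⟩, ⟨f.p, f.hp⟩, f.d, f.s)) ?_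
  intro f g h
  simp only [Prod.mk.injEq, Subtype.mk.injEq] at h
  exact Flag.ext h.1 h.2.1 h.2.2.1 h.2.2.2

instance : Fintype A.Flag := Fintype.ofFinite _

namespace Flag

lemma mem_thru (f : A.Flag) : f.p ∈ A.thru f.v := A.mem_thru.2 ⟨f.hp, f.on⟩

lemma mem_onV (f : A.Flag) : f.v ∈ A.onV f.p := A.mem_onV.2 ⟨f.hv, f.on⟩

lemma exists_next_onV (f : A.Flag) :
    ∃ t' κ, CycNext (A.onV f.p) Prod.fst f.d f.v t' κ :=
  CycNext.exists (injOn_onV _) f.mem_onV (exists_other_onV f.hp _) _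

lemma exists_next_thru (f : A.Flag) :
    ∃ t' κ, CycNext (A.thru f.v) Complex.re (f.d * f.s) f.p t' κ :=
  CycNext.exists (injOn_thru _) f.mem_thru (exists_other_thru f.hv _) _

/-- Move along the line to the next vertex. -/
def σ₀ (f : A.Flag) : A.Flag where
  v := f.exists_next_onV.choose
  p := f.p
  d := -f.d
  s := f.exists_next_onV.choose_spec.choose * f.s
  hv := (A.mem_onV.1 f.exists_next_onV.choose_spec.choose_spec.mem).1
  hp := f.hp
  on := (A.mem_onV.1 f.exists_next_onV.choose_spec.choose_spec.mem).2

/-- Turn around the vertex to the next line. -/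
def σ₁ (f : A.Flag) : A.Flag where
  v := f.v
  p := f.exists_next_thru.choose
  d := f.exists_next_thru.choose_spec.choose * f.d
  s := -f.exists_next_thru.choose_spec.choose * f.s
  hv := f.hv
  hp := (A.mem_thru.1 f.exists_next_thru.choose_spec.choose_spec.mem).1
  on := (A.mem_thru.1 f.exists_next_thru.choose_spec.choose_spec.mem).2

/-- Change the side of the line. -/
def σ₂ (f : A.Flag) : A.Flag := { f with s := -f.s }

/-- The opposite flag. -/
def opp (f : A.Flag) : A.Flag := { f with d := -f.d, s := -f.s }

lemma σ₀_spec (f : A.Flag) :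
    CycNext (A.onV f.p) Prod.fst f.d f.v f.σ₀.v (f.σ₀.s * f.s) := by
  have := f.exists_next_onV.choose_spec.choose_spec
  rwa [show f.σ₀.s * f.s = f.exists_next_onV.choose_spec.choose by
    rw [σ₀, mul_assoc, units_mul_self, mul_one]]

lemma σ₁_spec (f : A.Flag) :
    CycNext (A.thru f.v) Complex.re (f.d * f.s) f.p f.σ₁.p (f.σ₁.d * f.d) := by
  have := f.exists_next_thru.choose_spec.choose_spec
  rwa [show f.σ₁.d * f.d = f.exists_next_thru.choose_spec.choose by
    rw [σ₁, mul_assoc, units_mul_self, mul_one]]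

@[simp] lemma σ₀_p (f : A.Flag) : f.σ₀.p = f.p := rfl
@[simp] lemma σ₀_d (f : A.Flag) : f.σ₀.d = -f.d := rfl
@[simp] lemma σ₁_v (f : A.Flag) : f.σ₁.v = f.v := rfl
lemma σ₁_s (f : A.Flag) : f.σ₁.s = -(f.σ₁.d * f.d) * f.s := by
  rw [show f.σ₁.d * f.d = f.exists_next_thru.choose_spec.choose by
    rw [σ₁, mul_assoc, units_mul_self, mul_one]]
  rfl
@[simp] lemma σ₂_v (f : A.Flag) : f.σ₂.v = f.v := rfl
@[simp] lemma σ₂_p (f : A.Flag) : f.σ₂.p = f.p := rfl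
@[simp] lemma σ₂_d (f : A.Flag) : f.σ₂.d = f.d := rfl
@[simp] lemma σ₂_s (f : A.Flag) : f.σ₂.s = -f.s := rfl
@[simp] lemma opp_v (f : A.Flag) : f.opp.v = f.v := rfl
@[simp] lemma opp_p (f : A.Flag) : f.opp.p = f.p := rfl
@[simp] lemma opp_d (f : A.Flag) : f.opp.d = -f.d := rfl
@[simp] lemma opp_s (f : A.Flag) : f.opp.s = -f.s := rfl

lemma eq_σ₀ {f g : A.Flag} {κ : ℤˣ} (hp : g.p = f.p) (hd : g.d = -f.d) (hs : g.s = κ * f.s)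
    (h : CycNext (A.onV f.p) Prod.fst f.d f.v g.v κ) : g = f.σ₀ := by
  obtain ⟨h1, h2⟩ := h.unique (injOn_onV _) f.σ₀_spec
  refine Flag.ext h1 hp hd ?_
  rw [hs, h2, mul_assoc, units_mul_self, mul_one]

lemma eq_σ₁ {f g : A.Flag} {κ : ℤˣ} (hv : g.v = f.v) (hd : g.d = κ * f.d) (hs : g.s = -κ * f.s)
    (h : CycNext (A.thru f.v) Complex.re (f.d * f.s) f.p g.p κ) : g = f.σ₁ := by
  obtain ⟨h1, h2⟩ := h.unique (injOn_thru _) f.σ₁_spec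
  refine Flag.ext hv h1 ?_ ?_
  · rw [hd, h2, mul_assoc, units_mul_self, mul_one]
  · rw [hs, σ₁_s, h2]

@[simp] lemma σ₀_σ₀ (f : A.Flag) : f.σ₀.σ₀ = f := by
  refine (eq_σ₀ (f := f.σ₀) (g := f) (κ := f.σ₀.s * f.s) rfl ?_ ?_ ?_).symm
  · simp
  · rw [mul_comm f.σ₀.s, mul_assoc, units_mul_self, mul_one]
  · exact f.σ₀_spec.symm (injOn_onV _) f.mem_onV

@[simp] lemma σ₁_σ₁ (f : A.Flag) : f.σ₁.σ₁ = f := by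
  refine (eq_σ₁ (f := f.σ₁) (g := f) (κ := f.σ₁.d * f.d) rfl ?_ ?_ ?_).symm
  · rw [mul_comm f.σ₁.d, mul_assoc, units_mul_self, mul_one]
  · rw [σ₁_s]
    generalize f.σ₁.d = a; generalize f.d = b; generalize f.s = c
    revert a b c; decide
  · rw [σ₁_s]
    have := f.σ₁_spec.symm (injOn_thru _) f.mem_thru
    rwa [show f.σ₁.d * (-(f.σ₁.d * f.d) * f.s) = -(f.d * f.s) by
      generalize f.σ₁.d = a; generalize f.d = b; generalize f.s = c
      revert a b c; decide]

@[simp] lemma σ₂_σ₂ (f : A.Flag) : f.σ₂.σ₂ = f := by ext <;> simp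
@[simp] lemma opp_opp (f : A.Flag) : f.opp.opp = f := by ext <;> simp
lemma opp_σ₂ (f : A.Flag) : f.opp.σ₂ = f.σ₂.opp := rfl

lemma σ₂_σ₀ (f : A.Flag) : f.σ₀.σ₂ = f.σ₂.σ₀ := by
  refine eq_σ₀ (κ := f.σ₀.s * f.s) rfl rfl ?_ f.σ₀_spec
  simp [mul_assoc]

lemma opp_σ₁ (f : A.Flag) : f.σ₁.opp = f.opp.σ₁ := by
  refine eq_σ₁ (κ := f.σ₁.d * f.d) rfl ?_ ?_ ?_
  · simp [mul_assoc]
  · simp [σ₁_s]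
  · simpa using f.σ₁_spec

/-- If exactly three lines pass through the vertex, six successive turns lead to the opposite
flag. -/
lemma turn_three (f : A.Flag) (h3 : (A.thru f.v).card = 3) :
    f.σ₁.σ₂.σ₁.σ₂.σ₁.σ₂ = f.opp := by
  have h1 := f.σ₁_spec
  obtain ⟨u, hu, hup, hup'⟩ : ∃ u ∈ A.thru f.v, u ≠ f.p ∧ u ≠ f.σ₁.p := by
    classical
    by_contra! hcon
    have : A.thru f.v ⊆ {f.p, f.σ₁.p} := fun u hu => by
      by_cases h : u = f.p
      · simp [h]
      · simp [hcon u hu h]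
    have := (Finset.card_le_card this).trans Finset.card_le_two
    omega
  have hS : ∀ s ∈ A.thru f.v, s = f.p ∨ s = f.σ₁.p ∨ s = u := by
    classical
    have hsub : ({f.p, f.σ₁.p, u} : Finset ℂ) ⊆ A.thru f.v := by
      intro s hs
      simp only [Finset.mem_insert, Finset.mem_singleton] at hs
      rcases hs with rfl | rfl | rfl
      exacts [f.mem_thru, h1.mem, hu]
    have hcard : ({f.p, f.σ₁.p, u} : Finset ℂ).card = 3 := by
      rw [Finset.card_eq_three]
      exact ⟨_, _, _, h1.ne.symm, hup.symm, hup'.symm, rfl⟩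
    have := Finset.eq_of_subset_of_card_le hsub (by omega)
    intro s hs
    rw [← this] at hs
    simpa using hs
  have hinj := injOn_thru (A := A) f.v
  have h2 := h1.third hinj f.mem_thru hu hup hup' hS
  have h3 := h2.third hinj h1.mem f.mem_thru h1.ne.symm hup.symm
    (fun s hs => by rcases hS s hs with h | h | h <;> simp [h])
  set κ₁ := f.σ₁.d * f.d
  set κ₂ := sg (u.re - f.σ₁.p.re) * (f.d * f.s)
  set κ₃ := sg (f.p.re - u.re) * (f.d * f.s)
  have hκ : κ₁ * κ₂ * κ₃ = -1 := by
    have e := h1.btw u hu hup hup'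
    have e' : sg (f.p.re - u.re) = -sg (u.re - f.p.re) :=
      sg_sub_comm (re_ne f.hp (A.mem_thru.1 hu).1 hup.symm)
    change _ = κ₁ at e
    rw [← e]
    simp only [κ₂, κ₃, e']
    generalize sg (u.re - f.σ₁.p.re) = a
    generalize sg (u.re - f.p.re) = b
    generalize f.d * f.s = c
    revert a b c; decide
  have hu' := A.mem_thru.1 hu
  let f₁ : A.Flag := ⟨f.v, f.σ₁.p, κ₁ * f.d, κ₁ * f.s, f.hv, f.σ₁.hp, f.σ₁.on⟩
  let f₂ : A.Flag := ⟨f.v, u, κ₂ * κ₁ * f.d, κ₂ * κ₁ * f.s, f.hv, hu'.1, hu'.2⟩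
  let f₃ : A.Flag := ⟨f.v, f.p, κ₃ * κ₂ * κ₁ * f.d, κ₃ * κ₂ * κ₁ * f.s, f.hv, f.hp, f.on⟩
  have hδ : ∀ a : ℤˣ, a * f.d * (a * f.s) = f.d * f.s := fun a => by
    rw [mul_mul_mul_comm, units_mul_self, one_mul]
  have e1 : f.σ₁.σ₂ = f₁ := by
    rw [← eq_σ₁ (f := f) (g := f₁.σ₂) (κ := κ₁) rfl rfl (by simp [f₁]) h1, σ₂_σ₂]
  have e2 : f₁.σ₁.σ₂ = f₂ := by
    rw [← eq_σ₁ (f := f₁) (g := f₂.σ₂) (κ := κ₂) rfl (by simp [f₁, f₂, mul_assoc])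
      (by simp [f₁, f₂, mul_assoc]) (by simp only [f₁, hδ]; exact h2), σ₂_σ₂]
  have e3 : f₂.σ₁.σ₂ = f₃ := by
    rw [← eq_σ₁ (f := f₂) (g := f₃.σ₂) (κ := κ₃) rfl (by simp [f₂, f₃, mul_assoc])
      (by simp [f₂, f₃, mul_assoc]) (by simp only [f₂, hδ]; exact h3), σ₂_σ₂]
  rw [e1, e2, e3]
  have : κ₃ * κ₂ * κ₁ = -1 := by
    rw [← hκ]
    clear_value κ₁ κ₂ κ₃
    ac_rfl
  ext <;> simp [f₃, this]

end Flag

end Arrangement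

namespace Arrangement

variable {A : Arrangement}

namespace Flag

open Classical in
/-- The position of a flag relative to the line dual to `r`. -/
def side (f : A.Flag) (r : ℂ) : ℤˣ :=
  if r = f.p then f.s else
    if On f.v r then sg (f.p.re - r.re) * f.d else sg (f.v.2 - (r.re * f.v.1 + r.im))

lemma side_self (f : A.Flag) : f.side f.p = f.s := if_pos rfl

lemma side_on (f : A.Flag) {r : ℂ} (h : r ≠ f.p) (hr : On f.v r) :
    f.side r = sg (f.p.re - r.re) * f.d := by rw [side, if_neg h, if_pos hr]

lemma side_off (f : A.Flag) {r : ℂ} (hr : ¬ On f.v r) :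
    f.side r = sg (f.v.2 - (r.re * f.v.1 + r.im)) := by
  have h : r ≠ f.p := by rintro rfl; exact hr f.on
  rw [side, if_neg h, if_neg hr]

lemma side_off_eq (f : A.Flag) {r : ℂ} (hr : r ∈ A.pts) (hv : ¬ On f.v r) :
    f.side r = sg (f.p.re - r.re) * sg (f.v.1 - (meet f.p r).1) := by
  have h : f.p ≠ r := by rintro rfl; exact hv f.on
  have h1 : f.p.re - r.re ≠ 0 := sub_ne_zero.2 (re_ne f.hp hr h)
  have key : f.v.2 - (r.re * f.v.1 + r.im) = (f.p.re - r.re) * (f.v.1 - (meet f.p r).1) := by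
    have h3 := f.on
    unfold On at h3
    rw [h3]
    simp only [meet]
    field_simp
    ring
  have h2 : f.v.1 - (meet f.p r).1 ≠ 0 := fun h0 => by
    rw [h0, mul_zero] at key
    exact hv (by unfold On; linarith)
  rw [f.side_off hv, key, sg_mul h1 h2]

lemma side_σ₀ (f : A.Flag) {r : ℂ} (hr : r ∈ A.pts) :
    f.σ₀.side r = f.σ₀.s * f.s * f.side r := by
  by_cases hrp : r = f.p
  · subst hrp
    rw [side_self, ← f.σ₀_p, side_self, mul_assoc, units_mul_self, mul_one]
  have hn := f.σ₀_spec
  have hu : On (meet f.p r) r := on_meet_right (re_ne f.hp hr (Ne.symm hrp))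
  have huV : meet f.p r ∈ A.onV f.p := A.mem_onV.2 ⟨meet_mem f.hp hr (Ne.symm hrp), rfl⟩
  have hmeet : ∀ v, On v f.p → On v r → v = meet f.p r := fun v h1 h2 =>
    On.unique (Ne.symm hrp) h1 h2 rfl hu
  have hfst : ∀ v, On v f.p → ¬ On v r → v.1 ≠ (meet f.p r).1 := fun v h1 h2 e => h2 (by
    rw [On.eq_of_fst h1 (on_meet_left f.p r) e]; exact hu)
  by_cases h1 : On f.v r
  · have e := hmeet _ f.on h1
    have h2 : ¬ On f.σ₀.v r := fun h2 => hn.ne (by rw [hmeet _ f.σ₀.on h2, ← e])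
    rw [f.side_on hrp h1, f.σ₀.side_off_eq hr h2, σ₀_p, ← e, hn.sgn]
    generalize sg (f.p.re - r.re) = a
    generalize f.σ₀.s * f.s = b
    generalize f.d = c
    revert a b c; decide
  · by_cases h2 : On f.σ₀.v r
    · have e := hmeet _ f.σ₀.on h2
      rw [f.side_off_eq hr h1, f.σ₀.side_on hrp h2, σ₀_p, ← e,
        sg_sub_comm (a := f.v.1) (b := f.σ₀.v.1) (by rw [e]; exact hfst _ f.on h1), hn.sgn, σ₀_d]
      generalize sg (f.p.re - r.re) = a
      generalize f.σ₀.s * f.s = b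
      generalize f.d = c
      revert a b c; decide
    · have e := hn.btw _ huV (by rintro e; exact h1 (e ▸ hu)) (by rintro e; exact h2 (e ▸ hu))
      rw [f.side_off_eq hr h1, f.σ₀.side_off_eq hr h2, σ₀_p, ← e,
        sg_sub_comm (hfst _ f.on h1), sg_sub_comm (hfst _ f.σ₀.on h2)]
      generalize sg (f.p.re - r.re) = a
      generalize sg ((meet f.p r).1 - f.σ₀.v.1) = b
      generalize sg ((meet f.p r).1 - f.v.1) = c
      revert a b c; decide

lemma side_σ₁ (f : A.Flag) {r : ℂ} (hr : r ∈ A.pts) : f.σ₁.side r = f.side r := by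
  have hn := f.σ₁_spec
  have hs := f.σ₁_s
  by_cases hv : On f.v r
  · have hrv : r ∈ A.thru f.v := A.mem_thru.2 ⟨hr, hv⟩
    by_cases h1 : r = f.p
    · subst h1
      rw [side_self, side_on _ hn.ne.symm hv, hn.sgn]
      generalize f.σ₁.d = a
      generalize f.d = b
      generalize f.s = c
      revert a b c; decide
    · by_cases h2 : r = f.σ₁.p
      · subst h2
        rw [side_self, side_on _ h1 hv, sg_sub_comm (re_ne f.hp f.σ₁.hp hn.ne.symm), hn.sgn, hs]
        generalize f.σ₁.d = a
        generalize f.d = b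
        generalize f.s = c
        revert a b c; decide
      · rw [side_on _ h1 hv, side_on _ h2 hv, sg_sub_comm (re_ne f.hp hr (Ne.symm h1)),
          sg_sub_comm (re_ne f.σ₁.hp hr (Ne.symm h2))]
        have e := hn.btw r hrv h1 h2
        revert e
        generalize sg (r.re - f.p.re) = a
        generalize sg (r.re - f.σ₁.p.re) = b
        generalize f.σ₁.d = c
        generalize f.d = d
        revert a b c d; decide
  · rw [f.side_off hv, f.σ₁.side_off hv]; rfl

lemma side_eq_one (f : A.Flag) {r : ℂ} (h : f.side r = 1) :
    0 ≤ f.v.2 - (r.re * f.v.1 + r.im) := by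
  by_cases hv : On f.v r
  · unfold On at hv; linarith
  · rw [f.side_off hv, sg_eq_one] at h; exact h.le

lemma side_eq_neg_one (f : A.Flag) {r : ℂ} (h : f.side r = -1) :
    f.v.2 - (r.re * f.v.1 + r.im) ≤ 0 := by
  by_cases hv : On f.v r
  · unfold On at hv; linarith
  · rw [f.side_off hv, sg_eq_neg_one] at h
    · exact h.le
    · intro h0; exact hv (by unfold On; linarith)

/-- The cell of a flag in the projective plane: its position up to a global sign. -/
def cell (f : A.Flag) : A.pts × A.pts → ℤˣ := fun r => f.side r.1 * f.side r.2

lemma cell_σ₀ (f : A.Flag) : f.σ₀.cell = f.cell := by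
  funext r
  rw [cell, cell, side_σ₀ _ r.1.2, side_σ₀ _ r.2.2, mul_mul_mul_comm, units_mul_self, one_mul]

lemma cell_σ₁ (f : A.Flag) : f.σ₁.cell = f.cell := by
  funext r
  rw [cell, cell, side_σ₁ _ r.1.2, side_σ₁ _ r.2.2]

/-- A flag pointing to the right at the left end of its cell. -/
structure Corner (f : A.Flag) : Prop where
  d : f.d = 1
  s : f.s = 1
  ex : ∃ r ∈ A.thru f.v, f.p.re < r.re

lemma Corner.side_spec {f : A.Flag} (hf : f.Corner) : ∃ r ∈ A.pts, On f.v r ∧ f.p.re < r.re ∧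
    f.side r = -1 ∧ f.side f.p = 1 := by
  obtain ⟨r, hr, hlt⟩ := hf.ex
  obtain ⟨h1, h2⟩ := A.mem_thru.1 hr
  refine ⟨r, h1, h2, hlt, ?_, by rw [side_self, hf.s]⟩
  have hne : r ≠ f.p := by rintro rfl; exact lt_irrefl _ hlt
  rw [side_on _ hne h2, sg_of_neg (sub_neg.2 hlt), hf.d]; rfl

lemma Corner.side_inj {f g : A.Flag} (hf : f.Corner) (hg : g.Corner) (κ : ℤˣ)
    (h : ∀ r ∈ A.pts, g.side r = κ * f.side r) : f = g := by
  obtain ⟨r, hr, hvr, hlt, hr1, hp1⟩ := hf.side_spec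
  obtain ⟨r', hr', hvr', hlt', hr1', hp1'⟩ := hg.side_spec
  have hfp := f.on
  have hgp := g.on
  unfold On at hvr hvr' hfp hgp
  have hfr := h r hr
  have hfp1 := h f.p f.hp
  have hgr := h r' hr'
  have hgp1 := h g.p g.hp
  rw [hr1] at hfr; rw [hp1] at hfp1; rw [hr1'] at hgr; rw [hp1'] at hgp1
  rcases Int.units_eq_one_or κ with rfl | rfl
  · rw [one_mul] at hfr hfp1 hgr hgp1
    have a1 := g.side_eq_neg_one hfr
    have a2 := g.side_eq_one hfp1
    have a3 := f.side_eq_neg_one hgr.symm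
    have a4 := f.side_eq_one hgp1.symm
    have hx : f.v.1 = g.v.1 := by
      apply le_antisymm <;> nlinarith
    have hv : f.v = g.v := Prod.ext hx (by rw [hx] at hfp hvr; linarith)
    have hp : f.p = g.p := by
      by_contra hne
      have b1 : g.side f.p = _ := g.side_on hne (hv ▸ f.on)
      have b2 : f.side g.p = _ := f.side_on (Ne.symm hne) (hv ▸ g.on)
      rw [hfp1, hg.d, mul_one, eq_comm, sg_eq_one] at b1
      rw [← hgp1, hf.d, mul_one, eq_comm, sg_eq_one] at b2
      linarith
    exact Flag.ext hv hp (hf.d.trans hg.d.symm) (hf.s.trans hg.s.symm)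
  · exfalso
    have a1 := g.side_eq_one (hfr.trans (by decide))
    have a2 := g.side_eq_neg_one (hfp1.trans (by decide))
    have a3 := f.side_eq_one (r := r') (by
      revert hgr; generalize f.side r' = a; revert a; decide)
    have a4 := f.side_eq_neg_one (r := g.p) (by
      revert hgp1; generalize f.side g.p = a; revert a; decide)
    have hx : f.v.1 = g.v.1 := by
      apply le_antisymm <;> nlinarith
    have hv : f.v = g.v := Prod.ext hx (by rw [hx] at hfp hvr; linarith)
    obtain ⟨q, hq, hvq⟩ := A.noncol f.v
    have := h q hq
    rw [f.side_off hvq, g.side_off (hv ▸ hvq), ← hv] at this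
    revert this
    generalize sg _ = a
    revert a; decide

lemma Corner.cell_inj {f g : A.Flag} (hf : f.Corner) (hg : g.Corner) (h : f.cell = g.cell) :
    f = g := by
  refine hf.side_inj hg (g.side f.p * f.side f.p) fun r hr => ?_
  have e := congrFun h (⟨r, hr⟩, ⟨f.p, f.hp⟩)
  simp only [cell] at e
  revert e
  generalize f.side r = a
  generalize g.side r = b
  generalize f.side f.p = c
  generalize g.side f.p = d
  revert a b c d; decide

lemma σ₀_v_ne (f : A.Flag) : f.σ₀.v ≠ f.v := f.σ₀_spec.ne

lemma σ₁_p_ne (f : A.Flag) : f.σ₁.p ≠ f.p := f.σ₁_spec.ne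

end Flag

/-- Each flag lies in a set of six flags of its cell, closed up only around a triangle. -/
lemma six_flags (f : A.Flag) : ∃ F : Finset A.Flag, F.card = 6 ∧ (∀ g ∈ F, g.cell = f.cell) ∧
    (f.σ₁.σ₀.σ₁.σ₀.σ₁.σ₀ ≠ f → f.σ₁.σ₀.σ₁.σ₀.σ₁.σ₀ ∉ F) := by
  classical
  obtain ⟨f₂, h2⟩ : ∃ g, g = f.σ₁ := ⟨_, rfl⟩
  obtain ⟨f₃, h3⟩ : ∃ g, g = f₂.σ₀ := ⟨_, rfl⟩
  obtain ⟨f₄, h4⟩ : ∃ g, g = f₃.σ₁ := ⟨_, rfl⟩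
  obtain ⟨f₅, h5⟩ : ∃ g, g = f₄.σ₀ := ⟨_, rfl⟩
  obtain ⟨f₆, h6⟩ : ∃ g, g = f₅.σ₁ := ⟨_, rfl⟩
  have p12 : f₂.p ≠ f.p := h2 ▸ f.σ₁_p_ne
  have v23 : f₃.v ≠ f₂.v := h3 ▸ f₂.σ₀_v_ne
  have p34 : f₄.p ≠ f₃.p := h4 ▸ f₃.σ₁_p_ne
  have v45 : f₅.v ≠ f₄.v := h5 ▸ f₄.σ₀_v_ne
  have p56 : f₆.p ≠ f₅.p := h6 ▸ f₅.σ₁_p_ne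
  have v12 : f₂.v = f.v := by rw [h2]; rfl
  have p23 : f₃.p = f₂.p := by rw [h3]; rfl
  have v34 : f₄.v = f₃.v := by rw [h4]; rfl
  have p45 : f₅.p = f₄.p := by rw [h5]; rfl
  have v56 : f₆.v = f₅.v := by rw [h6]; rfl
  have v25 : f₅.v ≠ f₂.v := by
    intro e
    refine v45 (On.unique p34 (p45 ▸ f₅.on) ?_ f₄.on (v34 ▸ f₃.on))
    rw [e, p23]; exact f₂.on
  have c2 : f₂.cell = f.cell := by rw [h2, Flag.cell_σ₁]
  have c3 : f₃.cell = f.cell := by rw [h3, Flag.cell_σ₀, c2]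
  have c4 : f₄.cell = f.cell := by rw [h4, Flag.cell_σ₁, c3]
  have c5 : f₅.cell = f.cell := by rw [h5, Flag.cell_σ₀, c4]
  have c6 : f₆.cell = f.cell := by rw [h6, Flag.cell_σ₁, c5]
  have hne : ∀ {g h : A.Flag}, (g.v ≠ h.v ∨ g.p ≠ h.p) → g ≠ h := by
    rintro g h (h1 | h1) rfl <;> exact h1 rfl
  have n12 : f ≠ f₂ := hne (.inr p12.symm)
  have n13 : f ≠ f₃ := hne (.inl (v12 ▸ v23.symm))
  have n14 : f ≠ f₄ := hne (.inl (v12 ▸ v34 ▸ v23.symm))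
  have n15 : f ≠ f₅ := hne (.inl (v12 ▸ v25.symm))
  have n16 : f ≠ f₆ := hne (.inl (v12 ▸ v56 ▸ v25.symm))
  have n23 : f₂ ≠ f₃ := hne (.inl v23.symm)
  have n24 : f₂ ≠ f₄ := hne (.inl (v34 ▸ v23.symm))
  have n25 : f₂ ≠ f₅ := hne (.inl v25.symm)
  have n26 : f₂ ≠ f₆ := hne (.inl (v56 ▸ v25.symm))
  have n34 : f₃ ≠ f₄ := hne (.inr p34.symm)
  have n35 : f₃ ≠ f₅ := hne (.inl (v34 ▸ v45.symm))
  have n36 : f₃ ≠ f₆ := hne (.inl (v34 ▸ v56 ▸ v45.symm))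
  have n45 : f₄ ≠ f₅ := hne (.inl v45.symm)
  have n46 : f₄ ≠ f₆ := hne (.inl (v56 ▸ v45.symm))
  have n56 : f₅ ≠ f₆ := hne (.inr p56.symm)
  have key : ∀ g, f₆.σ₀ = g → f₆ = g.σ₀ := fun g hg => by rw [← hg, Flag.σ₀_σ₀]
  rw [← h2, ← h3, ← h4, ← h5, ← h6]
  refine ⟨{f, f₂, f₃, f₄, f₅, f₆}, ?_, ?_, ?_⟩
  · repeat rw [Finset.card_insert_of_notMem (by
      simp [n12, n13, n14, n15, n16, n23, n24, n25, n26, n34, n35, n36, n45, n46, n56])]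
    simp
  · intro g hg
    simp only [Finset.mem_insert, Finset.mem_singleton] at hg
    rcases hg with rfl | rfl | rfl | rfl | rfl | rfl
    exacts [rfl, c2, c3, c4, c5, c6]
  · intro hf hmem
    simp only [Finset.mem_insert, Finset.mem_singleton] at hmem
    rcases hmem with h | h | h | h | h | h
    · exact hf h
    · exact n36 (h3.trans (key _ h).symm)
    · have := key _ h
      rw [h3, Flag.σ₀_σ₀] at this
      exact n26 this.symm
    · exact n56 (h5.trans (key _ h).symm)
    · have := key _ h
      rw [h5, Flag.σ₀_σ₀] at this
      exact n46 this.symm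
    · exact f₆.σ₀_v_ne (by rw [h])

end Arrangement

namespace Arrangement

variable {A : Arrangement}

open Classical in
lemma card_flag_at {v : ℝ × ℝ} (hv : v ∈ A.verts) :
    (Finset.univ.filter fun f : A.Flag => f.v = v).card = 4 * (A.thru v).card := by
  have h4 : (Finset.univ : Finset (ℤˣ × ℤˣ)).card = 4 := by decide
  rw [← h4, mul_comm, ← Finset.card_product]
  refine Finset.card_bij (fun f _ => (f.p, f.d, f.s)) ?_ ?_ ?_
  · intro f hf
    have hf : f.v = v := by simpa using hf
    subst hf
    simp [f.mem_thru]
  · intro f hf g hg h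
    simp only [Prod.mk.injEq] at h
    simp only [Finset.mem_filter, Finset.mem_univ, true_and] at hf hg
    exact Flag.ext (hf.trans hg.symm) h.1 h.2.1 h.2.2
  · rintro ⟨p, d, s⟩ h
    have hp := A.mem_thru.1 (Finset.mem_product.1 h).1
    exact ⟨⟨v, p, d, s, hv, hp.1, hp.2⟩, by simp, rfl⟩

lemma card_thru_ge {v : ℝ × ℝ} (hv : v ∈ A.verts) : 2 ≤ (A.thru v).card := by
  obtain ⟨p, hp, -⟩ := exists_other_thru hv 0
  obtain ⟨q, hq, hqp⟩ := exists_other_thru hv p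
  exact Finset.one_lt_card.2 ⟨p, hp, q, hq, hqp.symm⟩

open Classical in
lemma card_corner_at {v : ℝ × ℝ} (hv : v ∈ A.verts) :
    (A.thru v).card ≤ (Finset.univ.filter fun f : A.Flag => f.Corner ∧ f.v = v).card + 1 := by
  obtain ⟨p, hp, -⟩ := exists_other_thru hv 0
  obtain ⟨m, hm, hmax⟩ := Finset.exists_max_image (A.thru v) Complex.re ⟨p, hp⟩
  rw [← Finset.card_erase_add_one hm, add_le_add_iff_right]
  refine Finset.card_le_card_of_surjOn Flag.p ?_
  intro q hq
  obtain ⟨hqm, hq⟩ := Finset.mem_erase.1 (Finset.mem_coe.1 hq)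
  have hq' := A.mem_thru.1 hq
  refine ⟨⟨v, q, 1, 1, hv, hq'.1, hq'.2⟩, ?_, rfl⟩
  simp only [Finset.coe_filter, Finset.mem_univ, true_and, Set.mem_ofPred_eq, and_true]
  exact ⟨rfl, rfl, m, hm, lt_of_le_of_ne (hmax q hq) fun e => hqm (injOn_thru v hq hm e)⟩

/-- A flag at a triple point around which the arrangement looks like a triangular grid. -/
def Flag.Good (f : A.Flag) : Prop :=
  (A.thru f.v).card = 3 ∧ f.σ₀.σ₁.σ₀ = f.σ₁.σ₀.σ₁

variable (A) in
open Classical in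
/-- The number of vertices on exactly two lines. -/
def n₂ : ℕ := (A.verts.filter fun v => (A.thru v).card = 2).card

open Classical in
/-- A quantitative form of Melchior's inequality. -/
lemma card_not_good : (Finset.univ.filter fun f : A.Flag => ¬ f.Good).card ≤ 24 * A.n₂ := by
  set B := Finset.univ.filter fun f : A.Flag => f.σ₁.σ₀.σ₁.σ₀.σ₁.σ₀ ≠ f with hB
  set D := Finset.univ.filter fun f : A.Flag => (A.thru f.v).card ≠ 3 with hD
  set C := Finset.univ.image (Flag.cell (A := A)) with hC
  have h1 : (Finset.univ.filter fun f : A.Flag => ¬ f.Good).card ≤ B.card + D.card := by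
    refine (Finset.card_le_card ?_).trans (Finset.card_union_le _ _)
    intro f hf
    simp only [Finset.mem_filter, Finset.mem_univ, true_and, Flag.Good, not_and_or] at hf
    simp only [hB, hD, Finset.mem_union, Finset.mem_filter, Finset.mem_univ, true_and]
    rcases hf with hf | hf
    · exact Or.inr hf
    · refine Or.inl fun h => hf ?_
      rw [← Flag.σ₀_σ₀ f.σ₁.σ₀.σ₁, ← Flag.σ₁_σ₁ f.σ₁.σ₀.σ₁.σ₀, ← Flag.σ₀_σ₀ f.σ₁.σ₀.σ₁.σ₀.σ₁, h]
  have hflag : ∀ S : Finset A.Flag, S.card = ∑ v ∈ A.verts, (S.filter fun f => f.v = v).card :=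
    fun S => Finset.card_eq_sum_card_fiberwise fun f _ => f.hv
  have hI : (Finset.univ : Finset A.Flag).card = ∑ v ∈ A.verts, 4 * (A.thru v).card := by
    rw [hflag]
    exact Finset.sum_congr rfl fun v hv => card_flag_at hv
  have hDc : D.card = ∑ v ∈ A.verts, if (A.thru v).card = 3 then 0 else 4 * (A.thru v).card := by
    rw [hflag]
    refine Finset.sum_congr rfl fun v hv => ?_
    split_ifs with h
    · rw [Finset.card_eq_zero, Finset.filter_eq_empty_iff]
      rintro f hf rfl
      exact (Finset.mem_filter.1 hf).2 h
    · rw [← card_flag_at hv]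
      congr 1
      ext f
      simp only [hD, Finset.mem_filter, Finset.mem_univ, true_and, and_iff_right_iff_imp]
      rintro rfl; exact h
  have hCc : ∑ v ∈ A.verts, (A.thru v).card ≤ C.card + A.verts.card := by
    have e1 : (Finset.univ.filter fun f : A.Flag => f.Corner).card ≤ C.card := by
      refine Finset.card_le_card_of_injOn Flag.cell (fun f _ => by simp [hC]) ?_
      intro f hf g hg h
      exact Flag.Corner.cell_inj (by simpa using hf) (by simpa using hg) h
    have e2 : ∑ v ∈ A.verts, (A.thru v).card ≤
        (Finset.univ.filter fun f : A.Flag => f.Corner).card + A.verts.card := by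
      rw [hflag, Finset.card_eq_sum_ones, ← Finset.sum_add_distrib]
      refine Finset.sum_le_sum fun v hv => ?_
      rw [Finset.filter_filter]
      exact card_corner_at hv
    omega
  have hfib : ∀ c ∈ C, 6 ≤ (Finset.univ.filter fun f : A.Flag => f.cell = c).card ∧
      (B.filter fun f => f.cell = c).card + 42 ≤
        7 * (Finset.univ.filter fun f : A.Flag => f.cell = c).card := by
    intro c hc
    obtain ⟨f, -, rfl⟩ := Finset.mem_image.1 hc
    have hsix : ∀ g : A.Flag, g.cell = f.cell →
        ∃ F ⊆ Finset.univ.filter fun h : A.Flag => h.cell = f.cell, F.card = 6 ∧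
        (g.σ₁.σ₀.σ₁.σ₀.σ₁.σ₀ ≠ g → g.σ₁.σ₀.σ₁.σ₀.σ₁.σ₀ ∉ F) := by
      intro g hg
      obtain ⟨F, h1, h2, h3⟩ := six_flags g
      exact ⟨F, fun h hh => by simp [h2 h hh, hg], h1, h3⟩
    obtain ⟨F, hF, hF6, -⟩ := hsix f rfl
    have h6 := Finset.card_le_card hF
    rw [hF6] at h6
    refine ⟨h6, ?_⟩
    by_cases hb : (B.filter fun g => g.cell = f.cell).Nonempty
    · obtain ⟨g, hg⟩ := hb
      simp only [hB, Finset.mem_filter, Finset.mem_univ, true_and] at hg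
      obtain ⟨F, hF, hF6, hF7⟩ := hsix g hg.2
      have h7 := Finset.card_le_card (Finset.insert_subset (a := g.σ₁.σ₀.σ₁.σ₀.σ₁.σ₀) (by
        simp [Flag.cell_σ₀, Flag.cell_σ₁, hg.2]) hF)
      rw [Finset.card_insert_of_notMem (hF7 hg.1), hF6] at h7
      have h8 : (B.filter fun g => g.cell = f.cell).card ≤
          (Finset.univ.filter fun h : A.Flag => h.cell = f.cell).card :=
        Finset.card_le_card (Finset.filter_subset_filter _ (Finset.subset_univ _))
      omega
    · rw [Finset.not_nonempty_iff_eq_empty.1 hb, Finset.card_empty]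
      omega
  have hsum : ∀ S : Finset A.Flag, S.card = ∑ c ∈ C, (S.filter fun f => f.cell = c).card :=
    fun S => Finset.card_eq_sum_card_fiberwise fun f _ => by simp [hC]
  have hfib1 : C.card * 6 ≤ (Finset.univ : Finset A.Flag).card := by
    rw [hsum, ← smul_eq_mul, ← Finset.sum_const]
    exact Finset.sum_le_sum fun c hc => (hfib c hc).1
  have hfib2 : B.card + C.card * 42 ≤ 7 * (Finset.univ : Finset A.Flag).card := by
    rw [hsum B, hsum Finset.univ, ← smul_eq_mul, ← Finset.sum_const, ← Finset.sum_add_distrib,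
      Finset.mul_sum]
    exact Finset.sum_le_sum fun c hc => (hfib c hc).2
  have hfinal : D.card + 48 * A.verts.card ≤
      24 * A.n₂ + 16 * ∑ v ∈ A.verts, (A.thru v).card := by
    rw [hDc, n₂, Finset.card_eq_sum_ones A.verts, Finset.card_filter, Finset.mul_sum,
      Finset.mul_sum, Finset.mul_sum, ← Finset.sum_add_distrib, ← Finset.sum_add_distrib]
    refine Finset.sum_le_sum fun v hv => ?_
    have := card_thru_ge hv
    split_ifs <;> omega
  rw [← Finset.mul_sum] at hI
  omega

end Arrangement

namespace Arrangement

variable {A : Arrangement}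

namespace Flag

/-- `GoodN R` means that all flags reachable in at most `R` moves are good. -/
def GoodN : ℕ → A.Flag → Prop
  | 0, f => f.Good
  | R + 1, f => GoodN R f ∧ GoodN R f.σ₀ ∧ GoodN R f.σ₁ ∧ GoodN R f.σ₂ ∧ GoodN R f.opp

lemma GoodN.mono {R S : ℕ} (h : R ≤ S) {f : A.Flag} (hf : f.GoodN S) : f.GoodN R := by
  induction S, h using Nat.le_induction with
  | base => exact hf
  | succ n _ ih => exact ih hf.1

lemma GoodN.σ₀ {R : ℕ} {f : A.Flag} (hf : f.GoodN (R + 1)) : f.σ₀.GoodN R := hf.2.1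
lemma GoodN.σ₁ {R : ℕ} {f : A.Flag} (hf : f.GoodN (R + 1)) : f.σ₁.GoodN R := hf.2.2.1
lemma GoodN.σ₂ {R : ℕ} {f : A.Flag} (hf : f.GoodN (R + 1)) : f.σ₂.GoodN R := hf.2.2.2.1
lemma GoodN.opp {R : ℕ} {f : A.Flag} (hf : f.GoodN (R + 1)) : f.opp.GoodN R := hf.2.2.2.2
lemma GoodN.good {R : ℕ} {f : A.Flag} (hf : f.GoodN R) : f.Good := hf.mono (Nat.zero_le R)
lemma GoodN.three {R : ℕ} {f : A.Flag} (hf : f.GoodN R) : (A.thru f.v).card = 3 := hf.good.1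

open Classical in
lemma card_not_goodN (R : ℕ) :
    (Finset.univ.filter fun f : A.Flag => ¬ f.GoodN R).card ≤ 24 * 5 ^ R * A.n₂ := by
  induction R with
  | zero =>
    rw [pow_zero, mul_one]
    refine le_trans (Finset.card_le_card fun f hf => ?_) (card_not_good (A := A))
    exact Finset.mem_filter.2 ⟨Finset.mem_univ _, (Finset.mem_filter.1 hf).2⟩
  | succ R ih =>
    have hinj : ∀ φ : A.Flag → A.Flag, φ.Injective →
        (Finset.univ.filter fun f : A.Flag => ¬ (φ f).GoodN R).card ≤
          (Finset.univ.filter fun f : A.Flag => ¬ f.GoodN R).card := fun φ hφ =>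
      Finset.card_le_card_of_injOn φ (fun f hf => by simpa using hf) hφ.injOn
    have h0 := hinj Flag.σ₀ (Function.LeftInverse.injective (g := Flag.σ₀) σ₀_σ₀)
    have h1 := hinj Flag.σ₁ (Function.LeftInverse.injective (g := Flag.σ₁) σ₁_σ₁)
    have h2 := hinj Flag.σ₂ (Function.LeftInverse.injective (g := Flag.σ₂) σ₂_σ₂)
    have h3 := hinj Flag.opp (Function.LeftInverse.injective (g := Flag.opp) opp_opp)
    have hsub : (Finset.univ.filter fun f : A.Flag => ¬ f.GoodN (R + 1)) ⊆
        (Finset.univ.filter fun f : A.Flag => ¬ f.GoodN R) ∪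
        ((Finset.univ.filter fun f : A.Flag => ¬ f.σ₀.GoodN R) ∪
        ((Finset.univ.filter fun f : A.Flag => ¬ f.σ₁.GoodN R) ∪
        ((Finset.univ.filter fun f : A.Flag => ¬ f.σ₂.GoodN R) ∪
        (Finset.univ.filter fun f : A.Flag => ¬ f.opp.GoodN R)))) := by
      intro f hf
      have hf := (Finset.mem_filter.1 hf).2
      simp only [Finset.mem_filter, Finset.mem_univ, true_and, Finset.mem_union]
      simp only [GoodN] at hf
      tauto
    have hc := Finset.card_le_card hsub
    have u1 := hc.trans (Finset.card_union_le _ _)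
    have u2 := u1.trans (Nat.add_le_add_left (Finset.card_union_le _ _) _)
    have u3 := u2.trans (Nat.add_le_add_left (Nat.add_le_add_left (Finset.card_union_le _ _) _) _)
    have u4 := u3.trans (Nat.add_le_add_left (Nat.add_le_add_left (Nat.add_le_add_left
      (Finset.card_union_le _ _) _) _) _)
    have e : 24 * 5 ^ (R + 1) * A.n₂ = 5 * (24 * 5 ^ R * A.n₂) := by ring
    omega

/-- Rotation about the vertex to the next line. -/
def rot (f : A.Flag) : A.Flag := f.σ₁.σ₂

/-- Translation along the line. -/
def shift (f : A.Flag) : A.Flag := f.σ₀.opp.σ₂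

/-- Translation along the next line. -/
def shift₁ (f : A.Flag) : A.Flag := f.rot.shift.σ₂.σ₁

@[simp] lemma rot_v (f : A.Flag) : f.rot.v = f.v := rfl
@[simp] lemma shift_p (f : A.Flag) : f.shift.p = f.p := rfl
@[simp] lemma shift_d (f : A.Flag) : f.shift.d = f.d := by simp [shift]

lemma shift₁_rot (f : A.Flag) : f.shift₁.rot = f.rot.shift := by simp [rot, shift₁]

lemma shift₁_eq (f : A.Flag) : f.shift₁ = f.σ₁.σ₂.σ₀.opp.σ₁ := by simp [shift₁, rot, shift]

lemma shift_spec (f : A.Flag) :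
    CycNext (A.onV f.p) Prod.fst f.d f.v f.shift.v (f.σ₀.s * f.s) := f.σ₀_spec

lemma shift_inj {f g : A.Flag} (h : f.shift = g.shift) : f = g := by
  unfold shift at h
  have := congrArg (fun f : A.Flag => f.σ₂.opp.σ₀) h
  simpa using this

lemma turn_two (f : A.Flag) (h3 : (A.thru f.v).card = 3) :
    f.σ₂.σ₁.σ₂.σ₁.σ₂ = f.opp.σ₁ := by
  have := turn_three f.σ₁ h3
  rwa [σ₁_σ₁, opp_σ₁] at this

lemma turn_two' (f : A.Flag) (h3 : (A.thru f.v).card = 3) :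
    f.σ₂.σ₁.σ₂.σ₁ = f.opp.σ₁.σ₂ := by
  rw [← turn_two f h3, σ₂_σ₂]

lemma rot_rot_rot (f : A.Flag) (h3 : (A.thru f.v).card = 3) : f.rot.rot.rot = f.opp :=
  turn_three f h3

/-- The local relations of the triangular lattice. -/
structure Loc (f : A.Flag) : Prop where
  three : (A.thru f.v).card = 3
  rel : f.shift.rot.rot.shift = f.shift₁.rot.rot
  comm : f.shift₁.shift = f.shift.shift₁

lemma rel_of_good {f : A.Flag} (hf : f.Good) (h0 : (A.thru f.σ₀.v).card = 3) :
    f.shift.rot.rot.shift = f.shift₁.rot.rot := by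
  rw [shift₁_rot]
  simp only [shift, rot]
  rw [turn_two f.σ₀.opp h0, opp_opp, hf.2, ← σ₂_σ₀, opp_σ₂ f.σ₁.σ₀.σ₂, σ₂_σ₂, opp_σ₁]

lemma shift_shift₂ {f : A.Flag} (h : f.σ₁.σ₂.σ₁.Good) (h3 : (A.thru f.σ₁.σ₂.σ₁.σ₀.v).card = 3) :
    f.rot.rot.shift.σ₂.σ₁.σ₂.σ₁.shift = f.shift₁ := by
  rw [shift₁_eq]
  simp only [rot, shift]
  rw [← σ₂_σ₀, σ₂_σ₂, ← opp_σ₂,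
    turn_two' f.σ₁.σ₂.σ₁.σ₀.opp h3, opp_opp, ← σ₂_σ₀, opp_σ₂, σ₂_σ₂, h.2, σ₁_σ₁, opp_σ₁]

lemma GoodN.shift {R : ℕ} {f : A.Flag} (hf : f.GoodN (R + 3)) : f.shift.GoodN R := hf.σ₀.opp.σ₂

lemma GoodN.shift₁ {R : ℕ} {f : A.Flag} (hf : f.GoodN (R + 5)) : f.shift₁.GoodN R := by
  rw [shift₁_eq]; exact hf.σ₁.σ₂.σ₀.opp.σ₁

lemma GoodN.loc {f : A.Flag} (hf : f.GoodN 7) : f.Loc := by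
  have h0 : (A.thru f.σ₀.v).card = 3 := hf.σ₀.three
  have hrel := rel_of_good hf.good h0
  refine ⟨hf.three, hrel, ?_⟩
  have hs : f.shift.GoodN 4 := GoodN.shift (R := 4) hf
  have h1 := shift_shift₂ (f := f.shift) (GoodN.good (R := 1) hs.σ₁.σ₂.σ₁)
    (GoodN.three (R := 0) hs.σ₁.σ₂.σ₁.σ₀)
  rw [hrel] at h1
  rw [← h1]
  simp [Flag.rot]

/-- The lattice relations hold in a large triangle. -/
def Lat (R : ℕ) (f : A.Flag) : Prop := ∀ n m, n + m ≤ R → (shift₁^[n] (shift^[m] f)).Loc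

lemma GoodN.lat {R : ℕ} {f : A.Flag} (hf : f.GoodN (5 * R + 7)) : f.Lat R := by
  have h1 : ∀ m S, ∀ f : A.Flag, f.GoodN (S + 5 * m) → (Flag.shift^[m] f).GoodN S := by
    intro m
    induction m with
    | zero => intro S f h; exact h
    | succ m ih =>
      intro S f h
      rw [Function.iterate_succ_apply]
      exact ih _ _ (GoodN.shift (h.mono (by omega)))
  have h2 : ∀ m S, ∀ f : A.Flag, f.GoodN (S + 5 * m) → (Flag.shift₁^[m] f).GoodN S := by
    intro m
    induction m with
    | zero => intro S f h; exact h
    | succ m ih =>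
      intro S f h
      rw [Function.iterate_succ_apply]
      exact ih _ _ (GoodN.shift₁ (h.mono (by omega)))
  intro n m hnm
  exact GoodN.loc (h2 _ _ _ (h1 _ _ _ (hf.mono (by omega))))

/-- The three families of lines of the lattice. -/
def lineA (f : A.Flag) (n : ℕ) : ℂ := (shift₁^[n] f).p
/-- The second family. -/
def lineB (f : A.Flag) (m : ℕ) : ℂ := (shift^[m] f).rot.p
/-- The third family. -/
def lineC (f : A.Flag) (k : ℕ) : ℂ := (shift^[k] f).rot.rot.p

variable {R : ℕ} {f : A.Flag}

lemma Lat.shift_grid (hf : f.Lat R) {n m : ℕ} (h : n + m ≤ R + 1) :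
    shift₁^[n] (shift^[m + 1] f) = (shift₁^[n] (shift^[m] f)).shift := by
  induction n with
  | zero => simp only [Function.iterate_zero, id]; rw [Function.iterate_succ_apply']
  | succ n ih =>
    rw [Function.iterate_succ_apply', ih (by omega), Function.iterate_succ_apply',
      (hf n m (by omega)).comm]

lemma Lat.grid_p (hf : f.Lat R) {n m : ℕ} (h : n + m ≤ R + 1) :
    (shift₁^[n] (shift^[m] f)).p = f.lineA n := by
  induction m with
  | zero => rfl
  | succ m ih => rw [hf.shift_grid (by omega), shift_p, ih (by omega)]

lemma grid_rot (n m : ℕ) : (shift₁^[n] (shift^[m] f)).rot.p = f.lineB m := by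
  induction n with
  | zero => rfl
  | succ n ih => rw [Function.iterate_succ_apply', shift₁_rot, shift_p, ih]

lemma Lat.grid_rot_rot (hf : f.Lat R) {n m : ℕ} (h : n + m ≤ R + 1) :
    (shift₁^[n] (shift^[m] f)).rot.rot.p = f.lineC (n + m) := by
  induction n generalizing m with
  | zero => rw [zero_add]; rfl
  | succ n ih =>
    rw [Function.iterate_succ_apply', ← (hf n m (by omega)).rel, shift_p,
      ← hf.shift_grid (by omega), ih (by omega)]
    congr 1; omega

lemma rot_p_ne (f : A.Flag) : f.rot.p ≠ f.p := f.σ₁_p_ne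

lemma rot_rot_p_ne (f : A.Flag) (h3 : (A.thru f.v).card = 3) : f.rot.rot.p ≠ f.p := by
  have := f.rot.rot.rot_p_ne
  rw [rot_rot_rot f h3] at this
  exact this.symm

lemma thru_eq (f : A.Flag) (h3 : (A.thru f.v).card = 3) :
    A.thru f.v = {f.p, f.rot.p, f.rot.rot.p} := by
  classical
  symm
  apply Finset.eq_of_subset_of_card_le
  · intro s hs
    simp only [Finset.mem_insert, Finset.mem_singleton] at hs
    rcases hs with rfl | rfl | rfl
    exacts [f.mem_thru, f.rot.mem_thru, f.rot.rot.mem_thru]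
  · rw [h3, Finset.card_eq_three.2 ⟨_, _, _, f.rot_p_ne.symm, (f.rot_rot_p_ne h3).symm,
      f.rot.rot_p_ne.symm, rfl⟩]

lemma Lat.thru_grid (hf : f.Lat R) {n m : ℕ} (h : n + m ≤ R) :
    A.thru (shift₁^[n] (shift^[m] f)).v = {f.lineA n, f.lineB m, f.lineC (n + m)} := by
  rw [thru_eq _ (hf n m h).three, hf.grid_p (by omega), grid_rot, hf.grid_rot_rot (by omega)]

@[simp] lemma iterate_shift_p (m : ℕ) : (shift^[m] f).p = f.p := by
  induction m with
  | zero => rfl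
  | succ m ih => rw [Function.iterate_succ_apply', shift_p, ih]

@[simp] lemma iterate_shift_d (m : ℕ) : (shift^[m] f).d = f.d := by
  induction m with
  | zero => rfl
  | succ m ih => rw [Function.iterate_succ_apply', shift_d, ih]

lemma iterate_shift_next (f : A.Flag) (m : ℕ) : ∃ κ,
    CycNext (A.onV f.p) Prod.fst f.d (shift^[m] f).v (shift^[m + 1] f).v κ := by
  have := (shift^[m] f).shift_spec
  rw [iterate_shift_p, iterate_shift_d] at this
  rw [Function.iterate_succ_apply']
  exact ⟨_, this⟩

lemma iterate_shift_mem (f : A.Flag) (m : ℕ) : (shift^[m] f).v ∈ A.onV f.p := by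
  have := (shift^[m] f).mem_onV
  rwa [iterate_shift_p] at this

/-- Translations of a flag along a line with many vertices have distinct vertices. -/
lemma iterate_shift_inj (f : A.Flag) {w : ℕ} (h3 : ∀ i ≤ w, (A.thru (shift^[i] f).v).card = 3)
    (hw : 2 * w + 1 < A.pts.card) {i j : ℕ} (hij : i < j) (hj : j ≤ w) :
    (shift^[i] f).v ≠ (shift^[j] f).v := by
  classical
  intro e
  have back : ∀ i k, (shift^[i] f).v = (shift^[i + k] f).v → (shift^[0] f).v = (shift^[k] f).v := by
    intro i
    induction i with
    | zero => intro k h; simpa using h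
    | succ i ih =>
      intro k h
      refine ih k ?_
      obtain ⟨κ, h1⟩ := f.iterate_shift_next i
      obtain ⟨κ', h2⟩ := f.iterate_shift_next (i + k)
      rw [show i + k + 1 = i + 1 + k by omega, ← h] at h2
      exact ((h1.symm (injOn_onV _) (f.iterate_shift_mem _)).unique (injOn_onV _)
        (h2.symm (injOn_onV _) (f.iterate_shift_mem _))).1
  obtain ⟨k, rfl⟩ := Nat.exists_eq_add_of_lt hij
  have e0 := back i (k + 1) e
  set U := (Finset.range (k + 1)).image fun i => (shift^[i] f).v with hU
  have hUV : U = A.onV f.p := by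
    refine CycNext.closed_eq (key := Prod.fst) (ε := f.d) (injOn_onV f.p) ?_ ?_ ?_ ?_
    · intro u hu
      obtain ⟨i, -, rfl⟩ := Finset.mem_image.1 hu
      exact f.iterate_shift_mem i
    · exact ⟨_, Finset.mem_image.2 ⟨0, by simp, rfl⟩⟩
    · intro u hu t' κ hn
      obtain ⟨i, hi, rfl⟩ := Finset.mem_image.1 hu
      obtain ⟨κ', hn'⟩ := f.iterate_shift_next i
      rw [(hn.unique (injOn_onV _) hn').1]
      rw [Finset.mem_range] at hi
      by_cases hik : i + 1 = k + 1
      · rw [hik, ← e0]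
        exact Finset.mem_image.2 ⟨0, by simp, rfl⟩
      · exact Finset.mem_image.2 ⟨i + 1, by rw [Finset.mem_range]; omega, rfl⟩
    · intro t ht
      exact CycNext.exists (injOn_onV _) ht (exists_other_onV f.hp t) _
  have hsub : A.pts.erase f.p ⊆
      (Finset.range (k + 1)).biUnion fun i => (A.thru (shift^[i] f).v).erase f.p := by
    intro q hq
    obtain ⟨hqp, hq⟩ := Finset.mem_erase.1 hq
    have hm : meet f.p q ∈ U := by
      rw [hUV]
      exact A.mem_onV.2 ⟨meet_mem f.hp hq hqp.symm, rfl⟩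
    obtain ⟨i, hi, hi'⟩ := Finset.mem_image.1 hm
    refine Finset.mem_biUnion.2 ⟨i, hi, Finset.mem_erase.2 ⟨hqp, A.mem_thru.2 ⟨hq, ?_⟩⟩⟩
    rw [hi']
    exact on_meet_right (re_ne f.hp hq hqp.symm)
  have hc := (Finset.card_le_card hsub).trans
    (Finset.card_biUnion_le_card_mul _ _ 2 fun i hi => by
      rw [Finset.mem_range] at hi
      have hmem := (shift^[i] f).mem_thru
      rw [iterate_shift_p] at hmem
      rw [Finset.card_erase_of_mem hmem, h3 i (by omega)])
  rw [Finset.card_erase_of_mem f.hp, Finset.card_range] at hc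
  omega

lemma shift₁_iterate_rot (n : ℕ) : (shift₁^[n] f).rot = shift^[n] f.rot := by
  induction n with
  | zero => rfl
  | succ n ih => rw [Function.iterate_succ_apply', shift₁_rot, ih, Function.iterate_succ_apply']

lemma Lat.v_inj (hf : f.Lat R) (hR : 2 * R + 1 < A.pts.card) {i j : ℕ} (hi : i ≤ R) (hj : j ≤ R)
    (h : (shift^[i] f).v = (shift^[j] f).v) : i = j := by
  have h3 : ∀ i ≤ R, (A.thru (shift^[i] f).v).card = 3 := fun i hi => (hf 0 i (by omega)).three
  rcases lt_trichotomy i j with h1 | h1 | h1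
  · exact absurd h (f.iterate_shift_inj h3 hR h1 hj)
  · exact h1
  · exact absurd h.symm (f.iterate_shift_inj h3 hR h1 hi)

lemma Lat.v_inj₁ (hf : f.Lat R) (hR : 2 * R + 1 < A.pts.card) {i j : ℕ} (hi : i ≤ R) (hj : j ≤ R)
    (h : (shift₁^[i] f).v = (shift₁^[j] f).v) : i = j := by
  have hv : ∀ i, (shift₁^[i] f).v = (shift^[i] f.rot).v := fun i => by
    rw [← shift₁_iterate_rot]; rfl
  have h3 : ∀ i ≤ R, (A.thru (shift^[i] f.rot).v).card = 3 := fun i hi => by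
    rw [← hv]; exact (hf i 0 (by omega)).three
  rw [hv, hv] at h
  rcases lt_trichotomy i j with h1 | h1 | h1
  · exact absurd h (f.rot.iterate_shift_inj h3 hR h1 hj)
  · exact h1
  · exact absurd h.symm (f.rot.iterate_shift_inj h3 hR h1 hi)

end Flag

/-- A triangular grid of points, each vertex being on exactly three lines. -/
structure Grid (A : Arrangement) (R : ℕ) (a b c : ℕ → ℂ) : Prop where
  thru : ∀ n m, n + m ≤ R → ∃ v ∈ A.verts, A.thru v = {a n, b m, c (n + m)}
  mem_a : ∀ i, a i ∈ A.pts
  mem_b : ∀ i, b i ∈ A.pts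
  mem_c : ∀ i, c i ∈ A.pts
  inj_a : ∀ i ≤ R, ∀ j ≤ R, a i = a j → i = j
  inj_b : ∀ i ≤ R, ∀ j ≤ R, b i = b j → i = j
  inj_c : ∀ i ≤ R, ∀ j ≤ R, c i = c j → i = j
  ab : ∀ i j, i + j ≤ R → a i ≠ b j
  ac : ∀ i ≤ R, ∀ j ≤ R, a i ≠ c j
  bc : ∀ i ≤ R, ∀ j ≤ R, b i ≠ c j

lemma Flag.Lat.grid {R : ℕ} {f : A.Flag} (hf : f.Lat R) (hR : 2 * R + 1 < A.pts.card) :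
    A.Grid R f.lineA f.lineB f.lineC := by
  have onB : ∀ m, On (shift^[m] f).v (f.lineB m) := fun m => (shift^[m] f).rot.on
  have onC : ∀ m, On (shift^[m] f).v (f.lineC m) := fun m => (shift^[m] f).rot.rot.on
  have onP : ∀ m, On (shift^[m] f).v f.p := fun m => by
    have := (shift^[m] f).on
    rwa [iterate_shift_p] at this
  have hB : ∀ m, f.lineB m ≠ f.p := fun m => by
    have := (shift^[m] f).rot_p_ne
    rwa [iterate_shift_p] at this
  have hC : ∀ m ≤ R, f.lineC m ≠ f.p := fun m hm => by
    have := (shift^[m] f).rot_rot_p_ne (hf 0 m (by omega)).three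
    rwa [iterate_shift_p] at this
  have key : ∀ i ≤ R, ∀ j ≤ R, ∀ q, q ≠ f.p → On (shift^[i] f).v q → On (shift^[j] f).v q →
      i = j := fun i hi j hj q hq h1 h2 =>
    hf.v_inj hR hi hj (On.unique hq h1 (onP i) h2 (onP j))
  have onA₁ : ∀ n, On (shift₁^[n] f).v (f.lineA n) := fun n => (shift₁^[n] f).on
  have onB₁ : ∀ n, On (shift₁^[n] f).v (f.lineB 0) := fun n => by
    rw [← grid_rot (f := f) n 0]; exact (shift₁^[n] f).rot.on
  have onC₁ : ∀ n ≤ R, On (shift₁^[n] f).v (f.lineC n) := fun n hn => by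
    have := hf.grid_rot_rot (n := n) (m := 0) (by omega)
    rw [add_zero] at this
    rw [← this]; exact (shift₁^[n] f).rot.rot.on
  have hA₁ : ∀ n ≤ R, f.lineA n ≠ f.lineB 0 := fun n _ => by
    rw [← grid_rot (f := f) n 0]
    exact (shift₁^[n] f).rot_p_ne.symm
  have key₁ : ∀ i ≤ R, ∀ j ≤ R, ∀ q, q ≠ f.lineB 0 → On (shift₁^[i] f).v q →
      On (shift₁^[j] f).v q → i = j := fun i hi j hj q hq h1 h2 =>
    hf.v_inj₁ hR hi hj (On.unique hq h1 (onB₁ i) h2 (onB₁ j))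
  refine ⟨fun n m h => ⟨_, Flag.hv _, hf.thru_grid h⟩, fun i => Flag.hp _, fun i => Flag.hp _,
    fun i => Flag.hp _, ?_, ?_, ?_, ?_, ?_, ?_⟩
  · intro i hi j hj h
    exact key₁ i hi j hj _ (hA₁ i hi) (onA₁ i) (h ▸ onA₁ j)
  · intro i hi j hj h
    exact key i hi j hj _ (hB i) (onB i) (h ▸ onB j)
  · intro i hi j hj h
    exact key i hi j hj _ (hC i hi) (onC i) (h ▸ onC j)
  · intro i j h
    rw [← hf.grid_p (n := i) (m := j) (by omega), ← grid_rot (f := f) i j]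
    exact (Flag.rot_p_ne _).symm
  · intro i hi j hj h
    have := key₁ i hi j hj _ (hA₁ i hi) (onA₁ i) (h ▸ onC₁ j hj)
    subst this
    have e := hf.grid_rot_rot (n := i) (m := 0) (by omega)
    exact Flag.rot_rot_p_ne _ (hf i 0 (by omega)).three (e.trans h.symm)
  · intro i hi j hj h
    have := key i hi j hj _ (hB i) (onB i) (h ▸ onC j)
    subst this
    exact (shift^[i] f).rot.rot_p_ne h.symm

end Arrangement

open Polynomial in
/-- The functions `w ↦ q(re w)` with `q` of degree at most `d`. -/
def rePoly (d : ℕ) : Submodule ℂ (ℂ → ℂ) where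
  carrier := {f | ∃ q : ℂ[X], q.natDegree ≤ d ∧ ∀ w, f w = q.eval (w.re : ℂ)}
  add_mem' := by
    rintro f g ⟨q, hq, hf⟩ ⟨r, hr, hg⟩
    exact ⟨q + r, (Polynomial.natDegree_add_le _ _).trans (max_le hq hr), fun w => by
      simp [hf, hg]⟩
  zero_mem' := ⟨0, by simp, by simp⟩
  smul_mem' := by
    rintro c f ⟨q, hq, hf⟩
    exact ⟨Polynomial.C c * q, (Polynomial.natDegree_C_mul_le _ _).trans hq, fun w => by simp [hf]⟩

/-- The linear function vanishing on the points of the line `v`. -/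
def lam (v : ℝ × ℝ) (w : ℂ) : ℂ := ((w.re * v.1 + w.im - v.2 : ℝ) : ℂ)

lemma lam_eq_zero {v : ℝ × ℝ} {w : ℂ} : lam v w = 0 ↔ On v w := by
  unfold lam On
  rw [Complex.ofReal_eq_zero, sub_eq_zero, eq_comm]

/-- The affine functions on the real plane. -/
def affine : Submodule ℂ (ℂ → ℂ) :=
  Submodule.span ℂ {1, fun w => w, fun w => (starRingEnd ℂ) w}

lemma one_mem_affine : (1 : ℂ → ℂ) ∈ affine := Submodule.subset_span (by simp)
lemma id_mem_affine : (fun w => w : ℂ → ℂ) ∈ affine := Submodule.subset_span (by simp)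
lemma conj_mem_affine : (fun w => (starRingEnd ℂ) w : ℂ → ℂ) ∈ affine :=
  Submodule.subset_span (by simp)

lemma re_mem_affine : (fun w => (w.re : ℂ) : ℂ → ℂ) ∈ affine := by
  have : (fun w => (w.re : ℂ) : ℂ → ℂ) =
      (1 / 2 : ℂ) • ((fun w => w : ℂ → ℂ) + fun w => (starRingEnd ℂ) w) := by
    funext w
    simp [Complex.add_conj]
  rw [this]
  exact affine.smul_mem _ (affine.add_mem id_mem_affine conj_mem_affine)

lemma im_mem_affine : (fun w => (w.im : ℂ) : ℂ → ℂ) ∈ affine := by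
  have : (fun w => (w.im : ℂ) : ℂ → ℂ) =
      (1 / (2 * Complex.I) : ℂ) • ((fun w => w : ℂ → ℂ) - fun w => (starRingEnd ℂ) w) := by
    funext w
    simp only [Pi.smul_apply, Pi.sub_apply, smul_eq_mul, Complex.sub_conj]
    field_simp [Complex.I_ne_zero]
    push_cast; ring
  rw [this]
  exact affine.smul_mem _ (affine.sub_mem id_mem_affine conj_mem_affine)

lemma lam_mem_affine (v : ℝ × ℝ) : lam v ∈ affine := by
  have : lam v = (v.1 : ℂ) • (fun w => (w.re : ℂ)) + (fun w => (w.im : ℂ)) - (v.2 : ℂ) • 1 := by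
    funext w
    simp [lam, mul_comm]
  rw [this]
  exact affine.sub_mem (affine.add_mem (affine.smul_mem _ re_mem_affine) im_mem_affine)
    (affine.smul_mem _ one_mem_affine)

lemma rePoly_mul_le (d : ℕ) : rePoly 1 * rePoly d ≤ rePoly (d + 1) := by
  rw [Submodule.mul_le]
  rintro f ⟨q, hq, hf⟩ g ⟨r, hr, hg⟩
  exact ⟨q * r, Polynomial.natDegree_mul_le.trans (by omega), fun w => by simp [hf, hg]⟩

lemma affine_le (v : ℝ × ℝ) : affine ≤ rePoly 1 ⊔ Submodule.span ℂ {lam v} := by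
  have h1 : (1 : ℂ → ℂ) ∈ rePoly 1 ⊔ Submodule.span ℂ {lam v} :=
    Submodule.mem_sup_left ⟨1, by simp, by simp⟩
  have hr : (fun w => (w.re : ℂ) : ℂ → ℂ) ∈ rePoly 1 ⊔ Submodule.span ℂ {lam v} :=
    Submodule.mem_sup_left ⟨Polynomial.X, by simp, by simp⟩
  have hl : lam v ∈ rePoly 1 ⊔ Submodule.span ℂ {lam v} :=
    Submodule.mem_sup_right (Submodule.mem_span_singleton_self _)
  have hi : (fun w => (w.im : ℂ) : ℂ → ℂ) ∈ rePoly 1 ⊔ Submodule.span ℂ {lam v} := by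
    have : (fun w => (w.im : ℂ) : ℂ → ℂ) =
        lam v - (v.1 : ℂ) • (fun w => (w.re : ℂ)) + (v.2 : ℂ) • 1 := by
      funext w
      simp only [lam, Pi.add_apply, Pi.sub_apply, Pi.smul_apply, smul_eq_mul, Pi.one_apply]
      push_cast; ring
    rw [this]
    exact Submodule.add_mem _ (Submodule.sub_mem _ hl (Submodule.smul_mem _ _ hr))
      (Submodule.smul_mem _ _ h1)
  unfold affine
  rw [Submodule.span_le]
  rintro f (rfl | rfl | rfl)
  · exact h1
  · have : (fun w => w : ℂ → ℂ) = (fun w => (w.re : ℂ)) + Complex.I • (fun w => (w.im : ℂ)) := by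
      funext w
      simp [mul_comm Complex.I, Complex.re_add_im]
    rw [this]
    exact Submodule.add_mem _ hr (Submodule.smul_mem _ _ hi)
  · have : (fun w => (starRingEnd ℂ) w : ℂ → ℂ) =
        (fun w => (w.re : ℂ)) - Complex.I • (fun w => (w.im : ℂ)) := by
      funext w
      apply Complex.ext <;> simp
    rw [this]
    exact Submodule.sub_mem _ hr (Submodule.smul_mem _ _ hi)

lemma affine_pow_le (v : ℝ × ℝ) (d : ℕ) :
    affine ^ (d + 1) ≤ rePoly (d + 1) ⊔ Submodule.span ℂ {lam v} * affine ^ d := by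
  induction d with
  | zero => simpa using affine_le v
  | succ d ih =>
    rw [pow_succ' affine (d + 1)]
    calc affine * affine ^ (d + 1)
        ≤ (rePoly 1 ⊔ Submodule.span ℂ {lam v}) * affine ^ (d + 1) :=
          mul_le_mul' (affine_le v) le_rfl
      _ = rePoly 1 * affine ^ (d + 1) ⊔ Submodule.span ℂ {lam v} * affine ^ (d + 1) :=
          Submodule.sup_mul _ _ _
      _ ≤ rePoly 1 * (rePoly (d + 1) ⊔ Submodule.span ℂ {lam v} * affine ^ d) ⊔
          Submodule.span ℂ {lam v} * affine ^ (d + 1) :=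
          sup_le_sup_right (mul_le_mul' le_rfl ih) _
      _ ≤ _ := by
          rw [Submodule.mul_sup]
          refine sup_le (sup_le ((rePoly_mul_le _).trans le_sup_left) ?_) le_sup_right
          rw [← mul_assoc, mul_comm (rePoly 1), mul_assoc]
          refine le_trans (mul_le_mul' le_rfl ?_) le_sup_right
          rw [pow_succ' affine d]
          refine mul_le_mul' ?_ le_rfl
          rintro f ⟨q, hq, hf⟩
          have : f = q.coeff 0 • (1 : ℂ → ℂ) + q.coeff 1 • (fun w : ℂ => (w.re : ℂ)) := by
            funext w
            rw [hf, Polynomial.eq_X_add_C_of_natDegree_le_one hq]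
            simp [add_comm]
          rw [this]
          exact affine.add_mem (affine.smul_mem _ one_mem_affine) (affine.smul_mem _ re_mem_affine)

/-- A function of degree `d + 1` with `d + 2` zeros on a line is divisible by its equation. -/
lemma exists_lam_mul {v : ℝ × ℝ} {d : ℕ} {f : ℂ → ℂ} (hf : f ∈ affine ^ (d + 1)) (S : Finset ℂ)
    (hS : d + 2 ≤ S.card) (hon : ∀ p ∈ S, On v p) (h0 : ∀ p ∈ S, f p = 0) :
    ∃ g ∈ affine ^ d, f = lam v * g := by
  obtain ⟨f₁, ⟨q, hq, hf₁⟩, f₂, hf₂, rfl⟩ := Submodule.mem_sup.1 (affine_pow_le v d hf)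
  obtain ⟨g, hg, rfl⟩ := Submodule.mem_span_singleton_mul.1 hf₂
  refine ⟨g, hg, ?_⟩
  have hq0 : q = 0 := by
    have hinj : Set.InjOn (fun p : ℂ => (p.re : ℂ)) S := fun a ha b hb h =>
      eq_of_re_eq (Complex.ofReal_injective h) (hon a ha) (hon b hb)
    refine Polynomial.eq_zero_of_natDegree_lt_card_of_eval_eq_zero' q
      (S.image fun p : ℂ => (p.re : ℂ)) ?_ ?_
    · intro i hi
      obtain ⟨p, hp, rfl⟩ := Finset.mem_image.1 hi
      have := h0 p hp
      rw [Pi.add_apply, hf₁, Pi.mul_apply, lam_eq_zero.2 (hon p hp), zero_mul, add_zero] at this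
      exact this
    · rw [Finset.card_image_of_injOn hinj]; omega
  have : f₁ = 0 := by funext w; rw [hf₁, hq0]; simp
  rw [this, zero_add]

/-- The Cayley–Bacharach theorem for a grid formed by three lines and three lines. -/
lemma chasles_aux {f : ℂ → ℂ} (hf : f ∈ affine ^ 3) {v u : Fin 3 → ℝ × ℝ} {p : Fin 3 → Fin 3 → ℂ}
    (hv : ∀ i i' j, On (v i) (p i' j) ↔ i = i') (hu : ∀ j i j', On (u j) (p i j') ↔ j = j')
    (h0 : ∀ i j, (i, j) ≠ (2, 2) → f (p i j) = 0) : f (p 2 2) = 0 := by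
  have pne : ∀ i j i' j', j ≠ j' → p i j ≠ p i' j' := fun i j i' j' h e =>
    h ((hu j i' j').1 (e ▸ (hu j i j).2 rfl))
  have onv : ∀ i j, On (v i) (p i j) := fun i j => (hv i i j).2 rfl
  set M : ℂ → ℂ := lam (u 0) * (lam (u 1) * lam (u 2)) with hM
  have hMmem : M ∈ affine ^ 3 := by
    rw [show (3 : ℕ) = 2 + 1 from rfl, pow_succ', pow_two]
    exact Submodule.mul_mem_mul (lam_mem_affine _)
      (Submodule.mul_mem_mul (lam_mem_affine _) (lam_mem_affine _))
  have hMp : ∀ i j, M (p i j) = 0 := by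
    intro i j
    have : lam (u j) (p i j) = 0 := lam_eq_zero.2 ((hu j i j).2 rfl)
    fin_cases j <;> simp only [hM, Pi.mul_apply] <;> simp_all
  obtain ⟨x, hx⟩ := Infinite.exists_notMem_finset
    (Finset.univ.image fun j : Fin 3 => (p 0 j).re)
  set r : ℂ := ⟨x, (v 0).2 - x * (v 0).1⟩ with hr
  have hron : On (v 0) r := by simp [On, hr]
  have hrp : ∀ j, r ≠ p 0 j := fun j e => hx (Finset.mem_image.2 ⟨j, by simp, by rw [← e]⟩)
  have hru : ∀ j, lam (u j) r ≠ 0 := by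
    intro j h
    have h := lam_eq_zero.1 h
    have e : v 0 = u j := On.unique (hrp j) hron (onv 0 j) h ((hu j 0 j).2 rfl)
    obtain ⟨j', hj'⟩ : ∃ j' : Fin 3, j ≠ j' := ⟨j + 1, by fin_cases j <;> decide⟩
    exact hj' ((hu j 0 j').1 (e ▸ onv 0 j'))
  have hMr : M r ≠ 0 := by
    simp only [hM, Pi.mul_apply]
    exact mul_ne_zero (hru 0) (mul_ne_zero (hru 1) (hru 2))
  have hf' : f - (f r / M r) • M ∈ affine ^ 3 := Submodule.sub_mem _ hf (Submodule.smul_mem _ _ hMmem)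
  have hval : ∀ i j, (f - (f r / M r) • M) (p i j) = f (p i j) := fun i j => by simp [hMp]
  have hlam : ∀ i i' j, i ≠ i' → lam (v i) (p i' j) ≠ 0 := fun i i' j h e =>
    h ((hv i i' j).1 (lam_eq_zero.1 e))
  rw [← hval]
  obtain ⟨g, hg, e⟩ := exists_lam_mul (v := v 0) (d := 2) hf' {r, p 0 0, p 0 1, p 0 2} (by
      rw [Finset.card_insert_of_notMem (by simp [hrp]),
        Finset.card_eq_three.2 ⟨_, _, _, pne 0 0 0 1 (by decide), pne 0 0 0 2 (by decide),
        pne 0 1 0 2 (by decide), rfl⟩]) (by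
      simp only [Finset.mem_insert, Finset.mem_singleton]
      rintro _ (rfl | rfl | rfl | rfl)
      exacts [hron, onv 0 0, onv 0 1, onv 0 2]) (by
      simp only [Finset.mem_insert, Finset.mem_singleton]
      rintro _ (rfl | rfl | rfl | rfl)
      · simp [hMr]
      all_goals rw [hval]; exact h0 _ _ (by decide))
  have hg1 : ∀ i j, i ≠ 0 → (i, j) ≠ (2, 2) → g (p i j) = 0 := by
    intro i j hi hij
    have := congrFun e (p i j)
    rw [hval, h0 i j hij, Pi.mul_apply] at this
    exact (mul_eq_zero.1 this.symm).resolve_left (hlam 0 i j hi.symm)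
  obtain ⟨g', hg', e'⟩ := exists_lam_mul (v := v 1) (d := 1) hg {p 1 0, p 1 1, p 1 2} (by
      rw [Finset.card_eq_three.2 ⟨_, _, _, pne 1 0 1 1 (by decide), pne 1 0 1 2 (by decide),
        pne 1 1 1 2 (by decide), rfl⟩]) (by
      simp only [Finset.mem_insert, Finset.mem_singleton]
      rintro _ (rfl | rfl | rfl)
      exacts [onv 1 0, onv 1 1, onv 1 2]) (by
      simp only [Finset.mem_insert, Finset.mem_singleton]
      rintro _ (rfl | rfl | rfl) <;> exact hg1 _ _ (by decide) (by decide))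
  have hg2 : ∀ j, j ≠ 2 → g' (p 2 j) = 0 := by
    intro j hj
    have := congrFun e' (p 2 j)
    rw [hg1 2 j (by decide) (by simpa using hj), Pi.mul_apply] at this
    exact (mul_eq_zero.1 this.symm).resolve_left (hlam 1 2 j (by decide))
  obtain ⟨k, _, e''⟩ := exists_lam_mul (v := v 2) (d := 0) hg' {p 2 0, p 2 1} (by
      rw [Finset.card_pair (pne 2 0 2 1 (by decide))]) (by
      simp only [Finset.mem_insert, Finset.mem_singleton]
      rintro _ (rfl | rfl)
      exacts [onv 2 0, onv 2 1]) (by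
      simp only [Finset.mem_insert, Finset.mem_singleton]
      rintro _ (rfl | rfl) <;> exact hg2 _ (by decide))
  rw [e, Pi.mul_apply, e', Pi.mul_apply, e'', Pi.mul_apply, lam_eq_zero.2 (onv 2 2)]
  ring

lemma chasles {f : ℂ → ℂ} (hf : f ∈ affine ^ 3) {v u : Fin 3 → ℝ × ℝ} {p : Fin 3 → Fin 3 → ℂ}
    (hv : ∀ i i' j, On (v i) (p i' j) ↔ i = i') (hu : ∀ j i j', On (u j) (p i j') ↔ j = j')
    (i₀ j₀ : Fin 3) (h0 : ∀ i j, (i, j) ≠ (i₀, j₀) → f (p i j) = 0) : f (p i₀ j₀) = 0 := by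
  set σ := Equiv.swap 2 i₀
  set τ := Equiv.swap 2 j₀
  have h := chasles_aux hf (v := v ∘ σ) (u := u ∘ τ) (p := fun i j => p (σ i) (τ j))
    (fun i i' j => by simp [hv]) (fun j i j' => by simp [hu]) (fun i j hij => h0 _ _ fun e => hij ?_)
  · simpa [σ, τ] using h
  · have h1 : σ i = σ 2 := by rw [Equiv.swap_apply_left]; exact (Prod.mk.inj e).1
    have h2 : τ j = τ 2 := by rw [Equiv.swap_apply_left]; exact (Prod.mk.inj e).2
    rw [σ.injective h1, τ.injective h2]

namespace Arrangement.Grid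

variable {A : Arrangement} {R : ℕ} {a b c : ℕ → ℂ}

/-- The nine points of a hexagon of the lattice, arranged so that rows and columns are
collinear. -/
def hexP (a b c : ℕ → ℂ) (n m : ℕ) : Fin 3 → Fin 3 → ℂ :=
  ![![c (n + m + 3), a (n + 1), b (m + 2)], ![a (n + 2), b m, c (n + m + 2)],
    ![b (m + 1), c (n + m + 1), a n]]

lemma hexP_inj (G : A.Grid R a b c) {n m : ℕ} (h : n + m + 4 ≤ R) (i j i' j' : Fin 3)
    (e : hexP a b c n m i j = hexP a b c n m i' j') : i = i' ∧ j = j' := by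
  have hA : ∀ x y, x ≤ n + 2 → y ≤ n + 2 → x ≠ y → a x ≠ a y := fun x y hx hy hxy he =>
    hxy (G.inj_a _ (by omega) _ (by omega) he)
  have hB : ∀ x y, x ≤ m + 2 → y ≤ m + 2 → x ≠ y → b x ≠ b y := fun x y hx hy hxy he =>
    hxy (G.inj_b _ (by omega) _ (by omega) he)
  have hC : ∀ x y, x ≤ n + m + 3 → y ≤ n + m + 3 → x ≠ y → c x ≠ c y := fun x y hx hy hxy he =>
    hxy (G.inj_c _ (by omega) _ (by omega) he)
  fin_cases i <;> fin_cases j <;> fin_cases i' <;> fin_cases j' <;>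
    first
    | exact ⟨rfl, rfl⟩
    | (simp [hexP] at e
       first
       | exact absurd e (hA _ _ (by omega) (by omega) (by omega))
       | exact absurd e (hB _ _ (by omega) (by omega) (by omega))
       | exact absurd e (hC _ _ (by omega) (by omega) (by omega))
       | exact absurd e (G.ac _ (by omega) _ (by omega))
       | exact absurd e.symm (G.ac _ (by omega) _ (by omega))
       | exact absurd e (G.bc _ (by omega) _ (by omega))
       | exact absurd e.symm (G.bc _ (by omega) _ (by omega))
       | exact absurd e (G.ab _ _ (by omega))
       | exact absurd e.symm (G.ab _ _ (by omega)))

lemma hex (G : A.Grid R a b c) {n m : ℕ} (h : n + m + 4 ≤ R) {f : ℂ → ℂ} (hf : f ∈ affine ^ 3)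
    (i₀ j₀ : Fin 3) (h0 : ∀ i j, (i, j) ≠ (i₀, j₀) → f (hexP a b c n m i j) = 0) :
    f (hexP a b c n m i₀ j₀) = 0 := by
  have hmem : ∀ i j, hexP a b c n m i j ∈ A.pts := fun i j => by
    fin_cases i <;> fin_cases j <;> simp [hexP, G.mem_a, G.mem_b, G.mem_c]
  have hrow : ∀ i, ∃ v, ∀ s ∈ A.pts, On v s ↔ ∃ j, s = hexP a b c n m i j := by
    have key : ∀ x y z : ℂ, ∀ v, A.thru v = {x, y, z} → ∀ s ∈ A.pts, On v s ↔ s = x ∨ s = y ∨ s = z :=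
      fun x y z v hv s hs => by
        have := A.mem_thru (v := v) (p := s)
        rw [hv] at this
        simpa [hs] using this.symm
    intro i
    fin_cases i
    · obtain ⟨v, -, hv⟩ := G.thru (n + 1) (m + 2) (by omega)
      refine ⟨v, fun s hs => ?_⟩
      rw [key _ _ _ v hv s hs]
      simp [hexP, Fin.exists_fin_succ, show n + 1 + (m + 2) = n + m + 3 by ring]
      tauto
    · obtain ⟨v, -, hv⟩ := G.thru (n + 2) m (by omega)
      refine ⟨v, fun s hs => ?_⟩
      rw [key _ _ _ v hv s hs]
      simp [hexP, Fin.exists_fin_succ, show n + 2 + m = n + m + 2 by ring]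
    · obtain ⟨v, -, hv⟩ := G.thru n (m + 1) (by omega)
      refine ⟨v, fun s hs => ?_⟩
      rw [key _ _ _ v hv s hs]
      simp [hexP, Fin.exists_fin_succ, show n + (m + 1) = n + m + 1 by ring]
      tauto
  have hcol : ∀ j, ∃ v, ∀ s ∈ A.pts, On v s ↔ ∃ i, s = hexP a b c n m i j := by
    have key : ∀ x y z : ℂ, ∀ v, A.thru v = {x, y, z} → ∀ s ∈ A.pts, On v s ↔ s = x ∨ s = y ∨ s = z :=
      fun x y z v hv s hs => by
        have := A.mem_thru (v := v) (p := s)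
        rw [hv] at this
        simpa [hs] using this.symm
    intro j
    fin_cases j
    · obtain ⟨v, -, hv⟩ := G.thru (n + 2) (m + 1) (by omega)
      refine ⟨v, fun s hs => ?_⟩
      rw [key _ _ _ v hv s hs]
      simp [hexP, Fin.exists_fin_succ, show n + 2 + (m + 1) = n + m + 3 by ring]
      tauto
    · obtain ⟨v, -, hv⟩ := G.thru (n + 1) m (by omega)
      refine ⟨v, fun s hs => ?_⟩
      rw [key _ _ _ v hv s hs]
      simp [hexP, Fin.exists_fin_succ, show n + 1 + m = n + m + 1 by ring]
    · obtain ⟨v, -, hv⟩ := G.thru n (m + 2) (by omega)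
      refine ⟨v, fun s hs => ?_⟩
      rw [key _ _ _ v hv s hs]
      simp [hexP, Fin.exists_fin_succ, show n + (m + 2) = n + m + 2 by ring]
      tauto
  choose v hv using hrow
  choose u hu using hcol
  refine chasles hf (v := v) (u := u) (fun i i' j => ?_) (fun j i j' => ?_) i₀ j₀ h0
  · rw [hv i _ (hmem _ _)]
    exact ⟨fun ⟨j', e⟩ => (G.hexP_inj h _ _ _ _ e).1.symm, fun e => ⟨j, by rw [e]⟩⟩
  · rw [hu j _ (hmem _ _)]
    exact ⟨fun ⟨i', e⟩ => (G.hexP_inj h _ _ _ _ e).2.symm, fun e => ⟨i, by rw [e]⟩⟩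

lemma hex_a₂ (G : A.Grid R a b c) {f : ℂ → ℂ} (hf : f ∈ affine ^ 3) (n m : ℕ)
    (h : n + m + 4 ≤ R) (a0 : f (a n) = 0) (a1 : f (a (n + 1)) = 0) (b0 : f (b m) = 0)
    (b1 : f (b (m + 1)) = 0) (b2 : f (b (m + 2)) = 0) (c1 : f (c (n + m + 1)) = 0)
    (c2 : f (c (n + m + 2)) = 0) (c3 : f (c (n + m + 3)) = 0) : f (a (n + 2)) = 0 :=
  G.hex h hf 1 0 fun i j hij => by
    fin_cases i <;> fin_cases j <;> first | assumption | exact absurd rfl hij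

lemma hex_b₂ (G : A.Grid R a b c) {f : ℂ → ℂ} (hf : f ∈ affine ^ 3) (n m : ℕ)
    (h : n + m + 4 ≤ R) (a0 : f (a n) = 0) (a1 : f (a (n + 1)) = 0)
    (a2 : f (a (n + 2)) = 0) (b0 : f (b m) = 0) (b1 : f (b (m + 1)) = 0)
    (c1 : f (c (n + m + 1)) = 0) (c2 : f (c (n + m + 2)) = 0) (c3 : f (c (n + m + 3)) = 0) :
    f (b (m + 2)) = 0 :=
  G.hex h hf 0 2 fun i j hij => by
    fin_cases i <;> fin_cases j <;> first | assumption | exact absurd rfl hij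

lemma hex_b₀ (G : A.Grid R a b c) {f : ℂ → ℂ} (hf : f ∈ affine ^ 3) (n m : ℕ)
    (h : n + m + 4 ≤ R) (a0 : f (a n) = 0) (a1 : f (a (n + 1)) = 0)
    (a2 : f (a (n + 2)) = 0) (b1 : f (b (m + 1)) = 0) (b2 : f (b (m + 2)) = 0)
    (c1 : f (c (n + m + 1)) = 0) (c2 : f (c (n + m + 2)) = 0) (c3 : f (c (n + m + 3)) = 0) :
    f (b m) = 0 :=
  G.hex h hf 1 1 fun i j hij => by
    fin_cases i <;> fin_cases j <;> first | assumption | exact absurd rfl hij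

lemma hex_c₁ (G : A.Grid R a b c) {f : ℂ → ℂ} (hf : f ∈ affine ^ 3) (n m : ℕ)
    (h : n + m + 4 ≤ R) (a0 : f (a n) = 0) (a1 : f (a (n + 1)) = 0)
    (a2 : f (a (n + 2)) = 0) (b0 : f (b m) = 0) (b1 : f (b (m + 1)) = 0) (b2 : f (b (m + 2)) = 0)
    (c2 : f (c (n + m + 2)) = 0) (c3 : f (c (n + m + 3)) = 0) : f (c (n + m + 1)) = 0 :=
  G.hex h hf 2 1 fun i j hij => by
    fin_cases i <;> fin_cases j <;> first | assumption | exact absurd rfl hij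

lemma hex_c₃ (G : A.Grid R a b c) {f : ℂ → ℂ} (hf : f ∈ affine ^ 3) (n m : ℕ)
    (h : n + m + 4 ≤ R) (a0 : f (a n) = 0) (a1 : f (a (n + 1)) = 0)
    (a2 : f (a (n + 2)) = 0) (b0 : f (b m) = 0) (b1 : f (b (m + 1)) = 0) (b2 : f (b (m + 2)) = 0)
    (c1 : f (c (n + m + 1)) = 0) (c2 : f (c (n + m + 2)) = 0) : f (c (n + m + 3)) = 0 :=
  G.hex h hf 0 0 fun i j hij => by
    fin_cases i <;> fin_cases j <;> first | assumption | exact absurd rfl hij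

/-- Vanishing on the initial block of the lattice. -/
structure _root_.Block (a b c : ℕ → ℂ) (f : ℂ → ℂ) : Prop where
  a : ∀ i ≤ 3, f (a i) = 0
  b : ∀ i ≤ 3, f (b i) = 0
  c : ∀ i ≤ 3, f (c (i + 1)) = 0

lemma block_of_core (G : A.Grid R a b c) (hR : 5 ≤ R) {f : ℂ → ℂ} (hf : f ∈ affine ^ 3)
    (ha : ∀ i ≤ 2, f (a i) = 0) (hb : ∀ i ≤ 3, f (b i) = 0) (c2 : f (c 2) = 0)
    (c3 : f (c 3) = 0) : Block a b c f := by
  have c1 : f (c 1) = 0 := G.hex_c₁ hf 0 0 (by omega) (ha 0 (by omega)) (ha 1 (by omega))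
    (ha 2 (by omega)) (hb 0 (by omega)) (hb 1 (by omega)) (hb 2 (by omega)) c2 c3
  have c4 : f (c 4) = 0 := G.hex_c₃ hf 0 1 (by omega) (ha 0 (by omega)) (ha 1 (by omega))
    (ha 2 (by omega)) (hb 1 (by omega)) (hb 2 (by omega)) (hb 3 (by omega)) c2 c3
  have a3 : f (a 3) = 0 := G.hex_a₂ hf 1 0 (by omega) (ha 1 (by omega)) (ha 2 (by omega))
    (hb 0 (by omega)) (hb 1 (by omega)) (hb 2 (by omega)) c2 c3 c4
  refine ⟨fun i hi => ?_, hb, fun i hi => ?_⟩ <;> interval_cases i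
  exacts [ha 0 (by omega), ha 1 (by omega), ha 2 (by omega), a3, c1, c2, c3, c4]

lemma block_extend (G : A.Grid R a b c) {f : ℂ → ℂ} (hf : f ∈ affine ^ 3) (hB : Block a b c f)
    (k : ℕ) (hk : 3 ≤ k) (hR : k + 2 ≤ R) :
    (∀ i ≤ k, f (a i) = 0) ∧ (∀ i ≤ k, f (b i) = 0) ∧ ∀ i ≤ k, f (c (i + 1)) = 0 := by
  induction k, hk using Nat.le_induction with
  | base => exact ⟨hB.a, hB.b, hB.c⟩
  | succ k hk ih =>
    obtain ⟨ha, hb, hc⟩ := ih (by omega)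
    obtain ⟨l, rfl⟩ : ∃ l, k = l + 2 := ⟨k - 2, by omega⟩
    have hcn : f (c (l + 2 + 1 + 1)) = 0 := by
      have := G.hex_c₃ hf 1 l (by omega) (ha 1 (by omega)) (ha 2 (by omega)) (ha 3 (by omega))
        (hb l (by omega)) (hb (l + 1) (by omega)) (hb (l + 2) (by omega))
        (hc (1 + l) (by omega)) (hc (1 + l + 1) (by omega))
      rwa [show 1 + l + 3 = l + 2 + 1 + 1 by ring] at this
    have hbn : f (b (l + 2 + 1)) = 0 := by
      refine G.hex_b₂ hf 0 (l + 1) (by omega) (ha 0 (by omega)) (ha 1 (by omega)) (ha 2 (by omega))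
        (hb (l + 1) (by omega)) (hb (l + 2) (by omega)) (hc (0 + (l + 1)) (by omega))
        (hc (0 + (l + 1) + 1) (by omega)) ?_
      rwa [show 0 + (l + 1) + 3 = l + 2 + 1 + 1 by ring]
    have han : f (a (l + 2 + 1)) = 0 := by
      refine G.hex_a₂ hf (l + 1) 0 (by omega) (ha (l + 1) (by omega)) (ha (l + 2) (by omega))
        (hb 0 (by omega)) (hb 1 (by omega)) (hb 2 (by omega)) (hc (l + 1 + 0) (by omega))
        (hc (l + 1 + 0 + 1) (by omega)) ?_
      rwa [show l + 1 + 0 + 3 = l + 2 + 1 + 1 by ring]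
    refine ⟨fun i hi => ?_, fun i hi => ?_, fun i hi => ?_⟩ <;>
      rcases Nat.lt_or_ge i (l + 3) with h | h
    · exact ha i (by omega)
    · obtain rfl : i = l + 2 + 1 := by omega
      exact han
    · exact hb i (by omega)
    · obtain rfl : i = l + 2 + 1 := by omega
      exact hbn
    · exact hc i (by omega)
    · obtain rfl : i = l + 2 + 1 := by omega
      exact hcn

lemma block_shift (G : A.Grid R a b c) (hR : 6 ≤ R) {f : ℂ → ℂ} (hf : f ∈ affine ^ 3) :
    Block a b c f ↔ Block a (fun i => b (i + 1)) (fun i => c (i + 1)) f := by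
  constructor
  · intro h
    obtain ⟨-, hb, hc⟩ := G.block_extend hf h 4 (by omega) (by omega)
    exact ⟨h.a, fun i hi => hb _ (by omega), fun i hi => hc _ (by omega)⟩
  · intro h
    have b0 : f (b 0) = 0 := G.hex_b₀ hf 1 0 (by omega) (h.a 1 (by omega)) (h.a 2 (by omega))
      (h.a 3 (by omega)) (h.b 0 (by omega)) (h.b 1 (by omega)) (h.c 0 (by omega))
      (h.c 1 (by omega)) (h.c 2 (by omega))
    have c1 : f (c 1) = 0 := G.hex_c₁ hf 0 0 (by omega) (h.a 0 (by omega)) (h.a 1 (by omega))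
      (h.a 2 (by omega)) b0 (h.b 0 (by omega)) (h.b 1 (by omega)) (h.c 0 (by omega))
      (h.c 1 (by omega))
    refine ⟨h.a, fun i hi => ?_, fun i hi => ?_⟩
    · rcases i with _ | i
      exacts [b0, h.b i (by omega)]
    · rcases i with _ | i
      exacts [c1, h.c i (by omega)]

end Arrangement.Grid

/-- The exponents of the monomials of degree at most three. -/
abbrev CubIdx := {ij : Fin 4 × Fin 4 // ij.1.val + ij.2.val ≤ 3}

/-- The coefficients of a real-analytic cubic in `w` and its conjugate. -/
abbrev Cub := CubIdx → ℂ

/-- The value of a cubic. -/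
def cev (k : Cub) (w : ℂ) : ℂ := ∑ ij, k ij * (w ^ ij.1.1.val * (starRingEnd ℂ) w ^ ij.1.2.val)

lemma cev_mem (k : Cub) : cev k ∈ affine ^ 3 := by
  have h1 : (1 : Submodule ℂ (ℂ → ℂ)) ≤ affine := by
    rw [Submodule.one_le]; exact one_mem_affine
  have : cev k = ∑ ij, k ij • ((fun w : ℂ => w) ^ ij.1.1.val *
      (fun w : ℂ => (starRingEnd ℂ) w) ^ ij.1.2.val) := by
    funext w
    simp [cev, Finset.sum_apply]
  rw [this]
  refine Submodule.sum_mem _ fun ij _ => Submodule.smul_mem _ _ ?_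
  have := Submodule.mul_mem_mul (Submodule.pow_mem_pow _ id_mem_affine ij.1.1.val)
    (Submodule.pow_mem_pow _ conj_mem_affine ij.1.2.val)
  rw [← pow_add] at this
  exact pow_le_pow_right' h1 ij.2 this

/-- Evaluation at a point as a linear functional on cubics. -/
def cevL (w : ℂ) : Cub →ₗ[ℂ] ℂ where
  toFun k := cev k w
  map_add' k l := by simp [cev, add_mul, Finset.sum_add_distrib]
  map_smul' r k := by simp [cev, mul_assoc, Finset.mul_sum]

lemma exists_cubic (S : Fin 9 → ℂ) : ∃ k : Cub, k ≠ 0 ∧ ∀ i, cev k (S i) = 0 := by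
  have h := LinearMap.ker_ne_bot_of_finrank_lt (f := LinearMap.pi fun i => cevL (S i)) (by
    rw [Module.finrank_fin_fun, Module.finrank_fintype_fun_eq_card]; decide)
  obtain ⟨k, hk, h0⟩ := (Submodule.ne_bot_iff _).1 h
  exact ⟨k, h0, fun i => congrFun (LinearMap.mem_ker.1 hk) i⟩

namespace Arrangement

variable {A : Arrangement} {R : ℕ}

lemma Grid.exists_block {a b c : ℕ → ℂ} (G : A.Grid R a b c) (hR : 5 ≤ R) :
    ∃ k : Cub, k ≠ 0 ∧ Block a b c (cev k) := by
  obtain ⟨k, hk, h⟩ := exists_cubic ![a 0, a 1, a 2, b 0, b 1, b 2, b 3, c 2, c 3]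
  refine ⟨k, hk, G.block_of_core hR (cev_mem k) (fun i hi => ?_) (fun i hi => ?_) (h 7) (h 8)⟩ <;>
    interval_cases i
  exacts [h 0, h 1, h 2, h 3, h 4, h 5, h 6]

namespace Flag

/-- The cubics vanishing on the initial block of the lattice at a flag. -/
def J (f : A.Flag) : Set Cub := {k | Block f.lineA f.lineB f.lineC (cev k)}

variable {f : A.Flag}

lemma J_vanish (hf : f.Lat R) (hA : 2 * R + 1 < A.pts.card) {k : Cub} (hk : k ∈ f.J) {n : ℕ}
    (hn : 3 ≤ n) (hnR : n + 2 ≤ R) : (∀ i ≤ n, cev k (f.lineA i) = 0) ∧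
      (∀ i ≤ n, cev k (f.lineB i) = 0) ∧ ∀ i ≤ n, cev k (f.lineC (i + 1)) = 0 :=
  (hf.grid hA).block_extend (cev_mem k) hk n hn hnR

lemma J_shift (hf : f.Lat R) (hA : 2 * R + 1 < A.pts.card) (hR : 6 ≤ R) : f.shift.J = f.J := by
  have ha : ∀ n ≤ 3, f.shift.lineA n = f.lineA n := fun n hn => hf.grid_p (n := n) (m := 1) (by omega)
  have hb : ∀ n, f.shift.lineB n = f.lineB (n + 1) := fun n => by
    simp [lineB, Function.iterate_succ_apply]
  have hc : ∀ n, f.shift.lineC n = f.lineC (n + 1) := fun n => by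
    simp [lineC, Function.iterate_succ_apply]
  ext k
  refine Iff.trans ?_ ((hf.grid hA).block_shift hR (cev_mem k)).symm
  constructor
  · intro h
    exact ⟨fun i hi => ha i hi ▸ h.a i hi, fun i hi => hb i ▸ h.b i hi,
      fun i hi => hc (i + 1) ▸ h.c i hi⟩
  · intro h
    exact ⟨fun i hi => by rw [ha i hi]; exact h.a i hi, fun i hi => by rw [hb]; exact h.b i hi,
      fun i hi => by rw [hc]; exact h.c i hi⟩

lemma exists_mem_J (hf : f.Lat R) (hA : 2 * R + 1 < A.pts.card) (hR : 6 ≤ R) :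
    ∃ k ∈ f.J, k ≠ 0 := by
  obtain ⟨k, h0, hk⟩ := (hf.grid hA).exists_block (by omega)
  exact ⟨k, hk, h0⟩

lemma lineC_zero (h3 : (A.thru f.v).card = 3) : f.lineC 0 = f.σ₂.lineB 0 := by
  have h := turn_two f h3
  have e : f.rot.rot = f.opp.σ₂.σ₁ := by
    have := congrArg (fun g : A.Flag => g.σ₂.σ₁) (turn_three f h3)
    simpa [rot] using this
  show f.rot.rot.p = f.σ₂.rot.p
  rw [e, opp_σ₂, ← opp_σ₁]
  rfl

lemma shift_eq_of_lt (hd : f.d = 1) {u : ℝ × ℝ} (hu : u ∈ A.onV f.p) (h : f.v.1 < u.1) :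
    f.shift.s = f.s ∧ f.v.1 < f.shift.v.1 := by
  obtain ⟨κ, hκ⟩ : ∃ κ, κ = f.σ₀.s * f.s := ⟨_, rfl⟩
  have hs := f.shift_spec
  rw [← hκ, hd] at hs
  have hne : f.shift.v.1 ≠ f.v.1 := fun e =>
    hs.ne (A.injOn_onV f.p hs.mem f.mem_onV e)
  have h1 : κ = 1 := by
    rcases Int.units_eq_one_or κ with h1 | h1
    · exact h1
    · exfalso
      have h2 := hs.sgn
      rw [h1, mul_one, sg_eq_neg_one (sub_ne_zero.2 hne)] at h2
      have hu1 : u ≠ f.v := fun e => by rw [e] at h; exact lt_irrefl _ h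
      have hu2 : u ≠ f.shift.v := fun e => by rw [e] at h; linarith
      have h3 := hs.btw u hu hu1 hu2
      rw [sg_of_pos (by linarith), sg_of_pos (by linarith), h1] at h3
      exact absurd h3 (by decide)
  constructor
  · have : f.σ₀.s = f.s := by
      have := congrArg (· * f.s) hκ
      simp only [h1, mul_assoc, units_mul_self, one_mul, mul_one] at this
      exact this.symm
    show - -f.σ₀.s = f.s
    rw [neg_neg, this]
  · have h2 := hs.sgn
    rw [h1, one_mul, sg_eq_one] at h2
    linarith

/-- The flag points from the last vertex of its line. -/
def IsLast (f : A.Flag) : Prop := ∀ u ∈ A.onV f.p, u.1 ≤ f.v.1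

lemma exists_J_eq (hA : 2 * R + 1 < A.pts.card) (hR : 6 ≤ R) : ∀ N : ℕ, ∀ f : A.Flag, f.d = 1 →
    ((A.onV f.p).filter fun u => f.v.1 < u.1).card ≤ N →
    ∃ g : A.Flag, g.p = f.p ∧ g.d = 1 ∧ g.J = f.J ∧ (¬ g.Lat R ∨ g.IsLast) := by
  intro N
  induction N with
  | zero =>
    intro f hd hN
    refine ⟨f, rfl, hd, rfl, Or.inr fun u hu => ?_⟩
    by_contra! h
    have : u ∈ (A.onV f.p).filter fun u => f.v.1 < u.1 := Finset.mem_filter.2 ⟨hu, h⟩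
    rw [Finset.card_eq_zero.1 (Nat.le_zero.1 hN)] at this
    simp at this
  | succ N ih =>
    intro f hd hN
    by_cases hL : f.Lat R
    · by_cases hl : f.IsLast
      · exact ⟨f, rfl, hd, rfl, Or.inr hl⟩
      · unfold IsLast at hl
        push Not at hl
        obtain ⟨u, hu, hlt⟩ := hl
        obtain ⟨hs, hv⟩ := shift_eq_of_lt hd hu hlt
        obtain ⟨g, g1, g2, g3, g4⟩ := ih f.shift (by rw [shift_d, hd]) (by
          rw [shift_p]
          refine Nat.lt_succ_iff.1 (lt_of_lt_of_le (Finset.card_lt_card ?_) hN)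
          refine ⟨fun x hx => ?_, fun hsub => ?_⟩
          · have := Finset.mem_filter.1 hx
            exact Finset.mem_filter.2 ⟨this.1, hv.trans this.2⟩
          · have h1 : f.shift.v ∈ (A.onV f.p).filter fun u => f.v.1 < u.1 :=
              Finset.mem_filter.2 ⟨f.shift.mem_onV, hv⟩
            exact lt_irrefl _ (Finset.mem_filter.1 (hsub h1)).2)
        exact ⟨g, g1, g2, g3.trans (J_shift hL hA hR), g4⟩
    · exact ⟨f, rfl, hd, rfl, Or.inl hL⟩

end Flag

open Classical in
/-- All points are covered by few vertices on a given line and few cubics attached to lattices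
based on that line. -/
lemma exists_cover (hA : 2 * R + 1 < A.pts.card) (hR : 6 ≤ R) {p : ℂ} (hp : p ∈ A.pts) {b : ℕ}
    (hb : (Finset.univ.filter fun f : A.Flag => f.p = p ∧ ¬ f.Lat R).card ≤ b) :
    ∃ (L : Finset (ℝ × ℝ)) (K : Finset Cub), L.card ≤ b ∧ K.card ≤ b + 2 ∧ L ⊆ A.onV p ∧
      (∀ k ∈ K, k ≠ 0 ∧ ∃ f : A.Flag, f.p = p ∧ f.Lat R ∧ k ∈ f.J) ∧
      ∀ q ∈ A.pts, q ≠ p → (∃ v ∈ L, On v q) ∨ ∃ k ∈ K, cev k q = 0 := by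
  set bad := Finset.univ.filter fun f : A.Flag => f.p = p ∧ ¬ f.Lat R with hbad
  set last := Finset.univ.filter fun f : A.Flag => f.p = p ∧ f.d = 1 ∧ f.IsLast with hlast
  set good := Finset.univ.filter fun f : A.Flag => f.p = p ∧ f.d = 1 ∧ f.Lat R with hgood
  obtain ⟨ch, hch⟩ : ∃ ch : Set Cub → Cub, ∀ S, (∃ k ∈ S, k ≠ 0) → ch S ∈ S ∧ ch S ≠ 0 := by
    refine ⟨fun S => if h : ∃ k ∈ S, k ≠ 0 then h.choose else 0, fun S h => ?_⟩
    simp only [dif_pos h]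
    exact h.choose_spec
  have hlc : last.card ≤ 2 := by
    have : last.card ≤ (Finset.univ : Finset ℤˣ).card := by
      refine Finset.card_le_card_of_injOn (fun f => f.s) (fun _ _ => Finset.mem_coe.2 (Finset.mem_univ _)) ?_
      intro f hf g hg hs
      simp only [hlast, Finset.coe_filter, Finset.mem_univ, true_and, Set.mem_ofPred_eq] at hf hg
      have h1 := hf.2.2 g.v (by rw [hf.1, ← hg.1]; exact g.mem_onV)
      have h2 := hg.2.2 f.v (by rw [hg.1, ← hf.1]; exact f.mem_onV)
      have hv : f.v = g.v := A.injOn_onV p (by rw [← hf.1]; exact f.mem_onV)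
        (by rw [← hg.1]; exact g.mem_onV) (le_antisymm h2 h1)
      exact Flag.ext hv (hf.1.trans hg.1.symm) (hf.2.1.trans hg.2.1.symm) hs
    simpa using this
  refine ⟨bad.image Flag.v, good.image fun f => ch f.J, Finset.card_image_le.trans hb, ?_, ?_, ?_, ?_⟩
  · have hsub : (good.image fun f => ch f.J) ⊆ (bad ∪ last).image fun f => ch f.J := by
      intro k hk
      obtain ⟨f, hf, rfl⟩ := Finset.mem_image.1 hk
      have hf := (Finset.mem_filter.1 hf).2
      obtain ⟨g, g1, g2, g3, g4⟩ := Flag.exists_J_eq hA hR _ f hf.2.1 le_rfl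
      refine Finset.mem_image.2 ⟨g, ?_, by rw [g3]⟩
      rw [Finset.mem_union]
      rcases g4 with g4 | g4
      · exact Or.inl (Finset.mem_filter.2 ⟨Finset.mem_univ _, g1.trans hf.1, g4⟩)
      · exact Or.inr (Finset.mem_filter.2 ⟨Finset.mem_univ _, g1.trans hf.1, g2, g4⟩)
    exact (Finset.card_le_card hsub).trans (Finset.card_image_le.trans
      ((Finset.card_union_le _ _).trans (add_le_add hb hlc)))
  · intro v hv
    obtain ⟨f, hf, rfl⟩ := Finset.mem_image.1 hv
    rw [← (Finset.mem_filter.1 hf).2.1]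
    exact f.mem_onV
  · intro k hk
    obtain ⟨f, hf, rfl⟩ := Finset.mem_image.1 hk
    have hf := (Finset.mem_filter.1 hf).2
    have := hch f.J (Flag.exists_mem_J hf.2.2 hA hR)
    exact ⟨this.2, f, hf.1, hf.2.2, this.1⟩
  · intro q hq hqp
    have hon : On (meet p q) q := on_meet_right (re_ne hp hq hqp.symm)
    have hv := meet_mem hp hq hqp.symm
    obtain ⟨f, hfv, hfp, hfd⟩ : ∃ f : A.Flag, f.v = meet p q ∧ f.p = p ∧ f.d = 1 :=
      ⟨⟨meet p q, p, 1, 1, hv, hp, on_meet_left p q⟩, rfl, rfl, rfl⟩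
    by_cases h1 : f.Lat R
    · by_cases h2 : f.σ₂.Lat R
      · right
        have h3 := (h1 0 0 (by omega)).three
        have hqm : q ∈ A.thru f.v := A.mem_thru.2 ⟨hq, hfv ▸ hon⟩
        have key : ∀ g : A.Flag, g.p = p → g.d = 1 → g.Lat R → q = g.lineB 0 →
            ∃ k ∈ good.image fun f => ch f.J, cev k q = 0 := fun g gp gd gl e =>
          ⟨ch g.J, Finset.mem_image.2 ⟨g, Finset.mem_filter.2 ⟨Finset.mem_univ _, gp, gd, gl⟩, rfl⟩,
            e ▸ (hch g.J (Flag.exists_mem_J gl hA hR)).1.b 0 (by omega)⟩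
        rw [Flag.thru_eq f h3] at hqm
        simp only [Finset.mem_insert, Finset.mem_singleton] at hqm
        rcases hqm with e | e | e
        · exact absurd (e.trans hfp) hqp
        · exact key f hfp hfd h1 e
        · exact key f.σ₂ hfp hfd h2 (e.trans (Flag.lineC_zero h3))
      · left
        exact ⟨f.σ₂.v, Finset.mem_image.2 ⟨f.σ₂, Finset.mem_filter.2
          ⟨Finset.mem_univ _, hfp, h2⟩, rfl⟩, by rw [show f.σ₂.v = f.v from rfl, hfv]; exact hon⟩
    · left
      exact ⟨f.v, Finset.mem_image.2 ⟨f, Finset.mem_filter.2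
          ⟨Finset.mem_univ _, hfp, h1⟩, rfl⟩, by rw [hfv]; exact hon⟩

end Arrangement

namespace Arrangement

variable {A : Arrangement} {R : ℕ}

open Classical in
lemma card_flag_on (p : ℂ) (hp : p ∈ A.pts) :
    4 * (A.onV p).card ≤ (Finset.univ.filter fun f : A.Flag => f.p = p).card := by
  have : ((A.onV p).attach ×ˢ (Finset.univ : Finset (ℤˣ × ℤˣ))).card ≤
      (Finset.univ.filter fun f : A.Flag => f.p = p).card := by
    refine Finset.card_le_card_of_injOn (fun t => ⟨t.1.1, p, t.2.1, t.2.2, (A.mem_onV.1 t.1.2).1, hp,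
      (A.mem_onV.1 t.1.2).2⟩) (fun t _ => by simp) ?_
    rintro ⟨v, d, s⟩ - ⟨v', d', s'⟩ - h
    simp only [Flag.mk.injEq, true_and] at h
    exact Prod.ext (Subtype.ext h.1) (Prod.ext h.2.1 h.2.2)
  rw [Finset.card_product, Finset.card_attach] at this
  have e : (Finset.univ : Finset (ℤˣ × ℤˣ)).card = 4 := by decide
  rw [e] at this
  omega

namespace Flag

open Classical in
lemma card_of_on {p q : ℂ} (hq : q ≠ p) (j : ℕ) :
    (Finset.univ.filter fun f : A.Flag => f.p = p ∧ On (shift^[j] f).v q).card ≤ 4 := by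
  have : (Finset.univ.filter fun f : A.Flag => f.p = p ∧ On (shift^[j] f).v q).card ≤
      (Finset.univ : Finset (ℤˣ × ℤˣ)).card := by
    refine Finset.card_le_card_of_injOn (fun f => ((shift^[j] f).d, (shift^[j] f).s))
      (fun _ _ => Finset.mem_coe.2 (Finset.mem_univ _)) ?_
    intro f hf g hg h
    have hf := (Finset.mem_filter.1 (Finset.mem_coe.1 hf)).2
    have hg := (Finset.mem_filter.1 (Finset.mem_coe.1 hg)).2
    have hfp : (shift^[j] f).p = p := by rw [iterate_shift_p, hf.1]
    have hgp : (shift^[j] g).p = p := by rw [iterate_shift_p, hg.1]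
    have hv : (shift^[j] f).v = (shift^[j] g).v :=
      On.unique hq hf.2 (hfp ▸ (shift^[j] f).on) hg.2 (hgp ▸ (shift^[j] g).on)
    have h := Prod.mk.inj h
    exact (Function.Injective.iterate (fun _ _ => shift_inj) j)
      (Flag.ext hv (hfp.trans hgp.symm) h.1 h.2)
  have e : (Finset.univ : Finset (ℤˣ × ℤˣ)).card = 4 := by decide
  omega

lemma on_lineB (f : A.Flag) (j : ℕ) : On (shift^[j] f).v (f.lineB j) := (shift^[j] f).rot.on

lemma on_lineC (f : A.Flag) (j : ℕ) : On (shift^[j] f).v (f.lineC j) := (shift^[j] f).rot.rot.on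

lemma on_p (f : A.Flag) (j : ℕ) : On (shift^[j] f).v f.p := by
  have := (shift^[j] f).on
  rwa [iterate_shift_p] at this

lemma lineB_ne (f : A.Flag) (m : ℕ) : f.lineB m ≠ f.p := by
  have := (shift^[m] f).rot_p_ne
  rwa [iterate_shift_p] at this

lemma lineB_mem (f : A.Flag) (m : ℕ) : f.lineB m ∈ A.pts := Flag.hp _
lemma lineC_mem (f : A.Flag) (m : ℕ) : f.lineC m ∈ A.pts := Flag.hp _

lemma Lat.lineC_ne {f : A.Flag} (hf : f.Lat R) {m : ℕ} (hm : m ≤ R) : f.lineC m ≠ f.p := by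
  have := (shift^[m] f).rot_rot_p_ne (hf 0 m (by omega)).three
  rwa [iterate_shift_p] at this

end Flag

open Classical in
/-- If no lattice based on `p` avoids `E` along two of its families, then there are many flags on
`p` without a lattice. -/
lemma card_bad_on_ge {p : ℂ} (hp : p ∈ A.pts) (E : Finset ℂ) {T : ℕ} (hT : T ≤ R)
    (h : ∀ f : A.Flag, f.p = p → f.Lat R → ∃ j ≤ T, f.lineB j ∈ E ∨ f.lineC j ∈ E) :
    4 * (A.onV p).card ≤ (Finset.univ.filter fun f : A.Flag => f.p = p ∧ ¬ f.Lat R).card +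
      4 * (T + 1) * E.card := by
  refine (card_flag_on p hp).trans ?_
  have hsub : (Finset.univ.filter fun f : A.Flag => f.p = p) ⊆
      (Finset.univ.filter fun f : A.Flag => f.p = p ∧ ¬ f.Lat R) ∪
      ((Finset.range (T + 1) ×ˢ E.erase p).biUnion fun jq =>
        Finset.univ.filter fun f : A.Flag => f.p = p ∧ On (Flag.shift^[jq.1] f).v jq.2) := by
    intro f hf
    have hfp := (Finset.mem_filter.1 hf).2
    rw [Finset.mem_union]
    by_cases hL : f.Lat R
    · right
      obtain ⟨j, hj, hq⟩ := h f hfp hL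
      rw [Finset.mem_biUnion]
      rcases hq with hq | hq
      · exact ⟨(j, f.lineB j), Finset.mem_product.2 ⟨Finset.mem_range.2 (by omega),
          Finset.mem_erase.2 ⟨hfp ▸ f.lineB_ne j, hq⟩⟩, Finset.mem_filter.2
            ⟨Finset.mem_univ _, hfp, f.on_lineB j⟩⟩
      · exact ⟨(j, f.lineC j), Finset.mem_product.2 ⟨Finset.mem_range.2 (by omega),
          Finset.mem_erase.2 ⟨hfp ▸ hL.lineC_ne (by omega), hq⟩⟩, Finset.mem_filter.2
            ⟨Finset.mem_univ _, hfp, f.on_lineC j⟩⟩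
    · exact Or.inl (Finset.mem_filter.2 ⟨Finset.mem_univ _, hfp, hL⟩)
  refine (Finset.card_le_card hsub).trans ((Finset.card_union_le _ _).trans
    (Nat.add_le_add_left ?_ _))
  have := Finset.card_biUnion_le_card_mul (Finset.range (T + 1) ×ˢ E.erase p) (fun jq =>
        Finset.univ.filter fun f : A.Flag => f.p = p ∧ On (Flag.shift^[jq.1] f).v jq.2) 4
    (fun jq hjq => Flag.card_of_on (Finset.ne_of_mem_erase (Finset.mem_product.1 hjq).2) _)
  refine this.trans ?_
  rw [Finset.card_product, Finset.card_range]
  have h1 : (E.erase p).card ≤ E.card := Finset.card_le_card (Finset.erase_subset _ _)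
  nlinarith

open Classical in
lemma sum_bad_on_le (S : Finset ℂ) :
    ∑ p ∈ S, (Finset.univ.filter fun f : A.Flag => f.p = p ∧ ¬ f.Lat R).card ≤
      24 * 5 ^ (5 * R + 7) * A.n₂ := by
  refine le_trans ?_ (Flag.card_not_goodN (A := A) (5 * R + 7))
  rw [← Finset.card_biUnion]
  · refine Finset.card_le_card fun f hf => ?_
    obtain ⟨p, -, hf⟩ := Finset.mem_biUnion.1 hf
    have hf := (Finset.mem_filter.1 hf).2.2
    exact Finset.mem_filter.2 ⟨Finset.mem_univ _, fun h => hf h.lat⟩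
  · intro p _ q _ hpq
    refine Finset.disjoint_left.2 fun f h1 h2 => ?_
    exact hpq ((Finset.mem_filter.1 h1).2.1.symm.trans (Finset.mem_filter.1 h2).2.1)

open Classical in
/-- Every point of `p` is on a vertex of `p`, so large vertices are needed if there are few. -/
lemma card_le_onV {p : ℂ} (hp : p ∈ A.pts) (S : Finset ℂ) (hS : S ⊆ A.pts) (hpS : p ∉ S) {D : ℕ}
    (hD : ∀ v ∈ A.onV p, (S.filter (On v)).card ≤ D) : S.card ≤ (A.onV p).card * D := by
  have : S ⊆ (A.onV p).biUnion fun v => S.filter (On v) := fun q hq => by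
    have hqp : p ≠ q := fun e => hpS (e ▸ hq)
    exact Finset.mem_biUnion.2 ⟨meet p q, A.mem_onV.2 ⟨meet_mem hp (hS hq) hqp, on_meet_left p q⟩,
      Finset.mem_filter.2 ⟨hq, on_meet_right (re_ne hp (hS hq) hqp)⟩⟩
  exact (Finset.card_le_card this).trans (Finset.card_biUnion_le_card_mul _ _ _ hD)

open Classical in
/-- The combined count: exceptional points force many vertices on two lines only. -/
lemma card_mul_le_n₂ (E S : Finset ℂ) (hE : E ⊆ A.pts) (hS : S ⊆ A.pts) (hES : Disjoint E S)
    {T D : ℕ} (hT : T ≤ R)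
    (hD : ∀ p ∈ E, ∀ v ∈ A.onV p, (S.filter (On v)).card ≤ D)
    (h : ∀ f : A.Flag, f.p ∈ E → f.Lat R → ∃ j ≤ T, f.lineB j ∈ E ∨ f.lineC j ∈ E) :
    4 * S.card * E.card ≤ D * (24 * 5 ^ (5 * R + 7) * A.n₂ + 4 * (T + 1) * E.card * E.card) := by
  have h1 : ∀ p ∈ E, 4 * S.card ≤ D * ((Finset.univ.filter fun f : A.Flag =>
      f.p = p ∧ ¬ f.Lat R).card + 4 * (T + 1) * E.card) := fun p hp => by
    have a1 := card_le_onV (hE hp) S hS (Finset.disjoint_left.1 hES hp) (hD p hp)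
    have a2 := card_bad_on_ge (hE hp) E hT (fun f hf => h f (hf ▸ hp))
    calc 4 * S.card ≤ 4 * ((A.onV p).card * D) := Nat.mul_le_mul_left _ a1
      _ = D * (4 * (A.onV p).card) := by ring
      _ ≤ _ := Nat.mul_le_mul_left _ a2
  have h2 := Finset.sum_le_sum h1
  rw [Finset.sum_const, ← Finset.mul_sum, Finset.sum_add_distrib, Finset.sum_const, smul_eq_mul,
    smul_eq_mul] at h2
  calc 4 * S.card * E.card = E.card * (4 * S.card) := by ring
    _ ≤ _ := h2
    _ ≤ _ := by
      refine Nat.mul_le_mul_left _ (add_le_add (sum_bad_on_le E) (le_of_eq ?_))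
      ring

open Classical in
/-- Some line carries few flags without a lattice. -/
lemma exists_few_bad (S : Finset ℂ) (hS : S.Nonempty) : ∃ p ∈ S,
    S.card * (Finset.univ.filter fun f : A.Flag => f.p = p ∧ ¬ f.Lat R).card ≤
      24 * 5 ^ (5 * R + 7) * A.n₂ := by
  by_contra! h
  have h1 := sum_bad_on_le (A := A) (R := R) S
  obtain ⟨p, hp, hmin⟩ := Finset.exists_min_image S (fun p => (Finset.univ.filter fun f : A.Flag =>
    f.p = p ∧ ¬ f.Lat R).card) hS
  have h2 := Finset.card_nsmul_le_sum S _ _ hmin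
  rw [smul_eq_mul] at h2
  exact absurd (h2.trans h1) (h p hp).not_ge

end Arrangement

section

open Polynomial ComplexConjugate

/-- The value of a bivariate polynomial at `(z, conj z)`. -/
def ev (z : ℂ) : ℂ[X][X] →+* ℂ := evalEvalRingHom z (conj z)

theorem ev_apply (z : ℂ) (F : ℂ[X][X]) : ev z F = F.evalEval z (conj z) := rfl

@[simp] theorem ev_CC (z a : ℂ) : ev z (C (C a)) = a := by simp [ev_apply]
@[simp] theorem ev_CX (z : ℂ) : ev z (C X) = z := by simp [ev_apply, evalEval_C]
@[simp] theorem ev_X (z : ℂ) : ev z X = conj z := by simp [ev_apply]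

/-- Both partial degrees are at most `k`. -/
def Bideg (k : ℕ) (F : ℂ[X][X]) : Prop := F.natDegree ≤ k ∧ (Bivariate.swap F).natDegree ≤ k

theorem coeff_swap (F : ℂ[X][X]) (i j : ℕ) :
    ((Bivariate.swap F).coeff i).coeff j = (F.coeff j).coeff i := by
  induction F using Polynomial.induction_on' with
  | add p q hp hq => simp only [map_add, coeff_add, hp, hq]
  | monomial n a =>
    induction a using Polynomial.induction_on' with
    | add p q hp hq => simp only [map_add, coeff_add, hp, hq]
    | monomial m r =>
      rw [Bivariate.swap_monomial_monomial]
      simp only [coeff_monomial]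
      split_ifs <;> simp_all [coeff_monomial]

theorem Bideg.coeff_natDegree {k : ℕ} {F : ℂ[X][X]} (h : Bideg k F) (j : ℕ) :
    (F.coeff j).natDegree ≤ k := by
  rw [natDegree_le_iff_coeff_eq_zero]
  intro i hi
  rw [← coeff_swap, coeff_eq_zero_of_natDegree_lt (h.2.trans_lt hi), coeff_zero]

theorem bideg_iff {k : ℕ} {F : ℂ[X][X]} :
    Bideg k F ↔ ∀ i j, k < i ∨ k < j → (F.coeff i).coeff j = 0 := by
  constructor
  · rintro h i j (hi | hj)
    · rw [coeff_eq_zero_of_natDegree_lt (h.1.trans_lt hi), coeff_zero]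
    · exact coeff_eq_zero_of_natDegree_lt ((h.coeff_natDegree i).trans_lt hj)
  · intro h
    constructor
    · rw [natDegree_le_iff_coeff_eq_zero]
      intro i hi
      ext j
      simpa using h i j (.inl hi)
    · rw [natDegree_le_iff_coeff_eq_zero]
      intro j hj
      ext i
      rw [coeff_swap]
      simpa using h i j (.inr hj)

theorem Bideg.add {k : ℕ} {F G : ℂ[X][X]} (hF : Bideg k F) (hG : Bideg k G) :
    Bideg k (F + G) := by
  rw [bideg_iff] at *
  intro i j h
  simp [hF i j h, hG i j h]

theorem Bideg.mono {k l : ℕ} {F : ℂ[X][X]} (hF : Bideg k F) (h : k ≤ l) : Bideg l F :=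
  ⟨hF.1.trans h, hF.2.trans h⟩

theorem Bideg.mul {k l : ℕ} {F G : ℂ[X][X]} (hF : Bideg k F) (hG : Bideg l G) :
    Bideg (k + l) (F * G) := by
  refine ⟨natDegree_mul_le.trans (add_le_add hF.1 hG.1), ?_⟩
  rw [map_mul]
  exact natDegree_mul_le.trans (add_le_add hF.2 hG.2)

theorem natDegree_swap_mul {F G : ℂ[X][X]} (hF : F ≠ 0) (hG : G ≠ 0) :
    (Bivariate.swap (F * G)).natDegree =
      (Bivariate.swap F).natDegree + (Bivariate.swap G).natDegree := by
  rw [map_mul, natDegree_mul] <;> simpa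

theorem Bideg.of_mul_left {k : ℕ} {F G : ℂ[X][X]} (h : Bideg k (F * G)) (hF : F ≠ 0)
    (hG : G ≠ 0) : Bideg k F := by
  have h1 := h.1
  have h2 := h.2
  rw [natDegree_mul hF hG] at h1
  rw [natDegree_swap_mul hF hG] at h2
  exact ⟨by omega, by omega⟩

theorem Bideg.of_dvd {k : ℕ} {F G : ℂ[X][X]} (h : Bideg k G) (hG : G ≠ 0) (hd : F ∣ G) :
    Bideg k F := by
  obtain ⟨H, rfl⟩ := hd
  exact h.of_mul_left (left_ne_zero_of_mul hG) (right_ne_zero_of_mul hG)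

theorem natDegree_resultant_le (f g : ℂ[X][X]) (m n k : ℕ)
    (hf : ∀ j, (f.coeff j).natDegree ≤ k) (hg : ∀ j, (g.coeff j).natDegree ≤ k) :
    (resultant f g m n).natDegree ≤ (m + n) * k := by
  rw [resultant, Matrix.det_apply]
  refine natDegree_sum_le_of_forall_le _ _ fun σ _ => ?_
  refine (natDegree_smul_le _ _).trans ?_
  refine (natDegree_prod_le _ _).trans ?_
  calc _ ≤ ∑ i : Fin (m + n), k := by
        refine Finset.sum_le_sum fun i _ => ?_
        rw [sylvester, Matrix.of_apply]
        induction i using Fin.addCases with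
        | left i => simp only [Fin.addCases_left]; split_ifs <;> simp [hg]
        | right i => simp only [Fin.addCases_right]; split_ifs <;> simp [hf]
    _ = _ := by simp

theorem resultant_ne_zero_of_fraction (K : Type*) [Field K] [Algebra ℂ[X] K]
    [IsFractionRing ℂ[X] K] {g F : ℂ[X][X]} (hg : Irreducible g)
    (h0 : g.natDegree ≠ 0) (hF : ¬g ∣ F) : resultant g F ≠ 0 := by
  let : NormalizedGCDMonoid ℂ[X] := Nonempty.some inferInstance
  have hp : g.IsPrimitive := hg.isPrimitive h0
  have hirr : Irreducible (g.map (algebraMap ℂ[X] K)) :=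
    (hp.irreducible_iff_irreducible_map_fraction_map (K := K)).1 hg
  have hnd : ¬g.map (algebraMap ℂ[X] K) ∣ F.map (algebraMap ℂ[X] K) := fun h =>
    hF ((hp.dvd_iff_fraction_map_dvd_fraction_map K).2 h)
  have hc := (hirr.coprime_iff_not_dvd).2 hnd
  have := resultant_ne_zero _ _ hc
  intro h
  apply this
  rw [natDegree_map_eq_of_injective (IsFractionRing.injective _ _),
    natDegree_map_eq_of_injective (IsFractionRing.injective _ _), resultant_map_map, h,
    map_zero]

theorem resultant_ne_zero_of_irreducible {g F : ℂ[X][X]} (hg : Irreducible g)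
    (h0 : g.natDegree ≠ 0) (hF : ¬g ∣ F) : resultant g F ≠ 0 :=
  resultant_ne_zero_of_fraction (FractionRing ℂ[X]) hg h0 hF

theorem exists_common_zeros {g F : ℂ[X][X]} (hg : Irreducible g) (hgd : Bideg 3 g)
    (hFd : Bideg 3 F) (hF : ¬g ∣ F) :
    ∃ Z : Finset ℂ, Z.card ≤ 18 ∧ ∀ z, ev z g = 0 → ev z F = 0 → z ∈ Z := by
  classical
  by_cases h0 : g.natDegree = 0
  · obtain ⟨a, rfl⟩ := natDegree_eq_zero.1 h0
    have ha : a ≠ 0 := by rintro rfl; simp at hg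
    refine ⟨a.roots.toFinset, ?_, fun z hz _ => ?_⟩
    · have := hgd.coeff_natDegree 0
      rw [coeff_C_zero] at this
      exact (Multiset.toFinset_card_le _).trans ((card_roots' _).trans (by omega))
    · simpa [ha, ev_apply, evalEval_C] using hz
  · have hR := resultant_ne_zero_of_irreducible hg h0 hF
    refine ⟨(resultant g F).roots.toFinset, ?_, fun z hz hz' => ?_⟩
    · refine (Multiset.toFinset_card_le _).trans ((card_roots' _).trans ?_)
      refine (natDegree_resultant_le g F _ _ 3 hgd.coeff_natDegree hFd.coeff_natDegree).trans ?_
      have := hgd.1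
      have := hFd.1
      omega
    · obtain ⟨p, q, -, -, h⟩ := exists_mul_add_mul_eq_C_resultant g F le_rfl le_rfl (.inl h0)
      have := congrArg (ev z) h
      rw [map_add, map_mul, map_mul, hz, hz', zero_mul, zero_mul, add_zero] at this
      simpa [hR, ev_apply, evalEval_C] using this.symm

theorem dvd_of_many_zeros {g F : ℂ[X][X]} (hg : Irreducible g) (hgd : Bideg 3 g)
    (hFd : Bideg 3 F) (S : Finset ℂ) (hS : 18 < S.card) (h : ∀ z ∈ S, ev z g = 0 ∧ ev z F = 0) :
    g ∣ F := by
  by_contra hF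
  obtain ⟨Z, hZ, hz⟩ := exists_common_zeros hg hgd hFd hF
  exact absurd (Finset.card_le_card fun z hzS => hz z (h z hzS).1 (h z hzS).2) (by omega)

/-- The polynomial whose values are conjugate to those of `F`. -/
def conjSwap : ℂ[X][X] →+* ℂ[X][X] :=
  (Bivariate.swap (R := ℂ) : ℂ[X][X] →+* ℂ[X][X]).comp
    (mapRingHom (mapRingHom (starRingEnd ℂ)))

theorem coeff_conjSwap (F : ℂ[X][X]) (i j : ℕ) :
    ((conjSwap F).coeff i).coeff j = conj ((F.coeff j).coeff i) := by
  simp [conjSwap, coeff_swap]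

theorem ev_conjSwap (z : ℂ) (F : ℂ[X][X]) : ev z (conjSwap F) = conj (ev z F) := by
  have : (ev z).comp conjSwap = (starRingEnd ℂ).comp (ev z) := by
    ext <;> simp [conjSwap, ev_apply, Bivariate.swap_C, Bivariate.swap_Y, evalEval_C]
  exact congrArg (fun f => f F) this

theorem conjSwap_conjSwap (F : ℂ[X][X]) : conjSwap (conjSwap F) = F := by
  ext i j
  simp [coeff_conjSwap]

theorem natDegree_conjSwap (F : ℂ[X][X]) : (conjSwap F).natDegree = (Bivariate.swap F).natDegree := by
  have : conjSwap F = (Bivariate.swap F).map (mapRingHom (starRingEnd ℂ)) := by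
    ext i j
    simp [coeff_conjSwap, coeff_swap]
  rw [this, natDegree_map_eq_of_injective (map_injective _ (starRingEnd ℂ).injective)]

theorem natDegree_swap_conjSwap (F : ℂ[X][X]) :
    (Bivariate.swap (conjSwap F)).natDegree = F.natDegree := by
  rw [← natDegree_conjSwap, conjSwap_conjSwap]

theorem Bideg.conjSwap {k : ℕ} {F : ℂ[X][X]} (h : Bideg k F) : Bideg k (conjSwap F) := by
  rw [bideg_iff] at *
  intro i j hij
  rw [coeff_conjSwap, h j i hij.symm, map_zero]

/-- The two partial degrees of an irreducible polynomial with many zeros `(z, conj z)` agree. -/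
theorem natDegree_eq_of_many_zeros {g : ℂ[X][X]} (hg : Irreducible g) (hgd : Bideg 3 g)
    (S : Finset ℂ) (hS : 18 < S.card) (h : ∀ z ∈ S, ev z g = 0) :
    (Bivariate.swap g).natDegree = g.natDegree := by
  have hd : g ∣ conjSwap g := dvd_of_many_zeros hg hgd hgd.conjSwap S hS fun z hz =>
    ⟨h z hz, by rw [ev_conjSwap, h z hz, map_zero]⟩
  have h0 : conjSwap g ≠ 0 := fun h => hg.ne_zero (by rw [← conjSwap_conjSwap g, h, map_zero])
  obtain ⟨f, hf⟩ := hd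
  have hf0 : f ≠ 0 := by rintro rfl; simp [h0] at hf
  have h1 := congrArg natDegree hf
  have h2 := congrArg (fun F => (Bivariate.swap F).natDegree) hf
  simp only [natDegree_swap_mul hg.ne_zero hf0, natDegree_mul hg.ne_zero hf0, natDegree_conjSwap,
    natDegree_swap_conjSwap] at h1 h2
  omega

/-- Translation of both variables. -/
def shiftXY (a b : ℂ) : ℂ[X][X] →+* ℂ[X][X] :=
  (taylorAlgHom (C b) : ℂ[X][X] →+* ℂ[X][X]).comp
    (mapRingHom (taylorAlgHom a : ℂ[X] →+* ℂ[X]))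

@[simp] theorem shiftXY_CC (a b c : ℂ) : shiftXY a b (C (C c)) = C (C c) := by simp [shiftXY]
@[simp] theorem shiftXY_CX (a b : ℂ) : shiftXY a b (C X) = C X + C (C a) := by simp [shiftXY]
@[simp] theorem shiftXY_X (a b : ℂ) : shiftXY a b X = X + C (C b) := by simp [shiftXY]

theorem natDegree_shiftXY_le (a b : ℂ) (F : ℂ[X][X]) : (shiftXY a b F).natDegree ≤ F.natDegree := by
  simp only [shiftXY, RingHom.comp_apply, coe_mapRingHom]
  exact (natDegree_taylor _ _).le.trans natDegree_map_le

theorem swap_shiftXY (a b : ℂ) (F : ℂ[X][X]) :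
    Bivariate.swap (shiftXY a b F) = shiftXY b a (Bivariate.swap F) := by
  have : (Bivariate.swap (R := ℂ) : ℂ[X][X] →+* ℂ[X][X]).comp (shiftXY a b) =
      (shiftXY b a).comp (Bivariate.swap (R := ℂ) : ℂ[X][X] →+* ℂ[X][X]) := by
    ext1
    · ext1
      · ext1 r
        simp [Bivariate.swap_C]
      · simp [Bivariate.swap_C]
    · simp [Bivariate.swap_C, Bivariate.swap_Y]
  exact congrArg (fun f => f F) this

theorem Bideg.shiftXY {k : ℕ} {F : ℂ[X][X]} (h : Bideg k F) (a b : ℂ) : Bideg k (shiftXY a b F) :=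
  ⟨(natDegree_shiftXY_le a b F).trans h.1,
    by rw [swap_shiftXY]; exact (natDegree_shiftXY_le b a _).trans h.2⟩

theorem shiftXY_shiftXY_neg (a b : ℂ) (F : ℂ[X][X]) : shiftXY (-a) (-b) (shiftXY a b F) = F := by
  have : (shiftXY (-a) (-b)).comp (shiftXY a b) = RingHom.id _ := by
    ext1
    · ext1
      · ext1 r
        simp
      · simp
    · simp
  exact congrArg (fun f => f F) this

theorem shiftXY_injective (a b : ℂ) : Function.Injective (shiftXY a b) :=
  Function.LeftInverse.injective (shiftXY_shiftXY_neg a b)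

theorem ev_shiftXY (x z : ℂ) (F : ℂ[X][X]) : ev (z - x) (shiftXY x (conj x) F) = ev z F := by
  have : (ev (z - x)).comp (shiftXY x (conj x)) = ev z := by
    ext1
    · ext1
      · ext1 r
        simp
      · simp
    · simp
  exact congrArg (fun f => f F) this

/-- Taylor coefficients at `(x, conj x)`. -/
def tc (x : ℂ) (F : ℂ[X][X]) (i j : ℕ) : ℂ := ((shiftXY x (conj x) F).coeff j).coeff i

theorem tc_zero_zero (x : ℂ) (F : ℂ[X][X]) : tc x F 0 0 = ev x F := by
  rw [← ev_shiftXY x x F, sub_self, ev_apply, evalEval, map_zero, map_zero, ← coeff_zero_eq_eval_zero,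
    ← coeff_zero_eq_eval_zero, tc]

theorem shiftXY_derivative (a b : ℂ) (F : ℂ[X][X]) :
    shiftXY a b (derivative F) = derivative (shiftXY a b F) := by
  simp [shiftXY, taylorAlgHom_apply, taylor_apply, derivative_comp, derivative_map]

theorem tc_zero_one (x : ℂ) (F : ℂ[X][X]) : tc x F 0 1 = ev x (derivative F) := by
  rw [← tc_zero_zero, tc, tc, shiftXY_derivative, coeff_derivative]
  simp

theorem ev_eq_sum {k : ℕ} {F : ℂ[X][X]} (h : Bideg k F) (z : ℂ) :
    ev z F = ∑ j ∈ Finset.range (k + 1), ∑ i ∈ Finset.range (k + 1),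
      (F.coeff j).coeff i * z ^ i * conj z ^ j := by
  rw [ev_apply, evalEval, eval_eq_sum_range' (Nat.lt_succ_of_le h.1), eval_finsetSum]
  refine Finset.sum_congr rfl fun j _ => ?_
  rw [eval_mul, eval_pow, eval_C, eval_eq_sum_range' (Nat.lt_succ_of_le (h.coeff_natDegree j)),
    Finset.sum_mul]

theorem ev_eq_tc {k : ℕ} {F : ℂ[X][X]} (h : Bideg k F) (x z : ℂ) :
    ev z F = ∑ j ∈ Finset.range (k + 1), ∑ i ∈ Finset.range (k + 1),
      tc x F i j * (z - x) ^ i * conj (z - x) ^ j := by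
  rw [← ev_shiftXY x, ev_eq_sum (h.shiftXY x (conj x))]
  rfl

theorem eq_zero_of_tc {k : ℕ} {F : ℂ[X][X]} (h : Bideg k F) (x : ℂ)
    (h0 : ∀ i ≤ k, ∀ j ≤ k, tc x F i j = 0) : F = 0 := by
  apply shiftXY_injective x (conj x)
  rw [map_zero]
  ext j i
  rw [coeff_zero, coeff_zero]
  by_cases hij : k < j ∨ k < i
  · exact bideg_iff.1 (h.shiftXY x (conj x)) j i hij
  · push Not at hij
    exact h0 i hij.2 j hij.1

/-- The pullback of a cubic along `z ↦ u / (z - x)`, with denominators cleared. -/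
def pull (x u : ℂ) (k : Cub) : ℂ[X][X] :=
  ∑ ij, C (C (k ij * (u ^ ij.1.1.val * conj u ^ ij.1.2.val)) * (X - C x) ^ (3 - ij.1.1.val)) *
    (X - C (C (conj x))) ^ (3 - ij.1.2.val)

theorem shiftXY_pull (x u : ℂ) (k : Cub) :
    shiftXY x (conj x) (pull x u k) =
    ∑ ij, C (C (k ij * (u ^ ij.1.1.val * conj u ^ ij.1.2.val)) * X ^ (3 - ij.1.1.val)) *
      X ^ (3 - ij.1.2.val) := by
  rw [pull, map_sum]
  refine Finset.sum_congr rfl fun ij _ => ?_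
  simp only [map_mul, map_pow, map_sub, shiftXY_CC, shiftXY_CX, shiftXY_X,
    add_sub_cancel_right]

theorem tc_pull (x u : ℂ) (k : Cub) (i j : ℕ) :
    tc x (pull x u k) i j = ∑ ij : CubIdx, if j = 3 - ij.1.2.val ∧ i = 3 - ij.1.1.val then
      k ij * (u ^ ij.1.1.val * conj u ^ ij.1.2.val) else 0 := by
  rw [tc, shiftXY_pull, finsetSum_coeff, finsetSum_coeff]
  refine Finset.sum_congr rfl fun ij _ => ?_
  rw [coeff_C_mul_X_pow]
  split_ifs with h1 h2 h2
  · rw [coeff_C_mul_X_pow, if_pos h2.2]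
  · rw [coeff_C_mul_X_pow, if_neg fun h => h2 ⟨h1, h⟩]
  · exact absurd h2.1 h1
  · rw [coeff_zero]

theorem tc_pull_low (x u : ℂ) (k : Cub) {i j : ℕ} (h : i + j < 3) :
    tc x (pull x u k) i j = 0 := by
  rw [tc_pull]
  refine Finset.sum_eq_zero fun ij _ => if_neg ?_
  have := ij.2
  omega

theorem pull_ne_zero (x : ℂ) {u : ℂ} (hu : u ≠ 0) {k : Cub} (hk : k ≠ 0) :
    pull x u k ≠ 0 := by
  obtain ⟨ij, hij⟩ := Function.ne_iff.1 hk
  intro h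
  have := tc_pull x u k (3 - ij.1.1.val) (3 - ij.1.2.val)
  rw [Finset.sum_eq_single ij, if_pos ⟨rfl, rfl⟩, h] at this
  · have hu' : conj u ≠ 0 := by simpa
    have h0 : tc x 0 (3 - ij.1.1.val) (3 - ij.1.2.val) = 0 := by simp [tc]
    rw [h0] at this
    exact mul_ne_zero hij (mul_ne_zero (pow_ne_zero _ hu) (pow_ne_zero _ hu')) this.symm
  · intro kl _ hkl
    refine if_neg ?_
    rintro ⟨h1, h2⟩
    apply hkl
    have a1 := ij.1.1.2
    have a2 := ij.1.2.2
    have b1 := kl.1.1.2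
    have b2 := kl.1.2.2
    ext
    · show kl.1.1.val = ij.1.1.val
      omega
    · show kl.1.2.val = ij.1.2.val
      omega
  · simp

theorem bideg_pull (x u : ℂ) (k : Cub) : Bideg 3 (pull x u k) := by
  have : pull x u k = shiftXY (-x) (-conj x) (shiftXY x (conj x) (pull x u k)) := (shiftXY_shiftXY_neg _ _ _).symm
  rw [this]
  refine Bideg.shiftXY ?_ _ _
  rw [bideg_iff]
  intro j i h
  change tc x (pull x u k) i j = 0
  rw [tc_pull]
  exact Finset.sum_eq_zero fun ij _ => if_neg (by omega)

theorem ev_pull (x : ℂ) {u z : ℂ} (hz : z ≠ x) (k : Cub) :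
    ev z (pull x u k) = (z - x) ^ 3 * conj (z - x) ^ 3 * cev k (u / (z - x)) := by
  have hz0 : z - x ≠ 0 := sub_ne_zero.2 hz
  have hz1 : conj (z - x) ≠ 0 := (_root_.map_ne_zero _).2 hz0
  rw [pull, map_sum, cev, Finset.mul_sum]
  refine Finset.sum_congr rfl fun ij _ => ?_
  have h1 : (z - x) ^ 3 = (z - x) ^ (3 - ij.1.1.val) * (z - x) ^ ij.1.1.val := by
    rw [← pow_add]; congr 1; have := ij.1.1.2; omega
  have h2 : conj (z - x) ^ 3 = conj (z - x) ^ (3 - ij.1.2.val) * conj (z - x) ^ ij.1.2.val := by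
    rw [← pow_add]; congr 1; have := ij.1.2.2; omega
  rw [h1, h2]
  simp only [map_mul, map_pow, map_sub, ev_CC, ev_CX, ev_X, map_div₀,
    div_pow] at *
  field_simp

theorem ev_pull_eq_zero (x : ℂ) {u z : ℂ} (hz : z ≠ x) (k : Cub) :
    ev z (pull x u k) = 0 ↔ cev k (u / (z - x)) = 0 := by
  have hz0 : z - x ≠ 0 := sub_ne_zero.2 hz
  have hz1 : conj (z - x) ≠ 0 := (_root_.map_ne_zero _).2 hz0
  rw [ev_pull x hz]
  rw [mul_eq_zero, or_iff_right (mul_ne_zero (pow_ne_zero _ hz0) (pow_ne_zero _ hz1))]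

/-- The Taylor expansion at `(x, conj x)` has no terms of total degree below `m`. -/
def OrdGE (m : ℕ) (x : ℂ) (F : ℂ[X][X]) : Prop := ∀ i j, i + j < m → tc x F i j = 0

theorem tc_mul (x : ℂ) (F G : ℂ[X][X]) (i j : ℕ) :
    tc x (F * G) i j = ∑ p ∈ Finset.range (j + 1), ∑ q ∈ Finset.range (i + 1),
      tc x F q p * tc x G (i - q) (j - p) := by
  simp only [tc, map_mul, coeff_mul, finsetSum_coeff,
    Finset.Nat.sum_antidiagonal_eq_sum_range_succ_mk]

theorem OrdGE.of_mul {x : ℂ} {g h : ℂ[X][X]} (hg : ev x g ≠ 0) (ho : OrdGE 3 x (g * h)) :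
    OrdGE 3 x h := by
  rw [← tc_zero_zero] at hg
  have e00 := ho 0 0 (by norm_num)
  have e01 := ho 0 1 (by norm_num)
  have e10 := ho 1 0 (by norm_num)
  have e11 := ho 1 1 (by norm_num)
  have e02 := ho 0 2 (by norm_num)
  have e20 := ho 2 0 (by norm_num)
  simp only [tc_mul, Finset.sum_range_succ, Finset.sum_range_zero, Nat.reduceAdd, Nat.reduceSub,
    zero_add] at e00 e01 e10 e11 e02 e20
  have f00 : tc x h 0 0 = 0 := by simpa [hg] using e00
  rw [f00] at e01 e10 e11 e02 e20
  have f01 : tc x h 0 1 = 0 := by simpa [hg] using e01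
  have f10 : tc x h 1 0 = 0 := by simpa [hg] using e10
  rw [f01] at e11 e02
  rw [f10] at e11 e20
  have f11 : tc x h 1 1 = 0 := by simpa [hg] using e11
  have f02 : tc x h 0 2 = 0 := by simpa [hg] using e02
  have f20 : tc x h 2 0 = 0 := by simpa [hg] using e20
  intro i j hij
  have hi : i < 3 := by omega
  have hj : j < 3 := by omega
  interval_cases i <;> interval_cases j <;> first | assumption | omega

theorem OrdGE.of_mul' {x : ℂ} {g h : ℂ[X][X]} (hg : ev x g = 0) (hg' : ev x (derivative g) ≠ 0)
    (ho : OrdGE 3 x (g * h)) : OrdGE 2 x h := by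
  rw [← tc_zero_zero] at hg
  rw [← tc_zero_one] at hg'
  have e01 := ho 0 1 (by norm_num)
  have e11 := ho 1 1 (by norm_num)
  have e02 := ho 0 2 (by norm_num)
  simp only [tc_mul, Finset.sum_range_succ, Finset.sum_range_zero, Nat.reduceAdd, Nat.reduceSub,
    zero_add, hg] at e01 e11 e02
  have f00 : tc x h 0 0 = 0 := by simpa [hg'] using e01
  rw [f00] at e11 e02
  have f01 : tc x h 0 1 = 0 := by simpa [hg'] using e02
  rw [f01] at e11
  have f10 : tc x h 1 0 = 0 := by simpa [hg'] using e11
  intro i j hij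
  have hi : i < 2 := by omega
  have hj : j < 2 := by omega
  interval_cases i <;> interval_cases j <;> first | assumption | omega

theorem lin_collinear {α β γ : ℂ} {v : ℝ × ℝ} {w₀ w₁ w₂ : ℂ} (h₀ : On v w₀) (h₁ : On v w₁)
    (h₂ : On v w₂) (h : w₀ ≠ w₁) (e₀ : α * w₀ + β * conj w₀ + γ = 0)
    (e₁ : α * w₁ + β * conj w₁ + γ = 0) : α * w₂ + β * conj w₂ + γ = 0 := by
  have hre : w₀.re ≠ w₁.re := fun e => h (eq_of_re_eq e h₀ h₁)
  have hre' : w₁.re - w₀.re ≠ 0 := sub_ne_zero.2 hre.symm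
  have e : w₂ = w₀ + (((w₂.re - w₀.re) / (w₁.re - w₀.re) : ℝ) : ℂ) * (w₁ - w₀) := by
    unfold On at h₀ h₁ h₂
    apply Complex.ext
    · rw [Complex.add_re, Complex.re_ofReal_mul, Complex.sub_re]
      field_simp
      ring
    · rw [Complex.add_im, Complex.im_ofReal_mul, Complex.sub_im]
      field_simp
      linear_combination (w₁.re - w₂.re) * h₀ - (w₁.re - w₀.re) * h₂ + (w₂.re - w₀.re) * h₁
  rw [e, map_add, map_mul, Complex.conj_ofReal, map_sub]
  linear_combination (1 - (((w₂.re - w₀.re) / (w₁.re - w₀.re) : ℝ) : ℂ)) * e₀ +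
    (((w₂.re - w₀.re) / (w₁.re - w₀.re) : ℝ) : ℂ) * e₁

theorem lin_on {α β γ : ℂ} (hne : ¬(α = 0 ∧ β = 0 ∧ γ = 0)) {w₀ w₁ w₂ : ℂ}
    (hre : w₀.re ≠ w₁.re) (e₀ : α * w₀ + β * conj w₀ + γ = 0)
    (e₁ : α * w₁ + β * conj w₁ + γ = 0) (e₂ : α * w₂ + β * conj w₂ + γ = 0) :
    On (meet w₀ w₁) w₂ := by
  have hD : (w₁ - w₀) * conj (w₂ - w₀) - conj (w₁ - w₀) * (w₂ - w₀) = 0 := by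
    by_contra hD
    have f₁ : α * (w₁ - w₀) + β * conj (w₁ - w₀) = 0 := by
      rw [map_sub]; linear_combination e₁ - e₀
    have f₂ : α * (w₂ - w₀) + β * conj (w₂ - w₀) = 0 := by
      rw [map_sub]; linear_combination e₂ - e₀
    have hα : α = 0 := by
      refine (mul_eq_zero.1 (?_ : α * _ = 0)).resolve_right hD
      linear_combination conj (w₂ - w₀) * f₁ - conj (w₁ - w₀) * f₂
    have hβ : β = 0 := by
      refine (mul_eq_zero.1 (?_ : β * _ = 0)).resolve_right hD
      linear_combination (w₁ - w₀) * f₂ - (w₂ - w₀) * f₁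
    exact hne ⟨hα, hβ, by simpa [hα, hβ] using e₀⟩
  have him := congrArg Complex.im hD
  simp only [Complex.sub_im, Complex.mul_im, Complex.conj_re, Complex.conj_im, Complex.sub_re,
    Complex.zero_im] at him
  have h1 := on_meet_left w₀ w₁
  have h2 := on_meet_right hre
  generalize meet w₀ w₁ = v at *
  unfold On at *
  have hre' : w₁.re - w₀.re ≠ 0 := sub_ne_zero.2 hre.symm
  apply mul_left_cancel₀ hre'
  linear_combination (w₁.re - w₂.re) * h1 + (w₂.re - w₀.re) * h2 + him / 2

/-- In the coordinate `u / (z - x)`, the zeros of `F` are those of a nonzero affine form. -/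
def LinAt (x u : ℂ) (F : ℂ[X][X]) : Prop :=
  ∃ α β γ : ℂ, ¬(α = 0 ∧ β = 0 ∧ γ = 0) ∧
    ∀ z, z ≠ x → (ev z F = 0 ↔ α * (u / (z - x)) + β * conj (u / (z - x)) + γ = 0)

theorem linAt_of_bideg_one {x u : ℂ} (hu : u ≠ 0) {g : ℂ[X][X]} (hg : Bideg 1 g) (h0 : g ≠ 0)
    (hx : ev x g = 0) : LinAt x u g := by
  rw [← tc_zero_zero] at hx
  have hu' : conj u ≠ 0 := (_root_.map_ne_zero _).2 hu
  refine ⟨tc x g 0 1 / u, tc x g 1 0 / conj u, tc x g 1 1, ?_, fun z hz => ?_⟩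
  · rintro ⟨h1, h2, h3⟩
    apply h0
    refine eq_zero_of_tc hg x fun i hi j hj => ?_
    have h1 : tc x g 0 1 = 0 := by simpa [hu] using h1
    have h2 : tc x g 1 0 = 0 := by simpa [hu'] using h2
    interval_cases i <;> interval_cases j <;> assumption
  · have hz0 : z - x ≠ 0 := sub_ne_zero.2 hz
    have hz1 : conj (z - x) ≠ 0 := (_root_.map_ne_zero _).2 hz0
    have : ev z g = (z - x) * conj (z - x) * (tc x g 0 1 / u * (u / (z - x)) +
        tc x g 1 0 / conj u * conj (u / (z - x)) + tc x g 1 1) := by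
      rw [ev_eq_tc hg x z, map_div₀]
      simp only [Finset.sum_range_succ, Finset.sum_range_zero, hx]
      field_simp
      ring
    rw [this, mul_eq_zero, or_iff_right (mul_ne_zero hz0 hz1)]

theorem linAt_of_ordGE {x u : ℂ} (hu : u ≠ 0) {g : ℂ[X][X]} (hg : Bideg 2 g) (h0 : g ≠ 0)
    (hx : OrdGE 3 x g) : LinAt x u g := by
  have hu' : conj u ≠ 0 := (_root_.map_ne_zero _).2 hu
  refine ⟨tc x g 1 2 / u, tc x g 2 1 / conj u, tc x g 2 2, ?_, fun z hz => ?_⟩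
  · rintro ⟨h1, h2, h3⟩
    apply h0
    refine eq_zero_of_tc hg x fun i hi j hj => ?_
    have h1 : tc x g 1 2 = 0 := by simpa [hu] using h1
    have h2 : tc x g 2 1 = 0 := by simpa [hu'] using h2
    by_cases h : i + j < 3
    · exact hx i j h
    interval_cases i <;> interval_cases j <;> first | assumption | omega
  · have hz0 : z - x ≠ 0 := sub_ne_zero.2 hz
    have hz1 : conj (z - x) ≠ 0 := (_root_.map_ne_zero _).2 hz0
    have : ev z g = (z - x) ^ 2 * conj (z - x) ^ 2 * (tc x g 1 2 / u * (u / (z - x)) +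
        tc x g 2 1 / conj u * conj (u / (z - x)) + tc x g 2 2) := by
      rw [ev_eq_tc hg x z, map_div₀]
      simp only [Finset.sum_range_succ, Finset.sum_range_zero, hx 0 0 (by norm_num),
        hx 0 1 (by norm_num), hx 0 2 (by norm_num), hx 1 0 (by norm_num), hx 1 1 (by norm_num),
        hx 2 0 (by norm_num)]
      field_simp
      ring
    rw [this, mul_eq_zero, or_iff_right (mul_ne_zero (pow_ne_zero _ hz0) (pow_ne_zero _ hz1))]

theorem not_three_on {x u : ℂ} (hu : u ≠ 0) {g : ℂ[X][X]} (hg : Bideg 1 g)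
    (hx : ev x g ≠ 0) {v : ℝ × ℝ} {z : Fin 3 → ℂ} (hz : Function.Injective z)
    (hzx : ∀ i, z i ≠ x) (hv : ∀ i, On v (u / (z i - x))) (h0 : ∀ i, ev (z i) g = 0) : False := by
  rw [← tc_zero_zero] at hx
  have hu' : conj u ≠ 0 := (_root_.map_ne_zero _).2 hu
  have key : ∀ i, tc x g 0 0 / (u * conj u) * (u / (z i - x)) * conj (u / (z i - x)) +
      tc x g 0 1 / u * (u / (z i - x)) + tc x g 1 0 / conj u * conj (u / (z i - x)) +
      tc x g 1 1 = 0 := by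
    intro i
    have hz0 : z i - x ≠ 0 := sub_ne_zero.2 (hzx i)
    have hz1 : conj (z i - x) ≠ 0 := (_root_.map_ne_zero _).2 hz0
    have h := h0 i
    rw [ev_eq_tc hg x (z i)] at h
    simp only [Finset.sum_range_succ, Finset.sum_range_zero] at h
    rw [map_div₀]
    apply mul_left_cancel₀ (mul_ne_zero hz0 hz1)
    rw [mul_zero, ← h]
    field_simp
    ring
  have hw : ∀ i, u / (z i - x) = (((u / (z i - x)).re : ℝ) : ℂ) * (1 - v.1 * Complex.I) +
      v.2 * Complex.I := by
    intro i
    have := hv i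
    unfold On at this
    apply Complex.ext <;> simp
    rw [this]; ring
  have hinj : Function.Injective fun i => (u / (z i - x)).re := by
    intro i j hij
    have := eq_of_re_eq hij (hv i) (hv j)
    apply hz
    have hi : z i - x ≠ 0 := sub_ne_zero.2 (hzx i)
    have hj : z j - x ≠ 0 := sub_ne_zero.2 (hzx j)
    rw [div_eq_div_iff hi hj] at this
    have := mul_left_cancel₀ hu this
    linear_combination -this
  set s : Fin 3 → ℝ := fun i => (u / (z i - x)).re with hs
  have hB : (1 - v.1 * Complex.I : ℂ) ≠ 0 := by
    intro h; simpa using congrArg Complex.re h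
  have hB' : (1 + v.1 * Complex.I : ℂ) ≠ 0 := by
    intro h; simpa using congrArg Complex.re h
  obtain ⟨a, b, c, ha, habc⟩ : ∃ a b c : ℂ, a ≠ 0 ∧ ∀ i, a * (s i) ^ 2 + b * s i + c = 0 := by
    refine ⟨tc x g 0 0 / (u * conj u) * ((1 - v.1 * Complex.I) * (1 + v.1 * Complex.I)),
      tc x g 0 0 / (u * conj u) * ((1 - v.1 * Complex.I) * (-v.2 * Complex.I) +
        (1 + v.1 * Complex.I) * (v.2 * Complex.I)) + tc x g 0 1 / u * (1 - v.1 * Complex.I) +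
        tc x g 1 0 / conj u * (1 + v.1 * Complex.I),
      tc x g 0 0 / (u * conj u) * ((v.2 * Complex.I) * (-v.2 * Complex.I)) +
        tc x g 0 1 / u * (v.2 * Complex.I) + tc x g 1 0 / conj u * (-v.2 * Complex.I) +
        tc x g 1 1, ?_, fun i => ?_⟩
    · exact mul_ne_zero (div_ne_zero hx (mul_ne_zero hu hu')) (mul_ne_zero hB hB')
    · have h := key i
      have hc : conj (u / (z i - x)) = (s i : ℂ) * (1 + v.1 * Complex.I) - v.2 * Complex.I := by
        rw [hw i]; simp [s]; ring
      rw [hc, hw i] at h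
      linear_combination h
  have d : ∀ i j, i ≠ j → (s i : ℂ) - s j ≠ 0 := fun i j hij h =>
    hij (hinj (by exact_mod_cast sub_eq_zero.1 h))
  have k1 : a * (s 0 + s 1) + b = 0 := by
    apply mul_left_cancel₀ (d 0 1 (by decide))
    linear_combination habc 0 - habc 1
  have k2 : a * (s 0 + s 2) + b = 0 := by
    apply mul_left_cancel₀ (d 0 2 (by decide))
    linear_combination habc 0 - habc 2
  apply mul_ne_zero ha (d 1 2 (by decide))
  linear_combination k1 - k2

/-- The generalised circle through `x` dual to `v`. -/
def circ (x u : ℂ) (v : ℝ × ℝ) : Set ℂ := {z | z = x ∨ On v (u / (z - x))}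

theorem mem_circ {x u z : ℂ} {v : ℝ × ℝ} (hz : z ≠ x) : z ∈ circ x u v ↔ On v (u / (z - x)) := by
  simp [circ, hz]

theorem self_mem_circ (x u : ℂ) (v : ℝ × ℝ) : x ∈ circ x u v := .inl rfl

theorem mem_circ_iff (x u z : ℂ) (v : ℝ × ℝ) : z ∈ circ x u v ↔
    v.2 * Complex.normSq (z - x) = ((v.1 - Complex.I) * u * conj (z - x)).re := by
  by_cases hz : z = x
  · simp [hz, circ]
  have h0 : Complex.normSq (z - x) ≠ 0 := by simpa [sub_eq_zero] using hz
  rw [mem_circ hz, On]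
  have : u / (z - x) = u * conj (z - x) * ((Complex.normSq (z - x))⁻¹ : ℝ) := by
    rw [div_eq_mul_inv, Complex.inv_def, mul_assoc]
  rw [this, Complex.re_mul_ofReal, Complex.im_mul_ofReal]
  rw [← mul_left_inj' h0]
  have e : ((v.1 - Complex.I) * u * conj (z - x)).re =
      (u * conj (z - x)).re * v.1 + (u * conj (z - x)).im := by
    rw [mul_assoc, Complex.mul_re]
    simp; ring
  rw [e]
  field_simp

theorem isGenCircle_circ (x : ℂ) {u : ℂ} (hu : u ≠ 0) (v : ℝ × ℝ) : IsGenCircle (circ x u v) := by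
  set β : ℂ := (v.1 - Complex.I) * u with hβ
  have hβ0 : β ≠ 0 := by
    refine mul_ne_zero (fun h => ?_) hu
    simpa using congrArg Complex.im h
  by_cases hv : v.2 = 0
  · refine .inr ⟨x, Complex.I * β, by simpa using hβ0, ?_⟩
    ext z
    rw [mem_circ_iff, hv, zero_mul, ← hβ]
    constructor
    · intro h
      have hn : Complex.normSq β ≠ 0 := by simpa using hβ0
      refine ⟨-(β * conj (z - x)).im / Complex.normSq β, ?_⟩
      have h2 : β * conj (z - x) = ((β * conj (z - x)).im : ℝ) * Complex.I := by
        generalize β * conj (z - x) = y at *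
        apply Complex.ext <;> simp [← h]
      set r := (β * conj (z - x)).im
      have h3 : conj β * (z - x) = -r * Complex.I := by
        have := congrArg conj h2
        simpa using this
      have h4 : (Complex.normSq β : ℂ) ≠ 0 := by exact_mod_cast hn
      have h5 : (z - x) * Complex.normSq β = -r * Complex.I * β := by
        rw [← h3, ← Complex.mul_conj]; ring
      have h6 : z - x = (-r / Complex.normSq β : ℝ) • (Complex.I * β) := by
        rw [Complex.real_smul]
        push_cast
        field_simp
        linear_combination h5
      rw [← h6]; ring
    · rintro ⟨t, rfl⟩
      rw [add_sub_cancel_left, Complex.real_smul]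
      simp
      ring
  · refine .inl ⟨x + β / (2 * v.2 : ℝ), ‖β / (2 * v.2 : ℝ)‖, ?_, ?_⟩
    · rw [norm_pos_iff]
      exact div_ne_zero hβ0 (by exact_mod_cast mul_ne_zero two_ne_zero hv)
    · ext z
      rw [mem_circ_iff, ← hβ, mem_sphere_iff_norm, ← sub_sub, ← sq_eq_sq₀ (norm_nonneg _)
        (norm_nonneg _), ← Complex.normSq_eq_norm_sq, ← Complex.normSq_eq_norm_sq,
        Complex.normSq_sub (z - x) (β / (2 * v.2 : ℝ)), mul_comm β]
      have : ((z - x) * conj (β / (2 * v.2 : ℝ))).re = (conj (z - x) * β).re / (2 * v.2) := by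
        rw [← Complex.conj_re, map_mul, Complex.conj_conj, mul_div_assoc', Complex.div_ofReal_re]
      rw [this]
      constructor
      · intro h
        rw [← h]; field_simp; ring
      · intro h
        have h : Complex.normSq (z - x) = 2 * ((conj (z - x) * β).re / (2 * v.2)) := by
          linarith
        rw [h]; field_simp

/-- The polynomial `a z conj z + b conj z + c z + e`. -/
def bil (a b c e : ℂ) : ℂ[X][X] := C (C a * X + C b) * X + C (C c * X + C e)

theorem ev_bil (a b c e z : ℂ) :
    ev z (bil a b c e) = a * z * conj z + b * conj z + c * z + e := by
  simp [bil, ev_apply, evalEval_C]; ring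

theorem bideg_bil (a b c e : ℂ) : Bideg 1 (bil a b c e) := by
  rw [bideg_iff]
  intro i j h
  rw [bil, coeff_add, coeff_C_mul, coeff_X, coeff_C]
  rcases h with h | h
  · rw [if_neg (by omega), if_neg (by omega)]; simp
  · split_ifs <;> simp [coeff_X, coeff_C, show j ≠ 0 by omega, show 1 ≠ j by omega]

theorem bil_ne_zero {a b c e : ℂ} (h : a ≠ 0 ∨ c ≠ 0) : bil a b c e ≠ 0 := by
  intro h0
  have h1 := congrArg (fun F => (F.coeff 1).coeff 1) h0
  have h2 := congrArg (fun F => (F.coeff 0).coeff 1) h0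
  simp [bil, coeff_X, coeff_C] at h1 h2
  tauto

theorem IsGenCircle.exists_poly {S : Set ℂ} (hS : IsGenCircle S) :
    ∃ F : ℂ[X][X], Bideg 1 F ∧ F ≠ 0 ∧ ∀ z, z ∈ S ↔ ev z F = 0 := by
  rcases hS with ⟨c, ρ, hρ, rfl⟩ | ⟨a, d, hd, rfl⟩
  · refine ⟨bil 1 (-c) (-conj c) (c * conj c - (ρ : ℂ) ^ 2), bideg_bil _ _ _ _,
      bil_ne_zero (by simp), fun z => ?_⟩
    rw [mem_sphere_iff_norm, ev_bil, ← sq_eq_sq₀ (norm_nonneg _) hρ.le,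
      ← Complex.ofReal_inj, Complex.ofReal_pow, ← Complex.mul_conj', map_sub, Complex.ofReal_pow]
    constructor <;> intro h <;> linear_combination h
  · refine ⟨bil 0 (-d) (conj d) (d * conj a - conj d * a), bideg_bil _ _ _ _,
      bil_ne_zero (by simpa using hd), fun z => ?_⟩
    rw [ev_bil]
    constructor
    · rintro ⟨t, rfl⟩
      simp only [Complex.real_smul, map_add, map_mul, Complex.conj_ofReal]
      ring
    · intro h
      have hd' : (Complex.normSq d : ℂ) ≠ 0 := by simpa using hd
      refine ⟨(conj d * (z - a)).re / Complex.normSq d, ?_⟩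
      have h1 : conj (conj d * (z - a)) = conj d * (z - a) := by
        simp only [map_mul, map_sub, Complex.conj_conj]
        linear_combination -h
      have h2 := Complex.conj_eq_iff_re.1 h1
      rw [Complex.real_smul, Complex.ofReal_div, h2, div_mul_eq_mul_div, ← Complex.mul_conj]
      rw [← Complex.mul_conj] at hd'
      rw [← sub_eq_iff_eq_add', eq_div_iff hd']
      ring

theorem IsGenCircle.eq_circ {S : Set ℂ} (hS : IsGenCircle S) {x u p q : ℂ} (hu : u ≠ 0)
    (hx : x ∈ S) (hp : p ∈ S) (hq : q ∈ S) (hpx : p ≠ x) (hqx : q ≠ x)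
    (hre : (u / (p - x)).re ≠ (u / (q - x)).re) :
    S = circ x u (meet (u / (p - x)) (u / (q - x))) := by
  obtain ⟨F, hF, hF0, hz⟩ := hS.exists_poly
  obtain ⟨α, β, γ, hne, h⟩ := linAt_of_bideg_one hu hF hF0 ((hz x).1 hx)
  have hp' := (h p hpx).1 ((hz p).1 hp)
  have hq' := (h q hqx).1 ((hz q).1 hq)
  ext z
  by_cases hzx : z = x
  · simp [hzx, hx, self_mem_circ]
  rw [mem_circ hzx, hz, h z hzx]
  exact ⟨fun hz' => lin_on hne hre hp' hq' hz', fun hz' =>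
    lin_collinear (on_meet_left _ _) (on_meet_right hre) hz' (fun e => hre (by rw [e])) hp' hq'⟩

theorem IsGenCircle.eq_of_three {S T : Set ℂ} (hS : IsGenCircle S) (hT : IsGenCircle T)
    {x p q : ℂ} (hpx : p ≠ x) (hqx : q ≠ x) (hpq : p ≠ q) (hxS : x ∈ S) (hpS : p ∈ S)
    (hqS : q ∈ S) (hxT : x ∈ T) (hpT : p ∈ T) (hqT : q ∈ T) : S = T := by
  obtain ⟨u, hu, hre⟩ : ∃ u : ℂ, u ≠ 0 ∧ (u / (p - x)).re ≠ (u / (q - x)).re := by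
    by_contra! h
    have h1 := h 1 one_ne_zero
    have h2 := h Complex.I Complex.I_ne_zero
    have : (1 : ℂ) / (p - x) = 1 / (q - x) := by
      apply Complex.ext h1
      rw [div_eq_mul_one_div, div_eq_mul_one_div Complex.I (q - x)] at h2
      simpa using h2
    apply hpq
    rw [div_eq_div_iff (sub_ne_zero.2 hpx) (sub_ne_zero.2 hqx)] at this
    linear_combination -this
  rw [hS.eq_circ hu hxS hpS hqS hpx hqx hre, hT.eq_circ hu hxT hpT hqT hpx hqx hre]

/-- The inversion of `P` in one of its points, in general position. -/
structure View (P : Finset ℂ) where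
  /-- the centre -/
  x : ℂ
  /-- the factor -/
  u : ℂ
  hx : x ∈ P
  hu : u ≠ 0
  /-- the image -/
  A : Arrangement
  hA : ∀ w, w ∈ A.pts ↔ ∃ z ∈ P, z ≠ x ∧ u / (z - x) = w

namespace View

variable {P : Finset ℂ} (V : View P)

/-- The inversion. -/
def im (z : ℂ) : ℂ := V.u / (z - V.x)

/-- The inverse of the inversion. -/
def inv (w : ℂ) : ℂ := V.x + V.u / w

lemma inv_im {z : ℂ} (hz : z ≠ V.x) : V.inv (V.im z) = z := by
  have := sub_ne_zero.2 hz
  have := V.hu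
  unfold inv im
  field_simp
  ring

lemma im_inv {w : ℂ} (hw : w ≠ 0) : V.im (V.inv w) = w := by
  have := V.hu
  unfold inv im
  rw [add_sub_cancel_left]
  field_simp

lemma im_mem {z : ℂ} (hz : z ∈ P) (h : z ≠ V.x) : V.im z ∈ V.A.pts := (V.hA _).2 ⟨z, hz, h, rfl⟩

lemma im_ne_zero {z : ℂ} (h : z ≠ V.x) : V.im z ≠ 0 := div_ne_zero V.hu (sub_ne_zero.2 h)

lemma im_inj {y z : ℂ} (hy : y ≠ V.x) (hz : z ≠ V.x) (h : V.im y = V.im z) : y = z := by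
  rw [← V.inv_im hy, h, V.inv_im hz]

variable {V}

lemma ne_zero {w : ℂ} (hw : w ∈ V.A.pts) : w ≠ 0 := by
  obtain ⟨z, -, hz, rfl⟩ := (V.hA w).1 hw
  exact V.im_ne_zero hz

lemma inv_mem {w : ℂ} (hw : w ∈ V.A.pts) : V.inv w ∈ P := by
  obtain ⟨z, h, hz, rfl⟩ := (V.hA w).1 hw
  rw [← im, V.inv_im hz]; exact h

lemma inv_ne {w : ℂ} (hw : w ∈ V.A.pts) : V.inv w ≠ V.x := by
  obtain ⟨z, h, hz, rfl⟩ := (V.hA w).1 hw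
  rw [← im, V.inv_im hz]; exact hz

lemma inv_inj {w w' : ℂ} (hw : w ∈ V.A.pts) (hw' : w' ∈ V.A.pts) (h : V.inv w = V.inv w') :
    w = w' := by
  rw [← V.im_inv (ne_zero hw), h, V.im_inv (ne_zero hw')]

variable (V)

/-- The generalised circle through the centre dual to a vertex. -/
def circ (v : ℝ × ℝ) : Set ℂ := _root_.circ V.x V.u v

lemma mem_circ {z : ℂ} {v : ℝ × ℝ} (hz : z ≠ V.x) : z ∈ V.circ v ↔ On v (V.im z) :=
  _root_.mem_circ hz

lemma inv_mem_circ {w : ℂ} {v : ℝ × ℝ} (hw : w ∈ V.A.pts) : V.inv w ∈ V.circ v ↔ On v w := by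
  rw [V.mem_circ (inv_ne hw), V.im_inv (ne_zero hw)]

lemma self_mem (v : ℝ × ℝ) : V.x ∈ V.circ v := self_mem_circ _ _ _

lemma isGenCircle (v : ℝ × ℝ) : IsGenCircle (V.circ v) := isGenCircle_circ _ V.hu v

lemma card_pts : V.A.pts.card + 1 = P.card := by
  classical
  have : V.A.pts = (P.erase V.x).image V.im := by
    ext w
    rw [V.hA, Finset.mem_image]
    simp only [Finset.mem_erase, im]
    exact ⟨fun ⟨z, a, b, c⟩ => ⟨z, ⟨b, a⟩, c⟩, fun ⟨z, ⟨b, a⟩, c⟩ => ⟨z, a, b, c⟩⟩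
  rw [this, Finset.card_image_of_injOn, Finset.card_erase_add_one V.hx]
  intro y hy z hz h
  exact V.im_inj (Finset.ne_of_mem_erase hy) (Finset.ne_of_mem_erase hz) h

end View

theorem exists_view {P : Finset ℂ} (hP : ∀ C, IsGenCircle C → ¬ (P : Set ℂ) ⊆ C) {x : ℂ}
    (hx : x ∈ P) : ∃ V : View P, V.x = x := by
  classical
  obtain ⟨t, ht⟩ := Infinite.exists_notMem_finset ((P ×ˢ P).image fun yz : ℂ × ℂ =>
    (1 / (yz.1 - x) - 1 / (yz.2 - x)).re / (1 / (yz.1 - x) - 1 / (yz.2 - x)).im)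
  set u : ℂ := ⟨1, t⟩ with hu
  have hu0 : u ≠ 0 := fun h => by simpa [hu] using congrArg Complex.re h
  refine ⟨⟨x, u, hx, hu0, ⟨(P.erase x).image fun z => u / (z - x), ?_, ?_⟩, fun w => ?_⟩, rfl⟩
  · intro a ha b hb h
    obtain ⟨y, hy, rfl⟩ := Finset.mem_image.1 (Finset.mem_coe.1 ha)
    obtain ⟨z, hz, rfl⟩ := Finset.mem_image.1 (Finset.mem_coe.1 hb)
    have hd : (u * (1 / (y - x) - 1 / (z - x))).re = 0 := by
      rw [mul_sub, Complex.sub_re, mul_one_div, mul_one_div]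
      exact sub_eq_zero.2 h
    have hn : t ≠ (1 / (y - x) - 1 / (z - x)).re / (1 / (y - x) - 1 / (z - x)).im := fun e =>
      ht (Finset.mem_image.2 ⟨(y, z), Finset.mem_product.2
        ⟨Finset.mem_of_mem_erase hy, Finset.mem_of_mem_erase hz⟩, e.symm⟩)
    rw [div_eq_mul_one_div, div_eq_mul_one_div u (z - x)]
    congr 1
    rw [← sub_eq_zero]
    generalize 1 / (y - x) - 1 / (z - x) = d at *
    have hd' : d.re = t * d.im := by
      rw [Complex.mul_re, hu] at hd
      simp only [one_mul] at hd
      linarith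
    by_cases hi : d.im = 0
    · exact Complex.ext (by rw [hd', hi]; simp) hi
    · exact absurd (by rw [hd']; field_simp) hn
  · intro v
    by_contra! h
    refine hP _ (isGenCircle_circ x hu0 v) fun z hz => ?_
    by_cases hzx : z = x
    · exact .inl hzx
    · exact .inr (h _ (Finset.mem_image.2 ⟨z, Finset.mem_erase.2 ⟨hzx, hz⟩, rfl⟩))
  · simp only [Finset.mem_image, Finset.mem_erase]
    exact ⟨fun ⟨z, ⟨b, a⟩, c⟩ => ⟨z, a, b, c⟩, fun ⟨z, a, b, c⟩ => ⟨z, ⟨b, a⟩, c⟩⟩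

theorem finite_ordinary (P : Finset ℂ) :
    {C : Set ℂ | IsGenCircle C ∧ (C ∩ (P : Set ℂ)).ncard = 3}.Finite := by
  refine Set.Finite.of_finite_image (f := fun C => C ∩ (P : Set ℂ))
    ((P.finite_toSet.finite_subsets).subset ?_) ?_
  · rintro _ ⟨C, -, rfl⟩
    exact Set.inter_subset_right
  · rintro C ⟨hC, h3⟩ D ⟨hD, -⟩ h
    obtain ⟨a, b, c, hab, hac, hbc, e⟩ := Set.ncard_eq_three.1 h3
    have h' : D ∩ (P : Set ℂ) = {a, b, c} := by rw [← e]; exact h.symm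
    have mC : ∀ z ∈ ({a, b, c} : Set ℂ), z ∈ C := fun z hz => by rw [← e] at hz; exact hz.1
    have mD : ∀ z ∈ ({a, b, c} : Set ℂ), z ∈ D := fun z hz => by rw [← h'] at hz; exact hz.1
    exact hC.eq_of_three hD (x := a) (p := b) (q := c) hab.symm hac.symm hbc (mC _ (by simp))
      (mC _ (by simp)) (mC _ (by simp)) (mD _ (by simp)) (mD _ (by simp)) (mD _ (by simp))

theorem View.circ_ordinary {P : Finset ℂ} (V : View P) {v : ℝ × ℝ}
    (h2 : (V.A.thru v).card = 2) : (V.circ v ∩ (P : Set ℂ)).ncard = 3 := by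
  classical
  have : V.circ v ∩ (P : Set ℂ) = (insert V.x ((V.A.thru v).image V.inv) : Finset ℂ) := by
    ext z
    simp only [Set.mem_inter_iff, Finset.coe_insert, Finset.coe_image, Set.mem_insert_iff,
      Set.mem_image, Finset.mem_coe, V.A.mem_thru]
    constructor
    · rintro ⟨h, hz⟩
      by_cases hzx : z = V.x
      · exact .inl hzx
      · exact .inr ⟨V.im z, ⟨V.im_mem hz hzx, (V.mem_circ hzx).1 h⟩, V.inv_im hzx⟩
    · rintro (rfl | ⟨w, ⟨hw, hv⟩, rfl⟩)
      · exact ⟨V.self_mem v, V.hx⟩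
      · exact ⟨(V.inv_mem_circ hw).2 hv, View.inv_mem hw⟩
  rw [this, Set.ncard_coe_finset, Finset.card_insert_of_notMem, Finset.card_image_of_injOn, h2]
  · intro a ha b hb h
    exact View.inv_inj (V.A.mem_thru.1 ha).1 (V.A.mem_thru.1 hb).1 h
  · intro h
    obtain ⟨w, hw, h⟩ := Finset.mem_image.1 h
    exact View.inv_ne (V.A.mem_thru.1 hw).1 h

theorem exists_views {P : Finset ℂ} (hP : ∀ C, IsGenCircle C → ¬ (P : Set ℂ) ⊆ C) :
    ∃ V : ℂ → View P, ∀ x ∈ P, (V x).x = x := by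
  classical
  have hne : ∃ x, x ∈ P := by
    by_contra! h
    exact hP _ (.inr ⟨0, 1, one_ne_zero, rfl⟩) fun z hz => absurd hz (h z)
  obtain ⟨x₀, h₀⟩ := hne
  choose W hW using fun x (hx : x ∈ P) => exists_view hP hx
  exact ⟨fun x => if h : x ∈ P then W x h else W x₀ h₀, fun x hx => by simp only [dif_pos hx, hW]⟩

/-- Every ordinary generalised circle is seen from its three points only. -/
theorem sum_n₂_le {P : Finset ℂ} (V : ℂ → View P) (hV : ∀ x ∈ P, (V x).x = x) :
    ∑ x ∈ P, (V x).A.n₂ ≤ 3 * ordinaryGenCircles (P : Set ℂ) := by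
  classical
  have hfin := finite_ordinary P
  set O := hfin.toFinset with hO
  have hcard : ordinaryGenCircles (P : Set ℂ) = O.card := Set.ncard_eq_toFinset_card _ hfin
  have memO : ∀ C, C ∈ O ↔ IsGenCircle C ∧ (C ∩ (P : Set ℂ)).ncard = 3 := fun C => by simp [hO]
  calc ∑ x ∈ P, (V x).A.n₂ ≤ ∑ x ∈ P, (O.filter fun C => x ∈ C).card := by
        refine Finset.sum_le_sum fun x hx => ?_
        unfold Arrangement.n₂
        refine Finset.card_le_card_of_injOn (V x).circ ?_ ?_
        · intro v hv
          have hv := Finset.mem_filter.1 (Finset.mem_coe.1 hv)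
          refine Finset.mem_coe.2 (Finset.mem_filter.2 ⟨(memO _).2 ⟨(V x).isGenCircle v,
            (V x).circ_ordinary hv.2⟩, ?_⟩)
          have := (V x).self_mem v
          rwa [hV x hx] at this
        · intro v hv v' hv' h
          have hv := Finset.mem_filter.1 (Finset.mem_coe.1 hv)
          obtain ⟨p, hp, q, hq, hpq, h1, h2⟩ := Arrangement.mem_verts.1 hv.1
          refine On.unique hpq h1 h2 ?_ ?_
          · rw [← (V x).inv_mem_circ hp, ← h, (V x).inv_mem_circ hp]; exact h1
          · rw [← (V x).inv_mem_circ hq, ← h, (V x).inv_mem_circ hq]; exact h2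
    _ = ∑ C ∈ O, (P.filter fun x => x ∈ C).card :=
        Finset.sum_card_bipartiteAbove_eq_sum_card_bipartiteBelow _
    _ = ∑ C ∈ O, 3 := by
        refine Finset.sum_congr rfl fun C hC => ?_
        rw [← ((memO C).1 hC).2, ← Set.ncard_coe_finset]
        congr 1
        ext z
        simp [and_comm]
    _ = 3 * ordinaryGenCircles (P : Set ℂ) := by rw [hcard, Finset.sum_const, smul_eq_mul, mul_comm]

theorem bideg_of_mul {a k : ℕ} {g h : ℂ[X][X]} (hgh : Bideg k (g * h)) (h0 : g * h ≠ 0)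
    (h1 : g.natDegree = a) (h2 : (Bivariate.swap g).natDegree = a) : Bideg (k - a) h := by
  have hg := left_ne_zero_of_mul h0
  have hh := right_ne_zero_of_mul h0
  have e1 := hgh.1
  have e2 := hgh.2
  rw [natDegree_mul hg hh] at e1
  rw [natDegree_swap_mul hg hh] at e2
  exact ⟨by omega, by omega⟩

theorem not_dvd_derivative {g : ℂ[X][X]} (h : g.natDegree ≠ 0) : ¬ g ∣ derivative g := by
  intro hd
  have h0 : derivative g ≠ 0 := fun e => h (derivative_eq_zero.1 e)
  have h1 := natDegree_le_of_dvd hd h0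
  have h2 := natDegree_derivative_lt h
  omega

theorem Bideg.derivative {k : ℕ} {g : ℂ[X][X]} (h : Bideg k g) : Bideg k (derivative g) := by
  rw [bideg_iff] at *
  intro i j hij
  have h0 := h (i + 1) j (by omega)
  rw [coeff_derivative, show ((i : ℂ[X]) + 1) = C ((i : ℂ) + 1) by simp, coeff_mul_C, h0, zero_mul]

theorem exists_singular {g : ℂ[X][X]} (hg : Irreducible g) (hgd : Bideg 3 g)
    (h : g.natDegree ≠ 0) : ∃ Z : Finset ℂ, Z.card ≤ 18 ∧
      ∀ z, ev z g = 0 → ev z (derivative g) = 0 → z ∈ Z :=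
  exists_common_zeros hg hgd hgd.derivative (not_dvd_derivative h)

theorem natDegree_pos_of_many_zeros {g : ℂ[X][X]} (hg : Irreducible g) (hgd : Bideg 3 g)
    {S : Finset ℂ} (hS : 18 < S.card) (h : ∀ z ∈ S, ev z g = 0) : g.natDegree ≠ 0 := by
  intro h0
  have h1 := natDegree_eq_of_many_zeros hg hgd S hS h
  obtain ⟨z, hz⟩ := Finset.card_pos.1 (show 0 < S.card by omega)
  have hz := h z hz
  have hb : Bideg 0 g := ⟨h0.le, (h1.trans h0).le⟩
  rw [ev_eq_tc hb z] at hz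
  refine hg.ne_zero (eq_zero_of_tc hb z fun i hi j hj => ?_)
  obtain rfl : i = 0 := by omega
  obtain rfl : j = 0 := by omega
  simpa using hz

theorem OrdGE.ev {m : ℕ} {x : ℂ} {F : ℂ[X][X]} (h : OrdGE (m + 1) x F) : ev x F = 0 := by
  rw [← tc_zero_zero]; exact h 0 0 (by omega)

namespace View

variable {P : Finset ℂ} (V : View P) {R : ℕ}

/-- The pull-back of a cubic under the inversion. -/
def pull (k : Cub) : ℂ[X][X] := _root_.pull V.x V.u k

lemma bideg_pull (k : Cub) : Bideg 3 (V.pull k) := _root_.bideg_pull _ _ k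

lemma pull_ne_zero {k : Cub} (hk : k ≠ 0) : V.pull k ≠ 0 := _root_.pull_ne_zero _ V.hu hk

lemma ordGE_pull (k : Cub) : OrdGE 3 V.x (V.pull k) := fun _ _ h => tc_pull_low _ _ k h

lemma ev_pull {z : ℂ} (hz : z ≠ V.x) (k : Cub) : ev z (V.pull k) = 0 ↔ cev k (V.im z) = 0 :=
  ev_pull_eq_zero _ hz k

variable {V}

lemma ev_pull_inv {w : ℂ} (hw : w ∈ V.A.pts) (k : Cub) :
    ev (V.inv w) (V.pull k) = 0 ↔ cev k w = 0 := by
  rw [V.ev_pull (inv_ne hw), V.im_inv (ne_zero hw)]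

variable (V) in
/-- The curves, through the image of `p`, which are used to cover `P`. -/
def IsCov (R : ℕ) (p : ℂ) (F : ℂ[X][X]) : Prop :=
  (∃ v, On v p ∧ Bideg 1 F ∧ F ≠ 0 ∧ ∀ z, z ∈ V.circ v ↔ ev z F = 0) ∨
    ∃ k, k ≠ 0 ∧ (∃ f : V.A.Flag, f.p = p ∧ f.Lat R ∧ k ∈ f.J) ∧ F = V.pull k

lemma IsCov.bideg {p : ℂ} {F : ℂ[X][X]} (h : V.IsCov R p F) : Bideg 3 F := by
  obtain ⟨v, -, h, -⟩ | ⟨k, -, -, rfl⟩ := h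
  · exact h.mono (by norm_num)
  · exact V.bideg_pull k

lemma IsCov.ne_zero {p : ℂ} {F : ℂ[X][X]} (h : V.IsCov R p F) : F ≠ 0 := by
  obtain ⟨v, -, -, h, -⟩ | ⟨k, h, -, rfl⟩ := h
  · exact h
  · exact V.pull_ne_zero h

open Classical in
theorem exists_cover (hA : 2 * R + 1 < V.A.pts.card) (hR : 6 ≤ R) {p : ℂ} (hp : p ∈ V.A.pts)
    {b : ℕ} (hb : (Finset.univ.filter fun f : V.A.Flag => f.p = p ∧ ¬ f.Lat R).card ≤ b) :
    ∃ 𝓕 : Finset ℂ[X][X], 𝓕.card ≤ 2 * b + 2 ∧ (∀ F ∈ 𝓕, V.IsCov R p F) ∧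
      ∀ z ∈ P, z ≠ V.x → z ≠ V.inv p → ∃ F ∈ 𝓕, ev z F = 0 := by
  classical
  obtain ⟨L, K, hL, hK, hLp, hKJ, h⟩ := Arrangement.exists_cover hA hR hp hb
  choose poly hpoly using fun v => (V.isGenCircle v).exists_poly
  refine ⟨L.image poly ∪ K.image V.pull, ?_, ?_, fun z hz hzx hzp => ?_⟩
  · have := Finset.card_union_le (L.image poly) (K.image V.pull)
    have := Finset.card_image_le (s := L) (f := poly)
    have := Finset.card_image_le (s := K) (f := V.pull)
    omega
  · intro F hF
    obtain hF | hF := Finset.mem_union.1 hF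
    · obtain ⟨v, hv, rfl⟩ := Finset.mem_image.1 hF
      exact .inl ⟨v, (V.A.mem_onV.1 (hLp hv)).2, hpoly v⟩
    · obtain ⟨k, hk, rfl⟩ := Finset.mem_image.1 hF
      exact .inr ⟨k, (hKJ k hk).1, (hKJ k hk).2, rfl⟩
  · obtain ⟨v, hv, ho⟩ | ⟨k, hk, h0⟩ := h (V.im z) (V.im_mem hz hzx) fun e =>
      hzp (by rw [← e, V.inv_im hzx])
    · exact ⟨poly v, Finset.mem_union_left _ (Finset.mem_image_of_mem _ hv),
        ((hpoly v).2.2 z).1 ((V.mem_circ hzx).2 ho)⟩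
    · exact ⟨V.pull k, Finset.mem_union_right _ (Finset.mem_image_of_mem _ hk),
        (V.ev_pull hzx k).2 h0⟩

theorem pull_of_natDegree_three {g : ℂ[X][X]} {k : Cub} (hk : k ≠ 0) (hd : g ∣ V.pull k)
    (h1 : g.natDegree = 3) (h2 : (Bivariate.swap g).natDegree = 3) :
    ev V.x g = 0 ∧ ev V.x (derivative g) = 0 := by
  obtain ⟨h, e⟩ := hd
  have h0 : g * h ≠ 0 := e ▸ V.pull_ne_zero hk
  have ho : OrdGE 3 V.x (g * h) := e ▸ V.ordGE_pull k
  have hb : Bideg 0 h := bideg_of_mul (e ▸ V.bideg_pull k) h0 h1 h2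
  have hne : ev V.x h ≠ 0 := fun hx => right_ne_zero_of_mul h0 (eq_zero_of_tc hb V.x (by
    intro i hi j hj
    obtain rfl : i = 0 := by omega
    obtain rfl : j = 0 := by omega
    rwa [tc_zero_zero]))
  have hx : ev V.x g = 0 := by
    have := ho.ev
    rw [map_mul] at this
    exact (mul_eq_zero.1 this).resolve_right hne
  exact ⟨hx, by_contra fun hn => hne (ho.of_mul' hx hn).ev⟩

theorem pull_of_natDegree_two {g : ℂ[X][X]} {k : Cub} (hk : k ≠ 0) (hd : g ∣ V.pull k)
    (h1 : g.natDegree = 2) (h2 : (Bivariate.swap g).natDegree = 2) :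
    ev V.x g = 0 ∧ (ev V.x (derivative g) ≠ 0 → ∀ z, z ≠ V.x → ev z (V.pull k) = 0 →
      ev z g = 0) := by
  obtain ⟨h, e⟩ := hd
  have h0 : g * h ≠ 0 := e ▸ V.pull_ne_zero hk
  have hh : h ≠ 0 := right_ne_zero_of_mul h0
  have ho : OrdGE 3 V.x (g * h) := e ▸ V.ordGE_pull k
  have hb : Bideg 1 h := bideg_of_mul (e ▸ V.bideg_pull k) h0 h1 h2
  have hx : ev V.x g = 0 := by
    by_contra hx
    have ho' := OrdGE.of_mul hx ho
    exact hh (eq_zero_of_tc hb V.x fun i hi j hj => ho' i j (by omega))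
  refine ⟨hx, fun hn z hz hz0 => ?_⟩
  have ho' := ho.of_mul' hx hn
  rw [e, map_mul] at hz0
  refine (mul_eq_zero.1 hz0).resolve_right ?_
  rw [ev_eq_tc hb V.x]
  simp only [Finset.sum_range_succ, Finset.sum_range_zero, ho' 0 0 (by norm_num),
    ho' 0 1 (by norm_num), ho' 1 0 (by norm_num)]
  intro hz1
  have hz2 : z - V.x ≠ 0 := sub_ne_zero.2 hz
  have hz3 : conj (z - V.x) ≠ 0 := (_root_.map_ne_zero _).2 hz2
  have h11 : tc V.x h 1 1 = 0 := by
    simpa [hz2, hz3, -map_sub] using hz1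
  refine hh (eq_zero_of_tc hb V.x fun i hi j hj => ?_)
  by_cases hij : i + j < 2
  · exact ho' i j hij
  · obtain rfl : i = 1 := by omega
    obtain rfl : j = 1 := by omega
    exact h11

theorem not_three {g : ℂ[X][X]} (hg : Bideg 1 g) (hx : ev V.x g ≠ 0) {v : ℝ × ℝ} {a b c : ℂ}
    (ha : a ∈ V.A.pts) (hb : b ∈ V.A.pts) (hc : c ∈ V.A.pts) (hab : a ≠ b) (hac : a ≠ c)
    (hbc : b ≠ c) (va : On v a) (vb : On v b) (vc : On v c) (ga : ev (V.inv a) g = 0)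
    (gb : ev (V.inv b) g = 0) (gc : ev (V.inv c) g = 0) : False := by
  have hon : ∀ w ∈ V.A.pts, On v w → On v (V.u / (V.inv w - V.x)) := fun w hw h => by
    rw [← im, V.im_inv (ne_zero hw)]; exact h
  have hne : ∀ w ∈ V.A.pts, ∀ w' ∈ V.A.pts, w ≠ w' → V.inv w ≠ V.inv w' :=
    fun w hw w' hw' h e => h (inv_inj hw hw' e)
  refine not_three_on V.hu hg hx (v := v) (z := ![V.inv a, V.inv b, V.inv c]) ?_ ?_ ?_ ?_
  · intro l l' h
    have h1 := hne a ha b hb hab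
    have h2 := hne a ha c hc hac
    have h3 := hne b hb c hc hbc
    fin_cases l <;> fin_cases l' <;>
      first
      | rfl
      | exact absurd h h1
      | exact absurd h h2
      | exact absurd h h3
      | exact absurd h.symm h1
      | exact absurd h.symm h2
      | exact absurd h.symm h3
  all_goals intro l; fin_cases l
  exacts [inv_ne ha, inv_ne hb, inv_ne hc, hon a ha va, hon b hb vb, hon c hc vc, ga, gb, gc]

/-- If the cubic of a lattice flag contains a generalised circle avoiding the centre and the
line of the flag, then the lines of the first family all pass through one point. -/
theorem concurrent {f : V.A.Flag} (hf : f.Lat R) (hA : 2 * R + 1 < V.A.pts.card) {k : Cub}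
    (hkJ : k ∈ f.J) (hk : k ≠ 0) {g : ℂ[X][X]} (hd : g ∣ V.pull k) (h1 : g.natDegree = 1)
    (h2 : (Bivariate.swap g).natDegree = 1) (hx : ev V.x g ≠ 0) (hp : ev (V.inv f.p) g ≠ 0)
    {W : ℕ} (hW : W + 6 ≤ R) :
    ∃ v, ∀ i ≤ W, On v (f.lineA i) ∧ ev (V.inv (f.lineA i)) g ≠ 0 := by
  obtain ⟨h, e⟩ := hd
  have h0 : g * h ≠ 0 := e ▸ V.pull_ne_zero hk
  have ho : OrdGE 3 V.x (g * h) := e ▸ V.ordGE_pull k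
  have hb : Bideg 2 h := bideg_of_mul (e ▸ V.bideg_pull k) h0 h1 h2
  obtain ⟨α, β, γ, hne, hlin⟩ := linAt_of_ordGE V.hu hb (right_ne_zero_of_mul h0) (ho.of_mul hx)
  have G := hf.grid hA
  obtain ⟨vA, vB, vC⟩ := f.J_vanish hf hA hkJ (n := W + 4) (by omega) (by omega)
  have key : ∀ w ∈ V.A.pts, cev k w = 0 → ev (V.inv w) g ≠ 0 → α * w + β * conj w + γ = 0 := by
    intro w hw hkw hgw
    rw [← ev_pull_inv hw, e, map_mul] at hkw
    have := (hlin _ (inv_ne hw)).1 ((mul_eq_zero.1 hkw).resolve_left hgw)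
    rwa [← im, V.im_inv (ne_zero hw)] at this
  have ℓ0 := key _ (G.mem_a 0) (vA 0 (by omega)) hp
  have mem_thru : ∀ i j, i + j ≤ R → ∃ v, On v (f.lineA i) ∧ On v (f.lineB j) ∧
      On v (f.lineC (i + j)) ∧ ∀ w ∈ V.A.pts, On v w →
        w = f.lineA i ∨ w = f.lineB j ∨ w = f.lineC (i + j) := by
    intro i j hij
    obtain ⟨v, -, hv⟩ := G.thru i j hij
    have : ∀ w, w ∈ V.A.thru v ↔ w = f.lineA i ∨ w = f.lineB j ∨ w = f.lineC (i + j) := by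
      intro w; rw [hv]; simp
    exact ⟨v, (V.A.mem_thru.1 ((this _).2 (by simp))).2, (V.A.mem_thru.1 ((this _).2 (by simp))).2,
      (V.A.mem_thru.1 ((this _).2 (by simp))).2, fun w hw ho =>
        (this w).1 (V.A.mem_thru.2 ⟨hw, ho⟩)⟩
  have through : ∀ w₁ ∈ V.A.pts, ∀ w₂, f.lineA 0 ≠ w₁ → α * w₁ + β * conj w₁ + γ = 0 →
      α * w₂ + β * conj w₂ + γ = 0 → On (meet (f.lineA 0) w₁) w₂ := fun w₁ hw₁ w₂ hne' e₁ e₂ =>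
    lin_on hne (Arrangement.re_ne (G.mem_a 0) hw₁ hne') ℓ0 e₁ e₂
  have oneB : ∀ j ≤ W + 4, ∀ j' ≤ W + 4, α * f.lineB j + β * conj (f.lineB j) + γ = 0 →
      α * f.lineB j' + β * conj (f.lineB j') + γ = 0 → j = j' := by
    intro j hj j' hj' e₁ e₂
    have hab := G.ab 0 j (by omega)
    obtain ⟨v, v1, v2, -, v4⟩ := mem_thru 0 j (by omega)
    have := through _ (G.mem_b j) _ hab e₁ e₂
    rw [← On.fst_eq (Arrangement.re_ne (G.mem_a 0) (G.mem_b j) hab) v1 v2] at this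
    obtain h | h | h := v4 _ (G.mem_b j') this
    · exact absurd h.symm (G.ab 0 j' (by omega))
    · exact (G.inj_b _ (by omega) _ (by omega) h).symm
    · exact absurd h (G.bc _ (by omega) _ (by omega))
  have oneC : ∀ j ≤ W + 4, ∀ j' ≤ W + 4, α * f.lineC j + β * conj (f.lineC j) + γ = 0 →
      α * f.lineC j' + β * conj (f.lineC j') + γ = 0 → j = j' := by
    intro j hj j' hj' e₁ e₂
    have hac := G.ac 0 (by omega) j (by omega)
    obtain ⟨v, v1, -, v3, v4⟩ := mem_thru 0 j (by omega)
    rw [zero_add] at v3 v4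
    have := through _ (G.mem_c j) _ hac e₁ e₂
    rw [← On.fst_eq (Arrangement.re_ne (G.mem_a 0) (G.mem_c j) hac) v1 v3] at this
    obtain h | h | h := v4 _ (G.mem_c j') this
    · exact absurd h.symm (G.ac 0 (by omega) j' (by omega))
    · exact absurd h.symm (G.bc _ (by omega) _ (by omega))
    · exact (G.inj_c _ (by omega) _ (by omega) h).symm
  have notA : ∀ i ≤ W, ev (V.inv (f.lineA i)) g ≠ 0 := by
    intro i hi hA0
    obtain ⟨j, hj1, hj3, hB, hC⟩ : ∃ j, 1 ≤ j ∧ j ≤ 3 ∧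
        α * f.lineB j + β * conj (f.lineB j) + γ ≠ 0 ∧
        α * f.lineC (i + j) + β * conj (f.lineC (i + j)) + γ ≠ 0 := by
      by_contra! hcon
      by_cases e1 : α * f.lineB 1 + β * conj (f.lineB 1) + γ = 0
      · have c2 := hcon 2 (by omega) (by omega) fun e => absurd (oneB 1 (by omega) 2 (by omega) e1 e)
          (by omega)
        have c3 := hcon 3 (by omega) (by omega) fun e => absurd (oneB 1 (by omega) 3 (by omega) e1 e)
          (by omega)
        exact absurd (oneC _ (by omega) _ (by omega) c2 c3) (by omega)
      have c1 := hcon 1 (by omega) (by omega) e1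
      by_cases e2 : α * f.lineB 2 + β * conj (f.lineB 2) + γ = 0
      · have c3 := hcon 3 (by omega) (by omega) fun e => absurd (oneB 2 (by omega) 3 (by omega) e2 e)
          (by omega)
        exact absurd (oneC _ (by omega) _ (by omega) c1 c3) (by omega)
      have c2 := hcon 2 (by omega) (by omega) e2
      exact absurd (oneC _ (by omega) _ (by omega) c1 c2) (by omega)
    have hgB : ev (V.inv (f.lineB j)) g = 0 := by
      by_contra hn; exact hB (key _ (G.mem_b j) (vB j (by omega)) hn)
    have hgC : ev (V.inv (f.lineC (i + j))) g = 0 := by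
      by_contra hn
      have := vC (i + j - 1) (by omega)
      rw [show i + j - 1 + 1 = i + j by omega] at this
      exact hC (key _ (G.mem_c _) this hn)
    obtain ⟨v, v1, v2, v3, -⟩ := mem_thru i j (by omega)
    exact not_three ⟨h1.le, h2.le⟩ hx (G.mem_a i) (G.mem_b j) (G.mem_c _) (G.ab i j (by omega))
      (G.ac i (by omega) (i + j) (by omega)) (G.bc j (by omega) (i + j) (by omega)) v1 v2 v3
      hA0 hgB hgC
  have h01 : W ≠ 0 → f.lineA 0 ≠ f.lineA 1 := fun hW0 h => by
    have := G.inj_a 0 (by omega) 1 (by omega) h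
    omega
  by_cases hW0 : W = 0
  · obtain ⟨v, v1, -⟩ := mem_thru 0 0 (by omega)
    refine ⟨v, fun i hi => ⟨?_, notA i hi⟩⟩
    obtain rfl : i = 0 := by omega
    exact v1
  · refine ⟨meet (f.lineA 0) (f.lineA 1), fun i hi => ⟨?_, notA i hi⟩⟩
    exact through _ (G.mem_a 1) _ (h01 hW0)
      (key _ (G.mem_a 1) (vA 1 (by omega)) (notA 1 (by omega)))
      (key _ (G.mem_a i) (vA i (by omega)) (notA i hi))

end View

/-- The quadratic polynomial with given coefficients. -/
def quad (a b c d e f : ℝ) : MvPolynomial (Fin 2) ℝ :=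
  MvPolynomial.C a * MvPolynomial.X 0 ^ 2 + MvPolynomial.C b * (MvPolynomial.X 0 * MvPolynomial.X 1)
    + MvPolynomial.C c * MvPolynomial.X 1 ^ 2 + MvPolynomial.C d * MvPolynomial.X 0 +
    MvPolynomial.C e * MvPolynomial.X 1 + MvPolynomial.C f

theorem eval_quad (a b c d e f x y : ℝ) : MvPolynomial.eval ![x, y] (quad a b c d e f) =
    a * x ^ 2 + b * (x * y) + c * y ^ 2 + d * x + e * y + f := by
  simp [quad]

theorem totalDegree_quad (a b c d e f : ℝ) : (quad a b c d e f).totalDegree ≤ 2 := by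
  have hC : ∀ (a : ℝ) (p : MvPolynomial (Fin 2) ℝ), p.totalDegree ≤ 2 →
      (MvPolynomial.C a * p).totalDegree ≤ 2 := fun a p hp => by
    refine (MvPolynomial.totalDegree_mul _ _).trans ?_
    rw [MvPolynomial.totalDegree_C]
    omega
  have hX : ∀ i, (MvPolynomial.X i : MvPolynomial (Fin 2) ℝ).totalDegree = 1 :=
    MvPolynomial.totalDegree_X
  have hX2 : ∀ i j, (MvPolynomial.X i * MvPolynomial.X j : MvPolynomial (Fin 2) ℝ).totalDegree ≤ 2 :=
    fun i j => (MvPolynomial.totalDegree_mul _ _).trans (by rw [hX, hX])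
  have h_add : ∀ p q : MvPolynomial (Fin 2) ℝ, p.totalDegree ≤ 2 → q.totalDegree ≤ 2 →
      (p + q).totalDegree ≤ 2 := fun p q hp hq =>
    (MvPolynomial.totalDegree_add _ _).trans (max_le hp hq)
  unfold quad
  refine h_add _ _ (h_add _ _ (h_add _ _ (h_add _ _ (h_add _ _ ?_ ?_) ?_) ?_) ?_) ?_
  · rw [sq]; exact hC _ _ (hX2 _ _)
  · exact hC _ _ (hX2 _ _)
  · rw [sq]; exact hC _ _ (hX2 _ _)
  · exact hC _ _ (by rw [hX]; norm_num)
  · exact hC _ _ (by rw [hX]; norm_num)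
  · rw [MvPolynomial.totalDegree_C]; norm_num

theorem quad_eq_zero {a b c d e f : ℝ} (h : quad a b c d e f = 0) :
    a = 0 ∧ b = 0 ∧ c = 0 ∧ d = 0 ∧ e = 0 ∧ f = 0 := by
  have key : ∀ x y : ℝ, a * x ^ 2 + b * (x * y) + c * y ^ 2 + d * x + e * y + f = 0 := fun x y => by
    rw [← eval_quad, h, map_zero]
  have h1 := key 0 0
  have h2 := key 1 0
  have h3 := key (-1) 0
  have h4 := key 0 1
  have h5 := key 0 (-1)
  have h6 := key 1 1
  refine ⟨?_, ?_, ?_, ?_, ?_, ?_⟩ <;> linarith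

theorem exists_hermitian {F : ℂ[X][X]} (hF : Bideg 2 F) (h0 : F ≠ 0) :
    ∃ H, Bideg 2 H ∧ H ≠ 0 ∧ conjSwap H = H ∧ ∀ z, ev z F = 0 → ev z H = 0 := by
  by_cases h : F + conjSwap F = 0
  · refine ⟨C (C Complex.I) * F, ?_, ?_, ?_, fun z hz => by rw [map_mul, hz, mul_zero]⟩
    · rw [bideg_iff] at *
      intro i j hij
      rw [coeff_C_mul, coeff_C_mul, hF i j hij, mul_zero]
    · exact mul_ne_zero (by simp) h0
    · have h1 : conjSwap F = -F := by rw [eq_neg_iff_add_eq_zero, add_comm]; exact h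
      have h2 : conjSwap (C (C Complex.I)) = -C (C Complex.I) := by
        ext i j
        rw [coeff_conjSwap, coeff_neg, coeff_neg, coeff_C, coeff_C]
        split_ifs <;> simp_all [coeff_C]
      rw [map_mul, h1, h2]
      ring
  · exact ⟨_, hF.add hF.conjSwap, h, by rw [map_add, conjSwap_conjSwap, add_comm],
      fun z hz => by rw [map_add, ev_conjSwap, hz, map_zero, add_zero]⟩

/-- A curve of bidegree `(2, 2)` in `z` and `conj z` is a bicircular quartic. -/
theorem exists_quartic {F : ℂ[X][X]} (hF : Bideg 2 F) (h0 : F ≠ 0) :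
    ∃ (t u v : ℝ) (q : MvPolynomial (Fin 2) ℝ), q ≠ 0 ∧ q.totalDegree ≤ 2 ∧
      ∀ z : ℂ, ev z F = 0 → t * (z.re ^ 2 + z.im ^ 2) ^ 2 +
        (u * z.re + v * z.im) * (z.re ^ 2 + z.im ^ 2) + MvPolynomial.eval ![z.re, z.im] q = 0 := by
  obtain ⟨H, hH, hH0, hcs, hz⟩ := exists_hermitian hF h0
  have hc : ∀ i j, (H.coeff i).coeff j = conj ((H.coeff j).coeff i) := fun i j => by
    conv_lhs => rw [← hcs]
    exact coeff_conjSwap H i j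
  set c : ℕ → ℕ → ℂ := fun i j => (H.coeff j).coeff i with hcdef
  have hcc : ∀ i j, c i j = conj (c j i) := fun i j => hc j i
  have him : ∀ i, (c i i).im = 0 := fun i => Complex.conj_eq_iff_im.1 (hcc i i).symm
  have key : ∀ z : ℂ, ev z H = 0 → (c 2 2).re * (z.re ^ 2 + z.im ^ 2) ^ 2 +
      (2 * (c 2 1).re * z.re + (-2 * (c 2 1).im) * z.im) * (z.re ^ 2 + z.im ^ 2) +
      MvPolynomial.eval ![z.re, z.im] (quad (2 * (c 2 0).re + (c 1 1).re) (-4 * (c 2 0).im)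
        (-2 * (c 2 0).re + (c 1 1).re) (2 * (c 1 0).re) (-2 * (c 1 0).im) (c 0 0).re) = 0 := by
    intro z h
    rw [eval_quad]
    rw [ev_eq_sum hH] at h
    have e : ∀ i j, (H.coeff j).coeff i = c i j := fun _ _ => rfl
    simp only [Finset.sum_range_succ, Finset.sum_range_zero, e, hcc 0 1, hcc 0 2, hcc 1 2] at h
    have h := congrArg Complex.re h
    simp [pow_two, him] at h
    linear_combination h
  by_cases hq : quad (2 * (c 2 0).re + (c 1 1).re) (-4 * (c 2 0).im)
        (-2 * (c 2 0).re + (c 1 1).re) (2 * (c 1 0).re) (-2 * (c 1 0).im) (c 0 0).re = 0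
  · obtain ⟨q1, q2, q3, q4, q5, q6⟩ := quad_eq_zero hq
    refine ⟨0, 0, 0, quad (c 2 2).re 0 (c 2 2).re (2 * (c 2 1).re) (-2 * (c 2 1).im) 0, ?_,
      totalDegree_quad _ _ _ _ _ _, fun z h => ?_⟩
    · intro hq'
      obtain ⟨r1, -, -, r4, r5, -⟩ := quad_eq_zero hq'
      apply hH0
      have c22 : c 2 2 = 0 := Complex.ext r1 (him 2)
      have c11 : c 1 1 = 0 := Complex.ext (by simp only [Complex.zero_re]; linarith) (him 1)
      have c00 : c 0 0 = 0 := Complex.ext q6 (him 0)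
      have c21 : c 2 1 = 0 := Complex.ext (by simp only [Complex.zero_re]; linarith)
        (by simp only [Complex.zero_im]; linarith)
      have c20 : c 2 0 = 0 := Complex.ext (by simp only [Complex.zero_re]; linarith)
        (by simp only [Complex.zero_im]; linarith)
      have c10 : c 1 0 = 0 := Complex.ext (by simp only [Complex.zero_re]; linarith)
        (by simp only [Complex.zero_im]; linarith)
      have c01 : c 0 1 = 0 := by rw [hcc, c10, map_zero]
      have c02 : c 0 2 = 0 := by rw [hcc, c20, map_zero]
      have c12 : c 1 2 = 0 := by rw [hcc, c21, map_zero]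
      ext j i
      rw [coeff_zero, coeff_zero]
      change c i j = 0
      by_cases hij : 2 < j ∨ 2 < i
      · exact bideg_iff.1 hH j i hij
      have hi : i ≤ 2 := by omega
      have hj : j ≤ 2 := by omega
      interval_cases i <;> interval_cases j <;> assumption
    · have h' := key z (hz z h)
      rw [hq, map_zero, add_zero] at h'
      rw [eval_quad]
      have : (z.re ^ 2 + z.im ^ 2) * ((c 2 2).re * (z.re ^ 2 + z.im ^ 2) +
          (2 * (c 2 1).re * z.re + (-2 * (c 2 1).im) * z.im)) = 0 := by linear_combination h'
      rcases mul_eq_zero.1 this with h | h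
      · have hr : z.re = 0 := by nlinarith [sq_nonneg z.re, sq_nonneg z.im]
        have hi : z.im = 0 := by nlinarith [sq_nonneg z.re, sq_nonneg z.im]
        simp [hr, hi]
      · linear_combination h
  · exact ⟨_, _, _, _, hq, totalDegree_quad _ _ _ _ _ _, fun z h => key z (hz z h)⟩

theorem eq_C_of_bideg_zero {F : ℂ[X][X]} (hF : Bideg 0 F) : F = C (C ((F.coeff 0).coeff 0)) := by
  ext i j
  by_cases h : 0 < i ∨ 0 < j
  · rw [bideg_iff.1 hF i j h, coeff_C]
    split_ifs with hi
    · rw [coeff_C, if_neg (by omega)]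
    · simp
  · obtain rfl : i = 0 := by omega
    obtain rfl : j = 0 := by omega
    simp

theorem isUnit_of_bideg_zero {F : ℂ[X][X]} (hF : Bideg 0 F) (h0 : F ≠ 0) : IsUnit F := by
  rw [eq_C_of_bideg_zero hF]
  refine isUnit_C.2 (isUnit_C.2 (isUnit_iff_ne_zero.2 fun h => h0 ?_))
  rw [eq_C_of_bideg_zero hF, h, C_0, C_0]

theorem ev_ne_zero_of_isUnit {F : ℂ[X][X]} (hF : IsUnit F) (z : ℂ) : ev z F ≠ 0 :=
  (hF.map (ev z)).ne_zero

theorem ev_eq_zero_iff_of_associated {F G : ℂ[X][X]} (h : Associated F G) (z : ℂ) :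
    ev z F = 0 ↔ ev z G = 0 := by
  obtain ⟨c, rfl⟩ := h
  rw [map_mul, mul_eq_zero, or_iff_left (ev_ne_zero_of_isUnit c.isUnit z)]

theorem associated_of_bideg_one {g F : ℂ[X][X]} (h1 : g.natDegree = 1)
    (h2 : (Bivariate.swap g).natDegree = 1) (hF : Bideg 1 F) (h0 : F ≠ 0) (hd : g ∣ F) :
    Associated g F := by
  obtain ⟨h, rfl⟩ := hd
  have hb : Bideg 0 h := bideg_of_mul hF h0 h1 h2
  obtain ⟨c, rfl⟩ := isUnit_of_bideg_zero hb (right_ne_zero_of_mul h0)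
  exact ⟨c, rfl⟩

theorem exists_factors (D : ℕ) : ∀ F : ℂ[X][X], F ≠ 0 →
    F.natDegree + (Bivariate.swap F).natDegree ≤ D → ∃ 𝓖 : Finset ℂ[X][X], 𝓖.card ≤ D ∧
      (∀ g ∈ 𝓖, Irreducible g ∧ g ∣ F) ∧ ∀ z, ev z F = 0 → ∃ g ∈ 𝓖, ev z g = 0 := by
  classical
  induction D with
  | zero =>
    intro F h0 hD
    have hu := isUnit_of_bideg_zero (F := F) ⟨by omega, by omega⟩ h0
    exact ⟨∅, le_rfl, by simp, fun z hz => absurd hz (ev_ne_zero_of_isUnit hu z)⟩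
  | succ D ih =>
    intro F h0 hD
    by_cases hu : IsUnit F
    · exact ⟨∅, by simp, by simp, fun z hz => absurd hz (ev_ne_zero_of_isUnit hu z)⟩
    obtain ⟨g, hg, h, rfl⟩ := WfDvdMonoid.exists_irreducible_factor hu h0
    have hg0 := left_ne_zero_of_mul h0
    have hh0 := right_ne_zero_of_mul h0
    rw [natDegree_mul hg0 hh0, natDegree_swap_mul hg0 hh0] at hD
    have hpos : g.natDegree + (Bivariate.swap g).natDegree ≠ 0 := fun e =>
      hg.not_isUnit (isUnit_of_bideg_zero ⟨by omega, by omega⟩ hg0)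
    obtain ⟨𝓖, hc, hi, hz⟩ := ih h hh0 (by omega)
    refine ⟨insert g 𝓖, (Finset.card_insert_le _ _).trans (by omega), ?_, fun z h => ?_⟩
    · intro g' hg'
      obtain rfl | h := Finset.mem_insert.1 hg'
      · exact ⟨hg, dvd_mul_right _ _⟩
      · exact ⟨(hi g' h).1, (hi g' h).2.mul_left _⟩
    · rw [map_mul] at h
      rcases mul_eq_zero.1 h with h | h
      · exact ⟨g, Finset.mem_insert_self _ _, h⟩
      · obtain ⟨g', h1, h2⟩ := hz z h
        exact ⟨g', Finset.mem_insert_of_mem h1, h2⟩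

open Classical in
/-- The points of `P` on the curve `F = 0`. -/
def zer (P : Finset ℂ) (F : ℂ[X][X]) : Finset ℂ := P.filter fun z => ev z F = 0

theorem mem_zer {P : Finset ℂ} {F : ℂ[X][X]} {z : ℂ} : z ∈ zer P F ↔ z ∈ P ∧ ev z F = 0 := by
  simp [zer]

theorem exists_rich (S : Finset ℂ) (𝓕 : Finset ℂ[X][X]) (N : ℕ)
    (h : ∀ z ∈ S, ∃ F ∈ 𝓕, ev z F = 0) (hS : 𝓕.card * N < S.card) :
    ∃ F ∈ 𝓕, N < (zer S F).card := by
  classical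
  by_contra! hcon
  have h1 : S ⊆ 𝓕.biUnion (zer S) := fun z hz => by
    obtain ⟨F, hF, h0⟩ := h z hz
    exact Finset.mem_biUnion.2 ⟨F, hF, mem_zer.2 ⟨hz, h0⟩⟩
  have h2 := Finset.card_le_card h1
  have h3 := Finset.card_biUnion_le_card_mul 𝓕 (zer S) N hcon
  omega

theorem exists_dvd {S : Finset ℂ} {𝓕 : Finset ℂ[X][X]} {g : ℂ[X][X]} (hg : Irreducible g)
    (hgd : Bideg 3 g) (h𝓕 : ∀ F ∈ 𝓕, Bideg 3 F) (hz : ∀ z ∈ S, ev z g = 0)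
    (h : ∀ z ∈ S, ∃ F ∈ 𝓕, ev z F = 0) (hS : 𝓕.card * 18 < S.card) : ∃ F ∈ 𝓕, g ∣ F := by
  obtain ⟨F, hF, hc⟩ := exists_rich S 𝓕 18 h hS
  exact ⟨F, hF, dvd_of_many_zeros hg hgd (h𝓕 F hF) _ hc fun z hz' =>
    ⟨hz z (mem_zer.1 hz').1, (mem_zer.1 hz').2⟩⟩

theorem card_zer_inter_le {P : Finset ℂ} {g F : ℂ[X][X]} (hg : Irreducible g) (hgd : Bideg 3 g)
    (hF : Bideg 3 F) (h : ¬ g ∣ F) : (zer (zer P g) F).card ≤ 18 := by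
  by_contra! hc
  refine h (dvd_of_many_zeros hg hgd hF _ hc fun z hz => ?_)
  obtain ⟨h1, h2⟩ := mem_zer.1 hz
  exact ⟨(mem_zer.1 h1).2, h2⟩

/-- The constant in the count of flags without a lattice. -/
def badConst (R : ℕ) : ℕ := 24 * 5 ^ (5 * R + 7)

namespace View

variable {P : Finset ℂ}

/-- The exceptional set `E` is small, if at many centres no lattice avoids it. -/
theorem card_exceptional_le {K : ℝ} (hn : 100 ≤ P.card)
    (hK : (ordinaryGenCircles (P : Set ℂ) : ℝ) ≤ K * (P.card : ℝ) ^ 2) (V : ℂ → View P)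
    (hV : ∀ x ∈ P, (V x).x = x) {E X : Finset ℂ} (hE : E ⊆ P) (hX : X ⊆ P) (hXE : Disjoint X E)
    (hX4 : P.card ≤ 4 * X.card) (hE6 : 6000 * E.card ≤ P.card)
    (hD : ∀ C, IsGenCircle C → (∃ p ∈ E, p ∈ C) →
      ∃ Z : Finset ℂ, Z.card ≤ 36 ∧ ∀ z ∈ P, z ∉ E → z ∈ C → z ∈ Z)
    (h : ∀ x ∈ X, ∀ f : (V x).A.Flag, (V x).inv f.p ∈ E → f.Lat 50 →
      ∃ j ≤ 40, (V x).inv (f.lineB j) ∈ E ∨ (V x).inv (f.lineC j) ∈ E) :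
    (E.card : ℝ) ≤ 216 * badConst 50 * K := by
  classical
  have key : ∀ x ∈ X, 2 * P.card * E.card ≤ 36 * badConst 50 * (V x).A.n₂ := by
    intro x hx
    have hxP := hX hx
    have hxE := Finset.disjoint_left.1 hXE hx
    have hx' := hV x hxP
    set S := (P \ E).erase x
    have neE : ∀ z ∈ E, z ≠ (V x).x := fun z hz e => hxE (by rw [hx'] at e; exact e ▸ hz)
    have neS : ∀ z ∈ S, z ≠ (V x).x := fun z hz e =>
      Finset.ne_of_mem_erase hz (by rw [hx'] at e; exact e)
    have injE : Set.InjOn (V x).im E := fun a ha b hb e => (V x).im_inj (neE a ha) (neE b hb) e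
    have injS : Set.InjOn (V x).im S := fun a ha b hb e => (V x).im_inj (neS a ha) (neS b hb) e
    have sP : ∀ z ∈ S, z ∈ P ∧ z ∉ E := fun z hz => Finset.mem_sdiff.1 (Finset.mem_of_mem_erase hz)
    have cS : S.card + 1 + E.card = P.card := by
      rw [Finset.card_erase_add_one (Finset.mem_sdiff.2 ⟨hxP, hxE⟩), Finset.card_sdiff_of_subset hE]
      exact Nat.sub_add_cancel (Finset.card_le_card hE)
    have memE : ∀ w ∈ (V x).A.pts, w ∈ E.image (V x).im ↔ (V x).inv w ∈ E := fun w hw => by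
      rw [Finset.mem_image]
      constructor
      · rintro ⟨z, hz, rfl⟩
        rwa [(V x).inv_im (neE z hz)]
      · exact fun h => ⟨_, h, (V x).im_inv (ne_zero hw)⟩
    have main := (V x).A.card_mul_le_n₂ (R := 50) (T := 40) (D := 36) (E.image (V x).im)
      (S.image (V x).im) ?_ ?_ ?_ (by norm_num) ?_ ?_
    · rw [Finset.card_image_of_injOn injE, Finset.card_image_of_injOn injS] at main
      change _ ≤ 36 * (badConst 50 * _ + _) at main
      have : 36 * (badConst 50 * (V x).A.n₂) = 36 * badConst 50 * (V x).A.n₂ := by ring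
      nlinarith
    · exact Finset.image_subset_iff.2 fun z hz => (V x).im_mem (hE hz) (neE z hz)
    · exact Finset.image_subset_iff.2 fun z hz => (V x).im_mem (sP z hz).1 (neS z hz)
    · rw [Finset.disjoint_left]
      rintro w hw hw'
      obtain ⟨z, hz, rfl⟩ := Finset.mem_image.1 hw
      obtain ⟨z', hz', e⟩ := Finset.mem_image.1 hw'
      have := (V x).im_inj (neS z' hz') (neE z hz) e
      exact (sP z' hz').2 (this ▸ hz)
    · intro p hp v hv
      obtain ⟨q, hq, rfl⟩ := Finset.mem_image.1 hp
      obtain ⟨Z, hZ, hZ'⟩ := hD _ ((V x).isGenCircle v) ⟨q, hq, ((V x).mem_circ (neE q hq)).2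
        ((V x).A.mem_onV.1 hv).2⟩
      refine le_trans (Finset.card_le_card_of_injOn (V x).inv (t := Z) ?_ ?_) hZ
      · intro w hw
        obtain ⟨hw, hon⟩ := Finset.mem_filter.1 (Finset.mem_coe.1 hw)
        obtain ⟨z, hz, rfl⟩ := Finset.mem_image.1 hw
        rw [(V x).inv_im (neS z hz)]
        exact Finset.mem_coe.2 (hZ' z (sP z hz).1 (sP z hz).2
          (((V x).mem_circ (neS z hz)).2 hon))
      · intro a ha b hb e
        obtain ⟨y, hy, rfl⟩ := Finset.mem_image.1 (Finset.mem_filter.1 (Finset.mem_coe.1 ha)).1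
        obtain ⟨z, hz, rfl⟩ := Finset.mem_image.1 (Finset.mem_filter.1 (Finset.mem_coe.1 hb)).1
        rw [(V x).inv_im (neS y hy), (V x).inv_im (neS z hz)] at e
        rw [e]
    · intro f hf hL
      obtain ⟨j, hj, hh⟩ := h x hx f ((memE _ f.hp).1 hf) hL
      exact ⟨j, hj, hh.imp (memE _ (f.lineB_mem j)).2 (memE _ (f.lineC_mem j)).2⟩
  have h1 := Finset.sum_le_sum key
  rw [Finset.sum_const, smul_eq_mul, ← Finset.mul_sum] at h1
  have h2 : ∑ x ∈ X, (V x).A.n₂ ≤ ∑ x ∈ P, (V x).A.n₂ := Finset.sum_le_sum_of_subset hX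
  have h3 := h2.trans (sum_n₂_le V hV)
  have h4 : P.card * (2 * P.card * E.card) ≤
      4 * (36 * badConst 50 * (3 * ordinaryGenCircles (P : Set ℂ))) :=
    calc P.card * (2 * P.card * E.card) ≤ 4 * X.card * (2 * P.card * E.card) :=
          Nat.mul_le_mul_right _ hX4
      _ = 4 * (X.card * (2 * P.card * E.card)) := by ring
      _ ≤ _ := Nat.mul_le_mul_left _ (h1.trans (Nat.mul_le_mul_left _ h3))
  have h5 : (P.card : ℝ) * (2 * P.card * E.card) ≤
      4 * (36 * badConst 50 * (3 * (ordinaryGenCircles (P : Set ℂ) : ℝ))) := by exact_mod_cast h4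
  have hpos : (0 : ℝ) < 2 * (P.card : ℝ) ^ 2 := by
    have : (0 : ℝ) < P.card := by exact_mod_cast (by omega : 0 < P.card)
    positivity
  refine le_of_mul_le_mul_left ?_ hpos
  have h6 : (432 * badConst 50 : ℝ) * ordinaryGenCircles (P : Set ℂ) ≤
      432 * badConst 50 * (K * (P.card : ℝ) ^ 2) := mul_le_mul_of_nonneg_left hK (by positivity)
  linarith

end View

/-- A generalised circle leaving an irreducible curve meets it in few points. -/
theorem IsGenCircle.card_le {C : Set ℂ} (hC : IsGenCircle C) {g : ℂ[X][X]} (hg : Irreducible g)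
    (hgd : Bideg 3 g) {a : ℕ} (h1 : g.natDegree = a + 1)
    (h2 : (Bivariate.swap g).natDegree = a + 1) {p : ℂ} (hp : p ∈ C) (hpg : ev p g ≠ 0) :
    ∃ Z : Finset ℂ, Z.card ≤ 18 ∧ ∀ z ∈ C, ev z g = 0 → z ∈ Z := by
  obtain ⟨F, hF, h0, hz⟩ := hC.exists_poly
  obtain ⟨Z, hZ, h⟩ := exists_common_zeros hg hgd (hF.mono (by norm_num)) (fun hd => by
    obtain ⟨k, rfl⟩ := hd
    have hb := bideg_of_mul hF h0 h1 h2
    rw [show 1 - (a + 1) = 0 by omega] at hb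
    have := (hz p).1 hp
    rw [map_mul] at this
    exact mul_ne_zero hpg
      (ev_ne_zero_of_isUnit (isUnit_of_bideg_zero hb (right_ne_zero_of_mul h0)) p) this)
  exact ⟨Z, hZ, fun z h1 h2 => h z h2 ((hz z).1 h1)⟩

open Classical in
/-- The points of `P` off the curve `F = 0`. -/
def off (P : Finset ℂ) (F : ℂ[X][X]) : Finset ℂ := P.filter fun z => ev z F ≠ 0

theorem mem_off {P : Finset ℂ} {F : ℂ[X][X]} {z : ℂ} : z ∈ off P F ↔ z ∈ P ∧ ev z F ≠ 0 := by
  simp [off]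

theorem card_zer_add_card_off (P : Finset ℂ) (F : ℂ[X][X]) :
    (zer P F).card + (off P F).card = P.card := by
  classical
  unfold zer off
  convert Finset.card_filter_add_card_filter_not (s := P) (fun z => ev z F = 0)

namespace View

variable {P : Finset ℂ}

/-- The count on an irreducible quartic. -/
theorem card_off_le_of_natDegree_two {K : ℝ} (hn : 300 ≤ P.card)
    (hK : (ordinaryGenCircles (P : Set ℂ) : ℝ) ≤ K * (P.card : ℝ) ^ 2) (V : ℂ → View P)
    (hV : ∀ x ∈ P, (V x).x = x) {g : ℂ[X][X]} (hg : Irreducible g) (hgd : Bideg 2 g)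
    (h1 : g.natDegree = 2) (h2 : (Bivariate.swap g).natDegree = 2)
    (hE6 : 6000 * (off P g).card ≤ P.card) : ((off P g).card : ℝ) ≤ 216 * badConst 50 * K := by
  classical
  have hg3 := hgd.mono (show 2 ≤ 3 by norm_num)
  obtain ⟨Z, hZ, hsing⟩ := exists_singular hg hg3 (by omega)
  have hc := card_zer_add_card_off P g
  refine card_exceptional_le (by omega) hK V hV (X := zer P g \ Z) (fun z hz => (mem_off.1 hz).1)
    (fun z hz => (mem_zer.1 (Finset.mem_sdiff.1 hz).1).1) ?_ ?_ hE6 ?_ ?_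
  · exact Finset.disjoint_left.2 fun z hz hz' =>
      (mem_off.1 hz').2 (mem_zer.1 (Finset.mem_sdiff.1 hz).1).2
  · have := Finset.le_card_sdiff Z (zer P g)
    omega
  · rintro C hC ⟨p, hp, hpC⟩
    obtain ⟨Y, hY, h⟩ := hC.card_le hg hg3 h1 h2 hpC (mem_off.1 hp).2
    refine ⟨Y, by omega, fun z hz hzE hzC => h z hzC ?_⟩
    by_contra h0
    exact hzE (mem_off.2 ⟨hz, h0⟩)
  · intro x hx f hf hL
    obtain ⟨hx, hxZ⟩ := Finset.mem_sdiff.1 hx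
    obtain ⟨hxP, hxg⟩ := mem_zer.1 hx
    have hx' := hV x hxP
    by_contra! hcon
    have hA : 2 * 50 + 1 < (V x).A.pts.card := by
      have := (V x).card_pts
      omega
    obtain ⟨k, hk, hk0⟩ := f.exists_mem_J hL hA (by norm_num)
    obtain ⟨vA, vB, -⟩ := f.J_vanish hL hA hk (n := 18) (by norm_num) (by norm_num)
    have G := hL.grid hA
    have hdvd : g ∣ (V x).pull k := by
      refine dvd_of_many_zeros hg hg3 ((V x).bideg_pull k)
        ((Finset.range 19).image fun i => (V x).inv (f.lineB i)) ?_ ?_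
      · rw [Finset.card_image_of_injOn, Finset.card_range]
        · norm_num
        · intro i hi j hj e
          have hi := Finset.mem_range.1 (Finset.mem_coe.1 hi)
          have hj := Finset.mem_range.1 (Finset.mem_coe.1 hj)
          exact G.inj_b i (by omega) j (by omega) (inv_inj (G.mem_b i) (G.mem_b j) e)
      · intro z hz
        obtain ⟨i, hi, rfl⟩ := Finset.mem_image.1 hz
        have hi := Finset.mem_range.1 hi
        refine ⟨?_, (ev_pull_inv (G.mem_b i) k).2 (vB i (by omega))⟩
        by_contra h0
        exact (hcon i (by omega)).1 (mem_off.2 ⟨inv_mem (G.mem_b i), h0⟩)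
    have hreg : ev (V x).x (derivative g) ≠ 0 := fun e => hxZ (hsing x hxg (hx' ▸ e))
    refine (mem_off.1 hf).2 ((pull_of_natDegree_two hk0 hdvd h1 h2).2 hreg _ (inv_ne f.hp) ?_)
    rw [ev_pull_inv f.hp]
    exact vA 0 (by omega)

/-- On a lattice, a curve of bidegree `(1, 1)` containing two points of a triple contains the
third. -/
theorem ev_eq_zero_of_triple {W : View P} {g : ℂ[X][X]} (hgd : Bideg 1 g) (h0 : g ≠ 0)
    (hx : ev W.x g = 0) {v : ℝ × ℝ} {a b c : ℂ} (ha : a ∈ W.A.pts) (hb : b ∈ W.A.pts)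
    (hc : c ∈ W.A.pts) (hbc : b ≠ c) (va : On v a) (vb : On v b) (vc : On v c)
    (gb : ev (W.inv b) g = 0) (gc : ev (W.inv c) g = 0) : ev (W.inv a) g = 0 := by
  obtain ⟨α, β, γ, -, h⟩ := linAt_of_bideg_one W.hu hgd h0 hx
  have key : ∀ w ∈ W.A.pts, ev (W.inv w) g = 0 ↔ α * w + β * conj w + γ = 0 := fun w hw => by
    rw [h _ (inv_ne hw)]
    have : W.u / (W.inv w - W.x) = w := W.im_inv (ne_zero hw)
    rw [this]
  rw [key _ ha]
  exact lin_collinear vb vc va hbc ((key _ hb).1 gb) ((key _ hc).1 gc)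

/-- The count on a generalised circle. -/
theorem card_off_le_of_natDegree_one {K : ℝ} (hn : 300 ≤ P.card)
    (hK : (ordinaryGenCircles (P : Set ℂ) : ℝ) ≤ K * (P.card : ℝ) ^ 2) (V : ℂ → View P)
    (hV : ∀ x ∈ P, (V x).x = x) {g : ℂ[X][X]} (hg : Irreducible g) (hgd : Bideg 1 g)
    (h1 : g.natDegree = 1) (h2 : (Bivariate.swap g).natDegree = 1)
    (hE6 : 6000 * (off P g).card ≤ P.card) : ((off P g).card : ℝ) ≤ 216 * badConst 50 * K := by
  classical
  have hg3 := hgd.mono (show 1 ≤ 3 by norm_num)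
  have hc := card_zer_add_card_off P g
  refine card_exceptional_le (by omega) hK V hV (X := zer P g) (fun z hz => (mem_off.1 hz).1)
    (fun z hz => (mem_zer.1 hz).1) ?_ (by omega) hE6 ?_ ?_
  · exact Finset.disjoint_left.2 fun z hz hz' => (mem_off.1 hz').2 (mem_zer.1 hz).2
  · rintro C hC ⟨p, hp, hpC⟩
    obtain ⟨Y, hY, h⟩ := hC.card_le hg hg3 h1 h2 hpC (mem_off.1 hp).2
    refine ⟨Y, by omega, fun z hz hzE hzC => h z hzC ?_⟩
    by_contra h0
    exact hzE (mem_off.2 ⟨hz, h0⟩)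
  · intro x hx f hf hL
    obtain ⟨hxP, hxg⟩ := mem_zer.1 hx
    by_contra! hcon
    have hA : 2 * 50 + 1 < (V x).A.pts.card := by
      have := (V x).card_pts
      omega
    have G := hL.grid hA
    have hz : ∀ w ∈ (V x).A.pts, (V x).inv w ∉ off P g → ev ((V x).inv w) g = 0 := fun w hw h => by
      by_contra h0
      exact h (mem_off.2 ⟨inv_mem hw, h0⟩)
    refine (mem_off.1 hf).2 (ev_eq_zero_of_triple hgd hg.ne_zero ((hV x hxP).symm ▸ hxg) f.hp
      (f.lineB_mem 0) (f.lineC_mem 0) (G.bc 0 (by norm_num) 0 (by norm_num)) (f.on_p 0)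
      (f.on_lineB 0) (f.on_lineC 0) (hz _ (f.lineB_mem 0) (hcon 0 (by norm_num)).1)
      (hz _ (f.lineC_mem 0) (hcon 0 (by norm_num)).2))

end View

open Classical in
/-- The points of a curve cocircular with three points of `E`. -/
theorem card_cocircular_le {E S : Finset ℂ} {g : ℂ[X][X]} (hg : Irreducible g)
    (h1 : g.natDegree = 1) (h2 : (Bivariate.swap g).natDegree = 1)
    (hE : ∀ z ∈ E, ev z g ≠ 0) (hS : ∀ z ∈ S, ev z g = 0) :
    (S.filter fun x => ∃ a ∈ E, ∃ b ∈ E, ∃ c ∈ E, a ≠ b ∧ a ≠ c ∧ b ≠ c ∧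
      ∃ C, IsGenCircle C ∧ a ∈ C ∧ b ∈ C ∧ c ∈ C ∧ x ∈ C).card ≤ 18 * E.card ^ 3 := by
  have hsub : (S.filter fun x => ∃ a ∈ E, ∃ b ∈ E, ∃ c ∈ E, a ≠ b ∧ a ≠ c ∧ b ≠ c ∧
      ∃ C, IsGenCircle C ∧ a ∈ C ∧ b ∈ C ∧ c ∈ C ∧ x ∈ C) ⊆ (E ×ˢ E ×ˢ E).biUnion fun t =>
      S.filter fun x => t.1 ≠ t.2.1 ∧ t.1 ≠ t.2.2 ∧ t.2.1 ≠ t.2.2 ∧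
      ∃ C, IsGenCircle C ∧ t.1 ∈ C ∧ t.2.1 ∈ C ∧ t.2.2 ∈ C ∧ x ∈ C := by
    intro x hx
    obtain ⟨hx, a, ha, b, hb, c, hc, h⟩ := Finset.mem_filter.1 hx
    exact Finset.mem_biUnion.2 ⟨(a, b, c), Finset.mem_product.2 ⟨ha, Finset.mem_product.2 ⟨hb, hc⟩⟩,
      Finset.mem_filter.2 ⟨hx, h⟩⟩
  refine (Finset.card_le_card hsub).trans ((Finset.card_biUnion_le_card_mul _ _ 18 ?_).trans
    (le_of_eq ?_))
  · rintro ⟨a, b, c⟩ ht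
    have ha : a ∈ E := (Finset.mem_product.1 ht).1
    by_cases h : ∃ C, IsGenCircle C ∧ a ∈ C ∧ b ∈ C ∧ c ∈ C ∧ a ≠ b ∧ a ≠ c ∧ b ≠ c
    · obtain ⟨C, hC, haC, hbC, hcC, hab, hac, hbc⟩ := h
      obtain ⟨Z, hZ, hz⟩ := hC.card_le hg (a := 0) ⟨by omega, by omega⟩ h1 h2 haC (hE a ha)
      refine (Finset.card_le_card fun x hx => ?_).trans hZ
      obtain ⟨hx, -, -, -, D, hD, haD, hbD, hcD, hxD⟩ := Finset.mem_filter.1 hx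
      have e := hC.eq_of_three hD hab.symm hac.symm hbc haC hbC hcC haD hbD hcD
      exact hz x (e ▸ hxD) (hS x hx)
    · rw [Finset.filter_eq_empty_iff.2, Finset.card_empty]
      · norm_num
      · rintro x - ⟨hab, hac, hbc, C, hC, haC, hbC, hcC, -⟩
        exact h ⟨C, hC, haC, hbC, hcC, hab, hac, hbc⟩
  · rw [Finset.card_product, Finset.card_product]; ring

theorem nineteen_of_or {p q : ℕ → Prop} (h : ∀ j, 1 ≤ j → j ≤ 37 → p j ∨ q j) :
    (∃ s : Finset ℕ, 18 < s.card ∧ ∀ j ∈ s, 1 ≤ j ∧ j ≤ 37 ∧ p j) ∨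
      ∃ s : Finset ℕ, 18 < s.card ∧ ∀ j ∈ s, 1 ≤ j ∧ j ≤ 37 ∧ q j := by
  classical
  have hc := Finset.card_filter_add_card_filter_not (s := Finset.Icc 1 37) p
  rw [Nat.card_Icc] at hc
  by_cases h1 : 18 < ((Finset.Icc 1 37).filter p).card
  · refine .inl ⟨_, h1, fun j hj => ?_⟩
    obtain ⟨hj, hp⟩ := Finset.mem_filter.1 hj
    exact ⟨(Finset.mem_Icc.1 hj).1, (Finset.mem_Icc.1 hj).2, hp⟩
  · refine .inr ⟨(Finset.Icc 1 37).filter fun j => ¬ p j, by omega, fun j hj => ?_⟩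
    obtain ⟨hj, hp⟩ := Finset.mem_filter.1 hj
    have hj := Finset.mem_Icc.1 hj
    exact ⟨hj.1, hj.2, (h j hj.1 hj.2).resolve_left hp⟩

namespace View

variable {P : Finset ℂ}

/-- The core of the count on two generalised circles. -/
theorem exists_cocircular {W : View P} (hA : 2 * 50 + 1 < W.A.pts.card) {g₁ g₂ : ℂ[X][X]}
    (hg₁ : Irreducible g₁) (hg₂ : Irreducible g₂) (hb₁ : Bideg 1 g₁) (hb₂ : Bideg 1 g₂)
    (h1 : g₂.natDegree = 1) (h2 : (Bivariate.swap g₂).natDegree = 1)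
    (hx₁ : ev W.x g₁ = 0) (hx₂ : ev W.x g₂ ≠ 0) {f : W.A.Flag} (hL : f.Lat 50)
    (hp : W.inv f.p ∈ off P (g₁ * g₂))
    (hcon : ∀ j ≤ 40, W.inv (f.lineB j) ∉ off P (g₁ * g₂) ∧
      W.inv (f.lineC j) ∉ off P (g₁ * g₂)) :
    ∃ a ∈ off P (g₁ * g₂), ∃ b ∈ off P (g₁ * g₂), ∃ c ∈ off P (g₁ * g₂),
      a ≠ b ∧ a ≠ c ∧ b ≠ c ∧ ∃ C, IsGenCircle C ∧ a ∈ C ∧ b ∈ C ∧ c ∈ C ∧ W.x ∈ C := by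
  classical
  have G := hL.grid hA
  have hoff : ∀ w ∈ W.A.pts, W.inv w ∈ off P (g₁ * g₂) ↔ ev (W.inv w) g₁ ≠ 0 ∧ ev (W.inv w) g₂ ≠ 0 :=
    fun w hw => by rw [mem_off, map_mul, mul_ne_zero_iff]; exact and_iff_right (inv_mem hw)
  have hp' := (hoff _ f.hp).1 hp
  have htwo : ∀ j, 1 ≤ j → j ≤ 37 → ev (W.inv (f.lineB j)) g₂ = 0 ∨ ev (W.inv (f.lineC j)) g₂ = 0 := by
    intro j _ hj
    by_contra! hne
    obtain ⟨hB, hC⟩ := hcon j (by omega)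
    rw [hoff _ (f.lineB_mem j)] at hB
    rw [hoff _ (f.lineC_mem j)] at hC
    have hB : ev (W.inv (f.lineB j)) g₁ = 0 := by by_contra h; exact hB ⟨h, hne.1⟩
    have hC : ev (W.inv (f.lineC j)) g₁ = 0 := by by_contra h; exact hC ⟨h, hne.2⟩
    exact hp'.1 (ev_eq_zero_of_triple hb₁ hg₁.ne_zero hx₁ f.hp (f.lineB_mem j) (f.lineC_mem j)
      (G.bc j (by omega) j (by omega)) (f.on_p j) (f.on_lineB j) (f.on_lineC j) hB hC)
  obtain ⟨k, hk, hk0⟩ := f.exists_mem_J hL hA (by norm_num)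
  obtain ⟨-, vB, vC⟩ := f.J_vanish hL hA hk (n := 40) (by norm_num) (by norm_num)
  have hb3 := hb₂.mono (show 1 ≤ 3 by norm_num)
  have hdvd : g₂ ∣ W.pull k := by
    rcases nineteen_of_or htwo with ⟨s, hs, h⟩ | ⟨s, hs, h⟩
    · refine dvd_of_many_zeros hg₂ hb3 (W.bideg_pull k)
        (s.image fun i => W.inv (f.lineB i)) ?_ fun z hz => ?_
      · rw [Finset.card_image_of_injOn]
        · exact hs
        · intro i hi j hj e
          have hi := h i hi
          have hj := h j hj
          exact G.inj_b i (by omega) j (by omega) (inv_inj (G.mem_b i) (G.mem_b j) e)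
      · obtain ⟨i, hi, rfl⟩ := Finset.mem_image.1 hz
        obtain ⟨_, _, hi⟩ := h i hi
        exact ⟨hi, (ev_pull_inv (G.mem_b i) k).2 (vB i (by omega))⟩
    · refine dvd_of_many_zeros hg₂ hb3 (W.bideg_pull k)
        (s.image fun i => W.inv (f.lineC i)) ?_ fun z hz => ?_
      · rw [Finset.card_image_of_injOn]
        · exact hs
        · intro i hi j hj e
          have hi := h i hi
          have hj := h j hj
          exact G.inj_c i (by omega) j (by omega) (inv_inj (G.mem_c i) (G.mem_c j) e)
      · obtain ⟨i, hi, rfl⟩ := Finset.mem_image.1 hz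
        obtain ⟨hi1, _, hi⟩ := h i hi
        refine ⟨hi, (ev_pull_inv (G.mem_c i) k).2 ?_⟩
        have := vC (i - 1) (by omega)
        rwa [Nat.sub_add_cancel hi1] at this
  obtain ⟨v, hv⟩ := concurrent hL hA hk hk0 hdvd h1 h2 hx₂ hp'.2 (W := 3) (by norm_num)
  have inj : ∀ i ≤ 3, ∀ j ≤ 3, i ≠ j → f.lineA i ≠ f.lineA j := fun i hi j hj h e =>
    h (G.inj_a i (by omega) j (by omega) e)
  have hone : ∀ i ≤ 3, ∀ j ≤ 3, i ≠ j → ev (W.inv (f.lineA i)) g₁ = 0 →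
      ev (W.inv (f.lineA j)) g₁ ≠ 0 := fun i hi j hj hij h h' =>
    hp'.1 (ev_eq_zero_of_triple hb₁ hg₁.ne_zero hx₁ (G.mem_a 0) (G.mem_a i) (G.mem_a j)
      (inj i hi j hj hij) (hv 0 (by omega)).1 (hv i hi).1 (hv j hj).1 h h')
  have done : ∀ i j, i ≤ 3 → j ≤ 3 → 0 ≠ i → 0 ≠ j → i ≠ j → ev (W.inv (f.lineA i)) g₁ ≠ 0 →
      ev (W.inv (f.lineA j)) g₁ ≠ 0 → ∃ a ∈ off P (g₁ * g₂), ∃ b ∈ off P (g₁ * g₂),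
      ∃ c ∈ off P (g₁ * g₂), a ≠ b ∧ a ≠ c ∧ b ≠ c ∧
      ∃ C, IsGenCircle C ∧ a ∈ C ∧ b ∈ C ∧ c ∈ C ∧ W.x ∈ C := by
    intro i j hi hj h0i h0j hij hgi hgj
    have ne : ∀ i ≤ 3, ∀ j ≤ 3, i ≠ j → W.inv (f.lineA i) ≠ W.inv (f.lineA j) :=
      fun i hi j hj h e => inj i hi j hj h (inv_inj (G.mem_a i) (G.mem_a j) e)
    have onC : ∀ i ≤ 3, W.inv (f.lineA i) ∈ W.circ v := fun i hi =>
      (W.inv_mem_circ (G.mem_a i)).2 (hv i hi).1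
    exact ⟨_, hp, _, (hoff _ (G.mem_a i)).2 ⟨hgi, (hv i hi).2⟩, _,
      (hoff _ (G.mem_a j)).2 ⟨hgj, (hv j hj).2⟩, ne 0 (by omega) i hi h0i, ne 0 (by omega) j hj h0j,
      ne i hi j hj hij, _, W.isGenCircle v, onC 0 (by omega), onC i hi, onC j hj, W.self_mem v⟩
  by_cases a1 : ev (W.inv (f.lineA 1)) g₁ = 0
  · exact done 2 3 (by omega) (by omega) (by omega) (by omega) (by omega)
      (hone 1 (by omega) 2 (by omega) (by omega) a1) (hone 1 (by omega) 3 (by omega) (by omega) a1)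
  · by_cases a2 : ev (W.inv (f.lineA 2)) g₁ = 0
    · exact done 1 3 (by omega) (by omega) (by omega) (by omega) (by omega) a1
        (hone 2 (by omega) 3 (by omega) (by omega) a2)
    · exact done 1 2 (by omega) (by omega) (by omega) (by omega) (by omega) a1 a2

/-- The count on two generalised circles. -/
theorem card_off_mul_le {K : ℝ} (hn : 1000 ≤ P.card)
    (hK : (ordinaryGenCircles (P : Set ℂ) : ℝ) ≤ K * (P.card : ℝ) ^ 2) (V : ℂ → View P)
    (hV : ∀ x ∈ P, (V x).x = x) {g₁ g₂ : ℂ[X][X]} (hg₁ : Irreducible g₁) (hg₂ : Irreducible g₂)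
    (h1 : g₁.natDegree = 1) (h2 : (Bivariate.swap g₁).natDegree = 1)
    (h1' : g₂.natDegree = 1) (h2' : (Bivariate.swap g₂).natDegree = 1) (hnd : ¬ g₁ ∣ g₂)
    {e : ℕ} (he : (off P (g₁ * g₂)).card ≤ e) (hne : 6000 * e + 1000 * e ^ 3 ≤ P.card)
    (hc₁ : P.card ≤ 3 * (zer P g₁).card) :
    ((off P (g₁ * g₂)).card : ℝ) ≤ 216 * badConst 50 * K := by
  classical
  have hb₁ : Bideg 1 g₁ := ⟨by omega, by omega⟩
  have hb₂ : Bideg 1 g₂ := ⟨by omega, by omega⟩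
  have hb₁3 := hb₁.mono (show 1 ≤ 3 by norm_num)
  have hb₂3 := hb₂.mono (show 1 ≤ 3 by norm_num)
  have hoff : ∀ z, z ∈ off P (g₁ * g₂) ↔ z ∈ P ∧ ev z g₁ ≠ 0 ∧ ev z g₂ ≠ 0 := fun z => by
    rw [mem_off, map_mul, mul_ne_zero_iff]
  set E := off P (g₁ * g₂) with hE
  set B := (zer P g₁).filter fun x => ∃ a ∈ E, ∃ b ∈ E, ∃ c ∈ E, a ≠ b ∧ a ≠ c ∧ b ≠ c ∧
      ∃ C, IsGenCircle C ∧ a ∈ C ∧ b ∈ C ∧ c ∈ C ∧ x ∈ C with hB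
  have cB : B.card ≤ 18 * e ^ 3 := (card_cocircular_le hg₁ h1 h2 (fun z hz => ((hoff z).1 hz).2.1)
    fun z hz => (mem_zer.1 hz).2).trans (Nat.mul_le_mul_left _ (Nat.pow_le_pow_left he 3))
  have c12 := card_zer_inter_le (P := P) hg₁ hb₁3 hb₂3 hnd
  set X := zer P g₁ \ (B ∪ zer (zer P g₁) g₂) with hX
  have memX : ∀ x ∈ X, x ∈ P ∧ ev x g₁ = 0 ∧ x ∉ B ∧ ev x g₂ ≠ 0 := by
    intro x hx
    obtain ⟨hx, hx'⟩ := Finset.mem_sdiff.1 hx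
    rw [Finset.mem_union, not_or] at hx'
    exact ⟨(mem_zer.1 hx).1, (mem_zer.1 hx).2, hx'.1, fun h => hx'.2 (mem_zer.2 ⟨hx, h⟩)⟩
  refine card_exceptional_le (by omega) hK V hV (X := X) (fun z hz => ((hoff z).1 hz).1)
    (fun z hz => (memX z hz).1) ?_ ?_ (by omega) ?_ ?_
  · exact Finset.disjoint_left.2 fun z hz hz' => ((hoff z).1 hz').2.1 (memX z hz).2.1
  · have a1 := Finset.le_card_sdiff (B ∪ zer (zer P g₁) g₂) (zer P g₁)
    have a2 := Finset.card_union_le B (zer (zer P g₁) g₂)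
    rw [← hX] at a1
    omega
  · rintro C hC ⟨p, hp, hpC⟩
    obtain ⟨-, hp1, hp2⟩ := (hoff p).1 hp
    obtain ⟨Y₁, hY₁, k₁⟩ := hC.card_le hg₁ hb₁3 h1 h2 hpC hp1
    obtain ⟨Y₂, hY₂, k₂⟩ := hC.card_le hg₂ hb₂3 h1' h2' hpC hp2
    refine ⟨Y₁ ∪ Y₂, (Finset.card_union_le _ _).trans (by omega), fun z hz hzE hzC => ?_⟩
    rw [hoff] at hzE
    by_cases h0 : ev z g₁ = 0
    · exact Finset.mem_union_left _ (k₁ z hzC h0)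
    · refine Finset.mem_union_right _ (k₂ z hzC ?_)
      by_contra h0'
      exact hzE ⟨hz, h0, h0'⟩
  · intro x hx f hf hL
    obtain ⟨hxP, hx1, hxB, hx2⟩ := memX x hx
    have hx' := hV x hxP
    by_contra! hcon
    have hA : 2 * 50 + 1 < (V x).A.pts.card := by
      have := (V x).card_pts
      omega
    refine hxB (Finset.mem_filter.2 ⟨mem_zer.2 ⟨hxP, hx1⟩, ?_⟩)
    have := exists_cocircular hA hg₁ hg₂ hb₁ hb₂ h1' h2' (hx'.symm ▸ hx1) (hx'.symm ▸ hx2) hL hf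
      hcon
    rwa [hx'] at this

end View

namespace View

variable {P : Finset ℂ}

open Classical in
/-- Most centres see few ordinary generalised circles. -/
theorem card_poor_mul_le {κ : ℕ} (hκ : 0 < κ) (hP : 0 < P.card)
    (hK : ordinaryGenCircles (P : Set ℂ) ≤ κ * P.card ^ 2) (V : ℂ → View P)
    (hV : ∀ x ∈ P, (V x).x = x) (m : ℕ) :
    (P.filter fun x => ¬ (V x).A.n₂ ≤ 3 * κ * m * P.card).card * m ≤ P.card := by
  have h1 := Finset.card_nsmul_le_sum (P.filter fun x => ¬ (V x).A.n₂ ≤ 3 * κ * m * P.card)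
    (fun x => (V x).A.n₂) (3 * κ * m * P.card) fun x hx => (not_le.1 (Finset.mem_filter.1 hx).2).le
  have h2 := h1.trans ((Finset.sum_le_sum_of_subset (Finset.filter_subset _ P)).trans
    ((sum_n₂_le V hV).trans (Nat.mul_le_mul_left 3 hK)))
  rw [smul_eq_mul] at h2
  refine Nat.le_of_mul_le_mul_left (c := 3 * κ * P.card) ?_ (by positivity)
  calc _ = _ := by ring
    _ ≤ _ := h2
    _ = _ := by ring

/-- A cover of `P` by few curves, based at a point of `S`. -/
theorem exists_cover_at (W : View P) {R H s : ℕ} (hA : 2 * R + 1 < W.A.pts.card) (hR : 6 ≤ R)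
    {S : Finset ℂ} (hS : S ⊆ P) (hx : W.x ∉ S) (hSs : P.card ≤ s * S.card)
    (hH : W.A.n₂ ≤ H * P.card) :
    ∃ p ∈ W.A.pts, W.inv p ∈ S ∧ ∃ 𝓕 : Finset ℂ[X][X],
      𝓕.card ≤ 2 * (badConst R * H * s) + 2 ∧ (∀ F ∈ 𝓕, W.IsCov R p F) ∧
      ∀ z ∈ P, z ≠ W.x → z ≠ W.inv p → ∃ F ∈ 𝓕, ev z F = 0 := by
  classical
  have neS : ∀ z ∈ S, z ≠ W.x := fun z hz e => hx (e ▸ hz)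
  have hpos : 0 < S.card := by
    refine Nat.pos_of_ne_zero fun h => ?_
    have := W.card_pts
    rw [h, mul_zero] at hSs
    omega
  obtain ⟨w, hw, hb⟩ := W.A.exists_few_bad (R := R) (S.image W.im)
    ((Finset.card_pos.1 hpos).image _)
  obtain ⟨z, hz, rfl⟩ := Finset.mem_image.1 hw
  have hp := W.im_mem (hS hz) (neS z hz)
  rw [Finset.card_image_of_injOn fun a ha b hb e => W.im_inj (neS a ha) (neS b hb) e] at hb
  change _ ≤ badConst R * _ at hb
  refine ⟨_, hp, by rw [W.inv_im (neS z hz)]; exact hz, exists_cover hA hR hp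
    (Nat.le_of_mul_le_mul_left (hb.trans ?_) hpos)⟩
  calc badConst R * W.A.n₂ ≤ badConst R * (H * (s * S.card)) :=
        Nat.mul_le_mul_left _ (hH.trans (Nat.mul_le_mul_left _ hSs))
    _ = _ := by ring

/-- A curve with many points divides some member of a cover. -/
theorem exists_cover_dvd {W : View P} {p : ℂ} {𝓕 : Finset ℂ[X][X]} {R M : ℕ} (hM : 𝓕.card ≤ M)
    (h𝓕 : ∀ F ∈ 𝓕, W.IsCov R p F)
    (hcov : ∀ z ∈ P, z ≠ W.x → z ≠ W.inv p → ∃ F ∈ 𝓕, ev z F = 0) {g : ℂ[X][X]}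
    (hg : Irreducible g) (hgd : Bideg 3 g) (hz : 18 * M + 2 < (zer P g).card) :
    ∃ F ∈ 𝓕, g ∣ F := by
  classical
  refine exists_dvd (S := ((zer P g).erase W.x).erase (W.inv p)) hg hgd
    (fun F hF => (h𝓕 F hF).bideg) (fun z hz => ?_) (fun z hz => ?_) ?_
  · exact (mem_zer.1 (Finset.mem_of_mem_erase (Finset.mem_of_mem_erase hz))).2
  · have hz' := Finset.mem_of_mem_erase hz
    exact hcov z (mem_zer.1 (Finset.mem_of_mem_erase hz')).1 (Finset.ne_of_mem_erase hz')
      (Finset.ne_of_mem_erase hz)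
  · have h1 := Finset.pred_card_le_card_erase (s := (zer P g).erase W.x) (a := W.inv p)
    have h2 := Finset.pred_card_le_card_erase (s := zer P g) (a := W.x)
    omega

/-- The degree of a curve with many points. -/
theorem natDegree_of_rich {H : ℕ} (hn : 1000 ≤ P.card) (V : ℂ → View P)
    (hV : ∀ x ∈ P, (V x).x = x) {G : Finset ℂ} (hGP : G ⊆ P)
    (hG : ∀ x ∈ G, (V x).A.n₂ ≤ H * P.card)
    (hGc : (P \ G).card * 6000 ≤ P.card) {g : ℂ[X][X]} (hg : Irreducible g) (hgd : Bideg 3 g)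
    (hz : 18 * (2 * (badConst 50 * H * 2) + 2) + 2 < (zer P g).card) :
    (g.natDegree = 1 ∧ (Bivariate.swap g).natDegree = 1) ∨
      g.natDegree = 2 ∧ (Bivariate.swap g).natDegree = 2 ∧ 6000 * (off P g).card ≤ P.card := by
  classical
  have hS : 18 < (zer P g).card := by omega
  have hzero : ∀ z ∈ zer P g, ev z g = 0 := fun z hz => (mem_zer.1 hz).2
  have h0 := natDegree_pos_of_many_zeros hg hgd hS hzero
  have hsw := natDegree_eq_of_many_zeros hg hgd _ hS hzero
  have h3 := hgd.1
  rw [hsw]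
  by_cases h1 : g.natDegree = 1
  · exact .inl ⟨h1, h1⟩
  have hdiv : ∀ x ∈ G, ∃ k, k ≠ 0 ∧ g ∣ (V x).pull k := by
    intro x hx
    have hA := (V x).card_pts
    obtain ⟨p, -, -, 𝓕, hc, h𝓕, hcov⟩ := (V x).exists_cover_at (R := 50) (H := H) (s := 2) (by omega)
      (by norm_num) (Finset.erase_subset (V x).x P) (Finset.notMem_erase _ _)
      (by rw [Finset.card_erase_of_mem (V x).hx]; omega) (hG x hx)
    obtain ⟨F, hF, hd⟩ := exists_cover_dvd hc h𝓕 hcov hg hgd hz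
    obtain ⟨v, -, hb, hF0, -⟩ | ⟨k, hk, -, rfl⟩ := h𝓕 F hF
    · have := (hb.of_dvd hF0 hd).1
      omega
    · exact ⟨k, hk, hd⟩
  have hcG : (P \ G).card + G.card = P.card := by
    rw [Finset.card_sdiff_of_subset hGP]
    exact Nat.sub_add_cancel (Finset.card_le_card hGP)
  obtain h2 | h3 : g.natDegree = 2 ∨ g.natDegree = 3 := by omega
  · refine .inr ⟨h2, h2, ?_⟩
    have : off P g ⊆ P \ G := fun z hz => by
      obtain ⟨hzP, hzg⟩ := mem_off.1 hz
      refine Finset.mem_sdiff.2 ⟨hzP, fun hzG => hzg ?_⟩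
      obtain ⟨k, hk, hd⟩ := hdiv z hzG
      have := (pull_of_natDegree_two hk hd h2 (hsw.trans h2)).1
      rwa [hV z hzP] at this
    have := Finset.card_le_card this
    omega
  · exfalso
    obtain ⟨Z, hZ, hs⟩ := exists_singular hg hgd h0
    have : G ⊆ Z := fun z hz => by
      obtain ⟨k, hk, hd⟩ := hdiv z hz
      have := pull_of_natDegree_three hk hd h3 (hsw.trans h3)
      rw [hV z (hGP hz)] at this
      exact hs z this.1 this.2
    have := Finset.card_le_card this
    omega

open Classical in
/-- Almost all points lie on few curves with many points. -/
theorem exists_rich_curves {H T : ℕ} (hn : 1000 ≤ P.card) (W : View P)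
    (hW : W.A.n₂ ≤ H * P.card) :
    ∃ 𝒢 : Finset ℂ[X][X], 𝒢.card ≤ 6 * (2 * (badConst 50 * H * 2) + 2) ∧
      (∀ g ∈ 𝒢, Irreducible g ∧ Bideg 3 g ∧ T < (zer P g).card) ∧
      (P.filter fun z => ∀ g ∈ 𝒢, ev z g ≠ 0).card ≤
        6 * (2 * (badConst 50 * H * 2) + 2) * T + 2 := by
  have hA := W.card_pts
  obtain ⟨p, -, -, 𝓕, hc, h𝓕, hcov⟩ := W.exists_cover_at (R := 50) (H := H) (s := 2) (by omega)
      (by norm_num) (Finset.erase_subset W.x P) (Finset.notMem_erase _ _)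
      (by rw [Finset.card_erase_of_mem W.hx]; omega) hW
  generalize 2 * (badConst 50 * H * 2) + 2 = M at *
  have hfac : ∀ F : ℂ[X][X], ∃ 𝒢 : Finset ℂ[X][X], F ∈ 𝓕 → 𝒢.card ≤ 6 ∧
      (∀ g ∈ 𝒢, Irreducible g ∧ g ∣ F) ∧ ∀ z, ev z F = 0 → ∃ g ∈ 𝒢, ev z g = 0 := by
    intro F
    by_cases hF : F ∈ 𝓕
    · obtain ⟨𝒢, h⟩ := exists_factors 6 F (h𝓕 F hF).ne_zero
        (by have := (h𝓕 F hF).bideg; have := this.1; have := (h𝓕 F hF).bideg.2; omega)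
      exact ⟨𝒢, fun _ => h⟩
    · exact ⟨∅, fun h => absurd h hF⟩
  choose fac hfac using hfac
  set 𝒜 := 𝓕.biUnion fac with h𝒜
  have c𝒜 : 𝒜.card ≤ 6 * M := (Finset.card_biUnion_le_card_mul 𝓕 fac 6 fun F hF =>
    (hfac F hF).1).trans (by omega)
  refine ⟨𝒜.filter fun g => T < (zer P g).card, (Finset.card_filter_le _ _).trans c𝒜, ?_, ?_⟩
  · intro g hg
    obtain ⟨hg, hT⟩ := Finset.mem_filter.1 hg
    obtain ⟨F, hF, hg⟩ := Finset.mem_biUnion.1 hg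
    obtain ⟨hi, hd⟩ := (hfac F hF).2.1 g hg
    exact ⟨hi, (h𝓕 F hF).bideg.of_dvd (h𝓕 F hF).ne_zero hd, hT⟩
  · have hsub : (P.filter fun z => ∀ g ∈ 𝒜.filter fun g => T < (zer P g).card, ev z g ≠ 0) ⊆
        ((𝒜.filter fun g => ¬ T < (zer P g).card).biUnion (zer P)) ∪ {W.x, W.inv p} := by
      intro z hz
      obtain ⟨hzP, hz⟩ := Finset.mem_filter.1 hz
      by_cases hx : z = W.x
      · exact Finset.mem_union_right _ (by simp [hx])
      by_cases hp : z = W.inv p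
      · exact Finset.mem_union_right _ (by simp [hp])
      obtain ⟨F, hF, h0⟩ := hcov z hzP hx hp
      obtain ⟨g, hg, h0⟩ := (hfac F hF).2.2 z h0
      have hg : g ∈ 𝒜 := Finset.mem_biUnion.2 ⟨F, hF, hg⟩
      exact Finset.mem_union_left _ (Finset.mem_biUnion.2 ⟨g, Finset.mem_filter.2 ⟨hg, fun h =>
        hz g (Finset.mem_filter.2 ⟨hg, h⟩) h0⟩, mem_zer.2 ⟨hzP, h0⟩⟩)
    refine (Finset.card_le_card hsub).trans ((Finset.card_union_le _ _).trans
      (add_le_add ?_ Finset.card_le_two))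
    exact (Finset.card_biUnion_le_card_mul _ _ T fun g hg =>
      not_lt.1 (Finset.mem_filter.1 hg).2).trans (Nat.mul_le_mul_right _
        ((Finset.card_filter_le _ _).trans c𝒜))

end View

open Classical in
/-- Few points of an irreducible curve lie on the other curves. -/
theorem card_zer_le_avoid {P : Finset ℂ} {𝒢 : Finset ℂ[X][X]} (h𝒢 : ∀ g ∈ 𝒢, Bideg 3 g)
    {g : ℂ[X][X]} (hg : Irreducible g) (hgd : Bideg 3 g) :
    (zer P g).card ≤ ((zer P g).filter fun z => ∀ h ∈ 𝒢, ¬ g ∣ h → ev z h ≠ 0).card +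
      18 * 𝒢.card := by
  have hsub : zer P g ⊆ ((zer P g).filter fun z => ∀ h ∈ 𝒢, ¬ g ∣ h → ev z h ≠ 0) ∪
      (𝒢.filter fun h => ¬ g ∣ h).biUnion fun h => zer (zer P g) h := by
    intro z hz
    by_cases h : ∀ h ∈ 𝒢, ¬ g ∣ h → ev z h ≠ 0
    · exact Finset.mem_union_left _ (Finset.mem_filter.2 ⟨hz, h⟩)
    · push Not at h
      obtain ⟨h, hh, hd, h0⟩ := h
      exact Finset.mem_union_right _ (Finset.mem_biUnion.2
        ⟨h, Finset.mem_filter.2 ⟨hh, hd⟩, mem_zer.2 ⟨hz, h0⟩⟩)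
  refine (Finset.card_le_card hsub).trans ((Finset.card_union_le _ _).trans
    (Nat.add_le_add_left ?_ _))
  refine (Finset.card_biUnion_le_card_mul _ _ 18 fun h hh => card_zer_inter_le hg hgd
    (h𝒢 h (Finset.mem_filter.1 hh).1) (Finset.mem_filter.1 hh).2).trans ?_
  rw [mul_comm]
  exact Nat.mul_le_mul_left _ (Finset.card_filter_le _ _)

/-- The bound for the number of points on a third curve. -/
def thirdBound (κ q y d : ℕ) : ℕ :=
  18 * (2 * (badConst (y + 18 * q + 6) * (3 * κ * (2 * d)) * (2 * d)) + 2) + 2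

namespace View

variable {P : Finset ℂ}

open Classical in
/-- If two generalised circles contain many points, then a third one does not. -/
theorem card_zer_third_le {κ q y d : ℕ} (hκ : 0 < κ)
    (hn : 100 * d * (q + 1) + 100 * (y + 18 * q + 100) ≤ P.card)
    (hK : ordinaryGenCircles (P : Set ℂ) ≤ κ * P.card ^ 2) (V : ℂ → View P)
    (hV : ∀ x ∈ P, (V x).x = x) {𝒢 : Finset ℂ[X][X]} (hq : 𝒢.card ≤ q)
    (h𝒢 : ∀ g ∈ 𝒢, Irreducible g ∧ g.natDegree = 1 ∧ (Bivariate.swap g).natDegree = 1)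
    (hy : (P.filter fun z => ∀ g ∈ 𝒢, ev z g ≠ 0).card ≤ y) {g₁ g₂ g₃ : ℂ[X][X]} (hg₁ : g₁ ∈ 𝒢)
    (hg₂ : g₂ ∈ 𝒢) (hg₃ : g₃ ∈ 𝒢) (h₁₂ : ¬ g₁ ∣ g₂) (h₁₃ : ¬ g₁ ∣ g₃) (h₂₃ : ¬ g₂ ∣ g₃)
    (hc₁ : P.card ≤ d * (zer P g₁).card) (hc₂ : P.card ≤ d * (zer P g₂).card) :
    (zer P g₃).card ≤ thirdBound κ q y d := by
  have hb : ∀ g ∈ 𝒢, Bideg 3 g := fun g hg => ⟨by have := h𝒢 g hg; omega, by have := h𝒢 g hg; omega⟩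
  have hd0 : 0 < d := Nat.pos_of_ne_zero fun h => by subst h; omega
  have hbig : 36 * d * (q + 1) < P.card := by nlinarith
  set B := P.filter fun x => ¬ (V x).A.n₂ ≤ 3 * κ * (2 * d) * P.card with hB
  have cB : B.card * (2 * d) ≤ P.card := card_poor_mul_le hκ (by omega) hK V hV (2 * d)
  have c₁ := card_zer_le_avoid (P := P) hb (h𝒢 g₁ hg₁).1 (hb g₁ hg₁)
  have c₂ := card_zer_le_avoid (P := P) hb (h𝒢 g₂ hg₂).1 (hb g₂ hg₂)
  set S₁ := (zer P g₁).filter fun z => ∀ h ∈ 𝒢, ¬ g₁ ∣ h → ev z h ≠ 0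
  set S := (zer P g₂).filter fun z => ∀ h ∈ 𝒢, ¬ g₂ ∣ h → ev z h ≠ 0 with hS
  obtain ⟨x, hx₁, hxB⟩ : ∃ x ∈ S₁, x ∉ B := by
    by_contra! h
    have := Finset.card_le_card (show S₁ ⊆ B from h)
    have h1 : (zer P g₁).card ≤ B.card + 18 * q := by omega
    have h2 := Nat.mul_le_mul_left d h1
    nlinarith
  obtain ⟨hx₁, hxav⟩ := Finset.mem_filter.1 hx₁
  obtain ⟨hxP, hx₁⟩ := mem_zer.1 hx₁
  have hx' := hV x hxP
  have hxH : (V x).A.n₂ ≤ 3 * κ * (2 * d) * P.card := by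
    by_contra h
    exact hxB (Finset.mem_filter.2 ⟨hxP, h⟩)
  have hSc : P.card ≤ 2 * d * S.card := by
    have h1 : (zer P g₂).card ≤ S.card + 18 * q := by omega
    have h2 := Nat.mul_le_mul_left d h1
    nlinarith
  have hxS : (V x).x ∉ S := fun h => by
    rw [hx'] at h
    exact hxav g₂ hg₂ h₁₂ (mem_zer.1 (Finset.mem_filter.1 h).1).2
  have hA := (V x).card_pts
  set R := y + 18 * q + 6 with hR
  have hA' : 2 * R + 1 < (V x).A.pts.card := by omega
  obtain ⟨p, hp, hpS, 𝓕, hc, h𝓕, hcov⟩ := (V x).exists_cover_at hA' (by omega)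
    (fun z hz => (mem_zer.1 (Finset.mem_filter.1 hz).1).1) hxS hSc hxH
  obtain ⟨hp₂, hpav⟩ := Finset.mem_filter.1 hpS
  by_contra! hcon
  obtain ⟨F, hF, hdvd⟩ := exists_cover_dvd hc h𝓕 hcov (h𝒢 g₃ hg₃).1 (hb g₃ hg₃) hcon
  obtain ⟨-, h31, h32⟩ := h𝒢 g₃ hg₃
  obtain ⟨v, hv, hF1, hF0, hFv⟩ | ⟨k, hk, ⟨f, rfl, hL, hkJ⟩, rfl⟩ := h𝓕 F hF
  · refine hpav g₃ hg₃ h₂₃ ?_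
    rw [ev_eq_zero_iff_of_associated (associated_of_bideg_one h31 h32 hF1 hF0 hdvd), ← hFv,
      (V x).inv_mem_circ hp]
    exact hv
  · obtain ⟨v, hv⟩ := concurrent hL hA' hkJ hk hdvd h31 h32 (by rw [hx']; exact hxav g₃ hg₃ h₁₃)
      (hpav g₃ hg₃ h₂₃) (W := y + 18 * q) (by omega)
    have G := hL.grid hA'
    set T := (Finset.range (y + 18 * q + 1)).image fun i => (V x).inv (f.lineA i) with hT
    have cT : T.card = y + 18 * q + 1 := by
      rw [Finset.card_image_of_injOn, Finset.card_range]
      intro i hi j hj e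
      have hi := Finset.mem_range.1 (Finset.mem_coe.1 hi)
      have hj := Finset.mem_range.1 (Finset.mem_coe.1 hj)
      exact G.inj_a i (by omega) j (by omega) (inv_inj (G.mem_a i) (G.mem_a j) e)
    have hTv : ∀ z ∈ T, z ∈ P ∧ z ∈ (V x).circ v := fun z hz => by
      obtain ⟨i, hi, rfl⟩ := Finset.mem_image.1 hz
      have hi := Finset.mem_range.1 hi
      exact ⟨inv_mem (G.mem_a i), ((V x).inv_mem_circ (G.mem_a i)).2 (hv i (by omega)).1⟩
    set Y := P.filter fun z => ∀ g ∈ 𝒢, ev z g ≠ 0 with hY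
    obtain ⟨g, hg, hgT⟩ := exists_rich (T \ Y) 𝒢 18 (fun z hz => by
      obtain ⟨hz, hzY⟩ := Finset.mem_sdiff.1 hz
      by_contra! h
      exact hzY (Finset.mem_filter.2 ⟨(hTv z hz).1, h⟩)) (by
      have := Finset.le_card_sdiff Y T
      omega)
    obtain ⟨hgi, hg1, hg2⟩ := h𝒢 g hg
    obtain ⟨C, hC1, hC0, hCv⟩ := ((V x).isGenCircle v).exists_poly
    have hgC : g ∣ C := dvd_of_many_zeros hgi (hb g hg) (hC1.mono (by norm_num)) _ hgT fun z hz => by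
      obtain ⟨hz, h0⟩ := mem_zer.1 hz
      exact ⟨h0, (hCv z).1 (hTv z (Finset.mem_sdiff.1 hz).1).2⟩
    have hev : ∀ z, z ∈ (V x).circ v ↔ ev z g = 0 := fun z => by
      rw [hCv, ev_eq_zero_iff_of_associated (associated_of_bideg_one hg1 hg2 hC1 hC0 hgC)]
    have d1 : g₁ ∣ g := by
      by_contra h
      refine hxav g hg h ((hev x).1 ?_)
      have := (V x).self_mem v
      rwa [hx'] at this
    have d2 : g₂ ∣ g := by
      by_contra h
      exact hpav g hg h ((hev _).1 (((V x).inv_mem_circ hp).2 (hv 0 (by omega)).1))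
    exact h₁₂ (d1.trans ((h𝒢 g₂ hg₂).1.dvd_symm hgi d2))

end View

open Classical in
/-- Either one curve contains almost all points, or two of them contain many. -/
theorem exists_two_rich {P : Finset ℂ} {q y : ℕ} (hn : 12000 * (q + 1) * (y + 1) < P.card)
    {𝒢 : Finset ℂ[X][X]} (hq : 𝒢.card ≤ q) (h𝒢 : ∀ g ∈ 𝒢, Irreducible g)
    (hy : (P.filter fun z => ∀ g ∈ 𝒢, ev z g ≠ 0).card ≤ y) :
    (∃ g ∈ 𝒢, 6000 * (off P g).card ≤ P.card) ∨ ∃ g₁ ∈ 𝒢, ∃ g₂ ∈ 𝒢, ¬ g₁ ∣ g₂ ∧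
      (zer P g₂).card ≤ (zer P g₁).card ∧ P.card ≤ 12000 * (q + 1) * (zer P g₂).card := by
  set Y := P.filter fun z => ∀ g ∈ 𝒢, ev z g ≠ 0 with hY
  have hyn : 12000 * y < P.card := by nlinarith
  have hne : 𝒢.Nonempty := by
    rw [Finset.nonempty_iff_ne_empty]
    rintro rfl
    rw [show Y = P by simp [hY]] at hy
    omega
  obtain ⟨g₁, hg₁, hmax⟩ := Finset.exists_max_image 𝒢 (fun g => (zer P g).card) hne
  by_cases h6 : 6000 * (off P g₁).card ≤ P.card
  · exact .inl ⟨g₁, hg₁, h6⟩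
  obtain ⟨g₂, hg₂, hc⟩ := exists_rich (off P g₁ \ Y) (𝒢.filter fun g => ¬ g₁ ∣ g)
      (P.card / (12000 * (q + 1))) (fun z hz => by
    obtain ⟨hz, hzY⟩ := Finset.mem_sdiff.1 hz
    obtain ⟨hzP, hz1⟩ := mem_off.1 hz
    have : ∃ g ∈ 𝒢, ev z g = 0 := by
      by_contra! h
      exact hzY (Finset.mem_filter.2 ⟨hzP, h⟩)
    obtain ⟨g, hg, h0⟩ := this
    refine ⟨g, Finset.mem_filter.2 ⟨hg, fun hd => hz1 ?_⟩, h0⟩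
    obtain ⟨c, hc⟩ := (h𝒢 g₁ hg₁).dvd_symm (h𝒢 g hg) hd
    rw [hc, map_mul, h0, zero_mul]) (by
    have a1 := Finset.le_card_sdiff Y (off P g₁)
    have a2 := Finset.card_filter_le 𝒢 fun g => ¬ g₁ ∣ g
    have a3 := Nat.div_mul_le_self P.card (12000 * (q + 1))
    have a4 := Nat.mul_le_mul_right (P.card / (12000 * (q + 1))) ((a2.trans hq).trans q.le_succ)
    have a5 : 12000 * (q.succ * (P.card / (12000 * (q + 1)))) ≤ P.card := by
      refine le_trans (le_of_eq ?_) a3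
      rw [Nat.succ_eq_add_one]; ring
    omega)
  obtain ⟨hg₂, hnd⟩ := Finset.mem_filter.1 hg₂
  refine .inr ⟨g₁, hg₁, g₂, hg₂, hnd, hmax g₂ hg₂, ?_⟩
  have h1 : (zer (off P g₁ \ Y) g₂).card ≤ (zer P g₂).card := Finset.card_le_card fun z hz => by
    obtain ⟨hz, h0⟩ := mem_zer.1 hz
    exact mem_zer.2 ⟨(mem_off.1 (Finset.mem_sdiff.1 hz).1).1, h0⟩
  exact ((Nat.div_lt_iff_lt_mul (by positivity)).1 (hc.trans_le h1)).le.trans_eq (mul_comm _ _)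

/-- Almost all points lie on a curve of bidegree `(2, 2)`. -/
theorem exists_bideg_two (κ : ℕ) (hκ : 0 < κ) : ∃ N : ℕ, ∀ P : Finset ℂ, N ≤ P.card → ∀ K : ℝ,
    0 < K → ordinaryGenCircles (P : Set ℂ) ≤ κ * P.card ^ 2 →
    (ordinaryGenCircles (P : Set ℂ) : ℝ) ≤ K * (P.card : ℝ) ^ 2 →
    ∃ F : ℂ[X][X], Bideg 2 F ∧ F ≠ 0 ∧ ((off P F).card : ℝ) ≤ 216 * badConst 50 * K := by
  classical
  obtain ⟨H, hH⟩ : ∃ H, H = 3 * κ * 6000 := ⟨_, rfl⟩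
  obtain ⟨M, hM⟩ : ∃ M, M = 2 * (badConst 50 * H * 2) + 2 := ⟨_, rfl⟩
  obtain ⟨q, hq⟩ : ∃ q, q = 6 * M := ⟨_, rfl⟩
  obtain ⟨y, hy⟩ : ∃ y, y = q * (18 * M + 2) + 2 := ⟨_, rfl⟩
  obtain ⟨d, hd⟩ : ∃ d, d = 12000 * (q + 1) := ⟨_, rfl⟩
  obtain ⟨e, he⟩ : ∃ e, e = y + q * thirdBound κ q y d := ⟨_, rfl⟩
  refine ⟨1000 + 12000 * (q + 1) * (y + 1) + 1 + (100 * d * (q + 1) + 100 * (y + 18 * q + 100)) +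
    (6000 * e + 1000 * e ^ 3), fun P hN K hK0 hκP hKP => ?_⟩
  by_cases hP : ∃ C, IsGenCircle C ∧ (P : Set ℂ) ⊆ C
  · obtain ⟨C, hC, hPC⟩ := hP
    obtain ⟨F, hF, h0, hz⟩ := hC.exists_poly
    refine ⟨F, hF.mono (by norm_num), h0, ?_⟩
    have : off P F = ∅ := Finset.eq_empty_of_forall_notMem fun z hz' =>
      (mem_off.1 hz').2 ((hz z).1 (hPC (mem_off.1 hz').1))
    rw [this, Finset.card_empty, Nat.cast_zero]
    exact mul_nonneg (mul_nonneg (by norm_num) (Nat.cast_nonneg _)) hK0.le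
  push Not at hP
  obtain ⟨V, hV⟩ := exists_views hP
  set G := P.filter fun x => (V x).A.n₂ ≤ H * P.card with hG
  have cG : (P \ G).card * 6000 ≤ P.card := by
    have := View.card_poor_mul_le hκ (by omega) hκP V hV 6000
    rwa [Finset.filter_not, ← hH] at this
  obtain ⟨x₀, hx₀⟩ : G.Nonempty := by
    rw [Finset.nonempty_iff_ne_empty]
    intro h
    rw [h, Finset.sdiff_empty] at cG
    omega
  obtain ⟨𝒢, c𝒢, h𝒢, cY⟩ := View.exists_rich_curves (T := 18 * M + 2) (by omega) (V x₀)
    (Finset.mem_filter.1 hx₀).2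
  rw [← hM, ← hq] at c𝒢 cY
  rw [← hy] at cY
  have hdeg := fun g hg => View.natDegree_of_rich (by omega) V hV (Finset.filter_subset _ P)
    (fun x hx => (Finset.mem_filter.1 hx).2) cG (h𝒢 g hg).1 (h𝒢 g hg).2.1
    (hM ▸ (h𝒢 g hg).2.2)
  by_cases htwo : ∃ g ∈ 𝒢, g.natDegree = 2
  · obtain ⟨g, hg, h2⟩ := htwo
    obtain h | ⟨h1, h2, h6⟩ := hdeg g hg
    · omega
    · have hb : Bideg 2 g := ⟨h1.le, h2.le⟩
      exact ⟨g, hb, (h𝒢 g hg).1.ne_zero,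
        View.card_off_le_of_natDegree_two (by omega) hKP V hV (h𝒢 g hg).1 hb h1 h2 h6⟩
  push Not at htwo
  have hone : ∀ g ∈ 𝒢, Irreducible g ∧ g.natDegree = 1 ∧ (Bivariate.swap g).natDegree = 1 :=
    fun g hg => ⟨(h𝒢 g hg).1, (hdeg g hg).resolve_right fun h => htwo g hg h.1⟩
  have hb1 : ∀ g ∈ 𝒢, Bideg 1 g := fun g hg => ⟨(hone g hg).2.1.le, (hone g hg).2.2.le⟩
  obtain ⟨g, hg, h6⟩ | ⟨g₁, hg₁, g₂, hg₂, hnd, hle, hc₂⟩ :=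
    exists_two_rich (by omega) c𝒢 (fun g hg => (hone g hg).1) cY
  · obtain ⟨hi, h1, h2⟩ := hone g hg
    exact ⟨g, (hb1 g hg).mono (by norm_num), hi.ne_zero,
      View.card_off_le_of_natDegree_one (by omega) hKP V hV hi (hb1 g hg) h1 h2 h6⟩
  · obtain ⟨hi₁, h11, h12⟩ := hone g₁ hg₁
    obtain ⟨hi₂, h21, h22⟩ := hone g₂ hg₂
    have hoff : (off P (g₁ * g₂)).card ≤ e := by
      have hsub : off P (g₁ * g₂) ⊆ (P.filter fun z => ∀ g ∈ 𝒢, ev z g ≠ 0) ∪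
          (𝒢.filter fun g => ¬ g₁ ∣ g ∧ ¬ g₂ ∣ g).biUnion (zer P) := by
        intro z hz
        obtain ⟨hzP, hz⟩ := mem_off.1 hz
        rw [map_mul, mul_ne_zero_iff] at hz
        by_cases h : ∀ g ∈ 𝒢, ev z g ≠ 0
        · exact Finset.mem_union_left _ (Finset.mem_filter.2 ⟨hzP, h⟩)
        · push Not at h
          obtain ⟨g, hg, h0⟩ := h
          have key : ∀ g' ∈ 𝒢, ev z g' ≠ 0 → ¬ g' ∣ g := fun g' hg' hne hd => by
            obtain ⟨c, hc⟩ := (hone g' hg').1.dvd_symm (hone g hg).1 hd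
            exact hne (by rw [hc, map_mul, h0, zero_mul])
          exact Finset.mem_union_right _ (Finset.mem_biUnion.2 ⟨g, Finset.mem_filter.2
            ⟨hg, key g₁ hg₁ hz.1, key g₂ hg₂ hz.2⟩, mem_zer.2 ⟨hzP, h0⟩⟩)
      rw [he]
      refine (Finset.card_le_card hsub).trans ((Finset.card_union_le _ _).trans
        (add_le_add cY ?_))
      refine (Finset.card_biUnion_le_card_mul _ _ (thirdBound κ q y d) fun g hg => ?_).trans
        (Nat.mul_le_mul_right _ ((Finset.card_filter_le _ _).trans c𝒢))
      obtain ⟨hg, hn1, hn2⟩ := Finset.mem_filter.1 hg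
      exact View.card_zer_third_le hκ (by omega) hκP V hV c𝒢 hone cY hg₁ hg₂ hg hnd hn1 hn2
        (hd ▸ hc₂.trans (Nat.mul_le_mul_left _ hle)) (hd ▸ hc₂)
    have hthree : P.card ≤ 3 * (zer P g₁).card := by
      have h1 : P ⊆ (zer P g₁ ∪ zer P g₂) ∪ off P (g₁ * g₂) := fun z hz => by
        by_cases h1 : ev z g₁ = 0
        · exact Finset.mem_union_left _ (Finset.mem_union_left _ (mem_zer.2 ⟨hz, h1⟩))
        by_cases h2 : ev z g₂ = 0
        · exact Finset.mem_union_left _ (Finset.mem_union_right _ (mem_zer.2 ⟨hz, h2⟩))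
        · exact Finset.mem_union_right _ (mem_off.2 ⟨hz, by rw [map_mul]; exact mul_ne_zero h1 h2⟩)
      have h2 := Finset.card_le_card h1
      have h3 := Finset.card_union_le (zer P g₁ ∪ zer P g₂) (off P (g₁ * g₂))
      have h4 := Finset.card_union_le (zer P g₁) (zer P g₂)
      omega
    exact ⟨g₁ * g₂, (hb1 g₁ hg₁).mul (hb1 g₂ hg₂), mul_ne_zero hi₁.ne_zero hi₂.ne_zero,
      View.card_off_mul_le (by omega) hKP V hV hi₁ hi₂ h11 h12 h21 h22 hnd hoff (by omega) hthree⟩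

end

/-- Weak structure theorem: a set of `n` points spanning at most `Kn²` ordinary
generalised circles has all but `O(K)` of its points on a bicircular quartic
`t(x² + y²)² + (ux + vy)(x² + y²) + q(x,y) = 0` with `q` a nonzero polynomial of
degree at most two. -/
theorem weak_structure_theorem :
    ∃ c : ℝ, ∀ K : ℝ, 0 < K → ∃ N : ℕ, ∀ n : ℕ, N ≤ n →
      ∀ P : Finset ℂ, P.card = n →
        (ordinaryGenCircles (P : Set ℂ) : ℝ) ≤ K * (n : ℝ) ^ 2 →
        ∃ (t u v : ℝ) (q : MvPolynomial (Fin 2) ℝ), q ≠ 0 ∧ q.totalDegree ≤ 2 ∧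
          (({z : ℂ | z ∈ (P : Set ℂ) ∧
              ¬ (t * (z.re ^ 2 + z.im ^ 2) ^ 2 +
                  (u * z.re + v * z.im) * (z.re ^ 2 + z.im ^ 2) +
                  MvPolynomial.eval ![z.re, z.im] q = 0)}).ncard : ℝ) ≤ c * K := by
  refine ⟨216 * badConst 50, fun K hK => ?_⟩
  obtain ⟨κ, hκ⟩ := exists_nat_ge K
  obtain ⟨N, hN⟩ := exists_bideg_two (κ + 1) κ.succ_pos
  refine ⟨N, ?_⟩
  rintro n hn P rfl hP
  have hP' : ordinaryGenCircles (P : Set ℂ) ≤ (κ + 1) * P.card ^ 2 := by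
    have : (ordinaryGenCircles (P : Set ℂ) : ℝ) ≤ (κ + 1) * (P.card : ℝ) ^ 2 :=
      hP.trans (mul_le_mul_of_nonneg_right (by linarith) (by positivity))
    exact_mod_cast this
  obtain ⟨F, hF, h0, hoff⟩ := hN P hn K hK hP' hP
  obtain ⟨t, u, v, q, hq0, hq2, hq⟩ := exists_quartic hF h0
  refine ⟨t, u, v, q, hq0, hq2, le_trans ?_ hoff⟩
  rw [← Set.ncard_coe_finset, Nat.cast_le]
  refine Set.ncard_le_ncard ?_ (Finset.finite_toSet _)
  rintro z ⟨hz, hne⟩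
  exact Finset.mem_coe.2 (mem_off.2 ⟨hz, fun h => hne (hq z h)⟩)
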